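/- Let X be S^d, ℝ^d or H^d with d ≥ 2, and let K, L ⊊ X be proper closed convex sets with interior points such that the connected components of the boundaries of both K and L are congruent spheres (for S^d of radius at most π/2), or paraspheres, or congruent hyperspheres (degeneration to hyperplanes not admitted), where in the case of congruent spheres or paraspheres either K and L are congruent balls (for S^d of radius at most π/2) or they are paraballs. Then, for each pair of orientation-preserving congruences φ, ψ with int((φK) ∩ (ψL)) ≠ ∅ and each x ∈ bd K, y ∈ bd L, there exists ε = ε(K,L,x,y) > 0 such that whenever (A) diam((φK) ∩ (ψL)) < ε, (B) (φK) ∩ (ψL) has a unique inball B₀, and (C) bd((φK) ∩ (ψL)) ∩ bd B₀ = {φx, ψy} with φx ∈ int(ψL) and ψy ∈ int(φK) antipodal on bd B₀, the set (φK) ∩ (ψL) is symmetric with respect to the orthogonal bisector hyperplane of the segment [φx, ψy]. -/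

import Mathlib

open Metric Set Filter

namespace BallChar

/-- `X` is (isometric to) the `d`-dimensional round sphere of radius 1,
with the intrinsic (great-circle) metric. -/
def IsSphereSpace (X : Type*) [MetricSpace X] (d : ℕ) : Prop :=
  ∃ e : X → EuclideanSpace ℝ (Fin (d + 1)),
    Function.Injective e ∧
    Set.range e = Metric.sphere (0 : EuclideanSpace ℝ (Fin (d + 1))) 1 ∧
    ∀ x y : X, dist x y = Real.arccos (@inner ℝ _ _ (e x) (e y))

/-- `X` is (isometric to) the `d`-dimensional Euclidean space. -/
def IsEuclideanSpaceForm (X : Type*) [MetricSpace X] (d : ℕ) : Prop :=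
  Nonempty (X ≃ᵢ EuclideanSpace ℝ (Fin d))

/-- The Minkowski bilinear form on `ℝ^d × ℝ`. -/
noncomputable def mink (d : ℕ) (u v : EuclideanSpace ℝ (Fin d) × ℝ) : ℝ :=
  @inner ℝ _ _ u.1 v.1 - u.2 * v.2

/-- `X` is (isometric to) the `d`-dimensional hyperbolic space of curvature `-1`
(the hyperboloid model). -/
def IsHyperbolicSpace (X : Type*) [MetricSpace X] (d : ℕ) : Prop :=
  ∃ e : X → EuclideanSpace ℝ (Fin d) × ℝ,
    Function.Injective e ∧
    Set.range e = {u | mink d u u = -1 ∧ 0 < u.2} ∧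
    ∀ x y : X, Real.cosh (dist x y) = - mink d (e x) (e y)

/-- `X` is `S^d`, `ℝ^d` or `H^d`. -/
def IsSpaceForm (X : Type*) [MetricSpace X] (d : ℕ) : Prop :=
  IsSphereSpace X d ∨ IsEuclideanSpaceForm X d ∨ IsHyperbolicSpace X d

variable {X : Type*} [MetricSpace X]

/-- Metric betweenness: `z` lies on a shortest geodesic from `x` to `y`. -/
def Btw (x z y : X) : Prop := dist x z + dist z y = dist x y

/-- `z` is the unique point between `x` and `y` at its distance from `x`. -/
def UniqueBtwPt (x z y : X) : Prop :=
  Btw x z y ∧ ∀ w, Btw x w y → dist x w = dist x z → w = z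

/-- Geodesic convexity (for two antipodal points of a sphere no condition is imposed). -/
def GConvex (K : Set X) : Prop :=
  ∀ x ∈ K, ∀ y ∈ K, ∀ z, UniqueBtwPt x z y → z ∈ K

/-- `p` is a (metric) midpoint of `x` and `y`. -/
def IsMidpoint (p x y : X) : Prop := Btw x p y ∧ dist x p = dist p y

/-- A reflection in a hyperplane: a non-trivial involutive isometry whose
non-fixed locus is disconnected (by the mirror hyperplane). -/
def IsReflection (σ : X ≃ᵢ X) : Prop :=
  σ.trans σ = IsometryEquiv.refl X ∧ σ ≠ IsometryEquiv.refl X ∧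
    ¬ IsPreconnected {x : X | σ x ≠ x}

/-- An orientation preserving congruence: a product of an even number of reflections. -/
def OrientationPreserving (f : X ≃ᵢ X) : Prop :=
  ∃ l : List (X ≃ᵢ X), (∀ σ ∈ l, IsReflection σ) ∧ Even l.length ∧
    f = l.foldr IsometryEquiv.trans (IsometryEquiv.refl X)

/-- Two subsets are congruent if some isometry of the space maps one onto the other. -/
def Congruent (A B : Set X) : Prop := ∃ f : X ≃ᵢ X, ⇑f '' A = B

/-- `S` admits some non-trivial congruence. -/
def AdmitsNontrivialCongruence (S : Set X) : Prop :=
  ∃ f : X ≃ᵢ X, f ≠ IsometryEquiv.refl X ∧ ⇑f '' S = S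

/-- `S` is axially symmetric (symmetric with respect to some reflection). -/
def AxiallySymmetric (S : Set X) : Prop :=
  ∃ σ : X ≃ᵢ X, IsReflection σ ∧ ⇑σ '' S = S

/-- `S` is centrally symmetric: some involutive isometry fixing a point `p`
maps `S` onto itself, `p` being a midpoint of every pair `x`, `σ x` of `S`. -/
def CentrallySymmetric (S : Set X) : Prop :=
  ∃ (σ : X ≃ᵢ X) (p : X), Function.Involutive ⇑σ ∧ σ p = p ∧ ⇑σ '' S = S ∧
    ∀ x ∈ S, IsMidpoint p x (σ x)

/-- `S` is symmetric with respect to the orthogonal bisector hyperplane of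
the segment `[a, b]`, i.e. invariant under the reflection interchanging `a` and `b`. -/
def SymmetricWrtPerpBisector (S : Set X) (a b : X) : Prop :=
  ∃ σ : X ≃ᵢ X, IsReflection σ ∧ σ a = b ∧ ⇑σ '' S = S

/-- A closed half-space: one of the two closed sides of the mirror of a reflection. -/
def IsHalfspace (P : Set X) : Prop :=
  ∃ σ : X ≃ᵢ X, IsReflection σ ∧ IsClosed P ∧
    P ∪ ⇑σ '' P = univ ∧ P ∩ ⇑σ '' P = {x | σ x = x}

/-- A hyperplane: the mirror (fixed point set) of a reflection. -/
def IsHyperplane (B : Set X) : Prop :=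
  ∃ σ : X ≃ᵢ X, IsReflection σ ∧ B = {x | σ x = x}

/-- A paraball (horoball): a sublevel set of a Busemann function. -/
def IsParaball (K : Set X) : Prop :=
  ∃ γ : ℝ → X, Isometry γ ∧
    K = {x | ∃ b ≤ 0, Tendsto (fun t => dist x (γ t) - t) atTop (nhds b)}

/-- A parasphere (horosphere): the boundary of a paraball. -/
def IsParasphere (C : Set X) : Prop := ∃ K : Set X, IsParaball K ∧ C = frontier K

/-- A hypersphere at distance `lam > 0` from its base hyperplane
(degeneration to a hyperplane excluded). -/
def IsHypersphere (C : Set X) (lam : ℝ) : Prop :=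
  0 < lam ∧ (∃ P : Set X, IsHalfspace P ∧ C = frontier {x | infDist x P ≤ lam}) ∧
    ¬ IsHyperplane C

/-- The family of connected components of the boundary of `K`. -/
def bdryComponents (K : Set X) : Set (Set X) :=
  (connectedComponentIn (frontier K)) '' (frontier K)

/-- `closedBall p r` is an inball of `M` (a ball of maximal radius contained in `M`). -/
def IsInball (M : Set X) (p : X) (r : ℝ) : Prop :=
  0 ≤ r ∧ closedBall p r ⊆ M ∧ ∀ (q : X) (s : ℝ), closedBall q s ⊆ M → s ≤ r

/-- `closedBall p r` is the unique inball of `M`. -/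
def HasUniqueInball (M : Set X) (p : X) (r : ℝ) : Prop :=
  IsInball M p r ∧ ∀ (q : X) (s : ℝ), IsInball M q s → q = p

/-- The (geodesic) convex hull of a set. -/
def gconvexHull (Y : Set X) : Set X := ⋂₀ {C : Set X | GConvex C ∧ Y ⊆ C}

/-- `z` lies on the complete geodesic line through `a` and `b`. -/
def OnLine (a b z : X) : Prop := Btw a z b ∨ Btw z a b ∨ Btw a b z

/-- The closed `(d-1)`-ball of radius `ε` centred at `a` in the hyperplane through `a`
orthogonal to the segment `[a, b]`. -/
def perpDisc (a b : X) (ε : ℝ) : Set X :=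
  {x | (∀ z, OnLine a b z → dist x a ≤ dist x z) ∧ dist x a ≤ ε}

/-- The set `D(ε)` associated to the segment `D = [a, b]`: the convex hull of the two
`(d-1)`-balls of radius `ε` orthogonal to `D` at its endpoints. -/
def segCyl (a b : X) (ε : ℝ) : Set X :=
  gconvexHull (perpDisc a b ε ∪ perpDisc b a ε)

/-- `[a, b]` is the unique diametral segment of `M`. -/
def UniqueDiametral (M : Set X) (a b : X) : Prop :=
  a ∈ M ∧ b ∈ M ∧ a ≠ b ∧ dist a b = diam M ∧
    ∀ a' ∈ M, ∀ b' ∈ M, dist a' b' = diam M → (a' = a ∧ b' = b) ∨ (a' = b ∧ b' = a)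

/-- Condition (**): at every boundary point, `K` contains a ball having this point
on its boundary. -/
def CondBallInside (K : Set X) : Prop :=
  ∀ x ∈ frontier K, ∃ ε > 0, ∃ p : X, closedBall p ε ⊆ K ∧ x ∈ sphere p ε

/-- `K` has an extreme point. -/
def HasExtremePoint (K : Set X) : Prop :=
  ∃ x ∈ K, ∀ y ∈ K, ∀ z ∈ K, Btw y x z → x = y ∨ x = z

/-- Condition (***): near every boundary point, `K` is contained in a ball
(resp. in a convex set bounded by a hypersphere, for hyperbolic space) whose boundary
has sectional curvatures bounded below and passes through the given point. -/
def CondCurvBound (d : ℕ) (K : Set X) : Prop :=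
  ∀ x ∈ frontier K, ∃ ε > 0, ∃ B : Set X,
    {y | y ∈ K ∧ dist y x ≤ ε} ⊆ B ∧ x ∈ frontier B ∧
    (IsSphereSpace X d → ∃ (q : X) (R : ℝ), 0 < R ∧ R < Real.pi / 2 ∧
        ε ≤ Real.cos R / Real.sin R ∧ B = closedBall q R) ∧
    (IsEuclideanSpaceForm X d → ∃ (q : X) (R : ℝ), 0 < R ∧ ε ≤ 1 / R ∧ B = closedBall q R) ∧
    (IsHyperbolicSpace X d → ∃ (P : Set X) (lam : ℝ), IsHalfspace P ∧ 0 < lam ∧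
        ε ≤ Real.tanh lam ∧ B = {y | infDist y P ≤ lam})

/-- `K` has a supporting sphere at each of its boundary points
(for the sphere, of radius less than `π/2`). -/
def SupportingSpheres (d : ℕ) (K : Set X) : Prop :=
  ∀ x ∈ frontier K, ∃ (p : X) (R : ℝ), 0 < R ∧ K ⊆ closedBall p R ∧ x ∈ sphere p R ∧
    (IsSphereSpace X d → R < Real.pi / 2)

/-- `K` is `C¹` (smooth): at each boundary point there is a unique supporting half-space. -/
def SmoothBody (K : Set X) : Prop :=
  ∀ x ∈ frontier K, ∃! P : Set X, IsHalfspace P ∧ K ⊆ P ∧ x ∈ frontier P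

/-- A complete geodesic (straight line). -/
def IsGeodesicLine (B : Set X) : Prop := ∃ γ : ℝ → X, Isometry γ ∧ B = Set.range γ

/-- A circle (closed disc) of positive radius. -/
def IsDisc (K : Set X) : Prop := ∃ (p : X) (r : ℝ), 0 < r ∧ K = closedBall p r

/-- The parallel domain of `B` at distance `l`. -/
def parallelDomain (B : Set X) (l : ℝ) : Set X := {x | infDist x B ≤ l}

/-- `K` is the parallel domain of some straight line, at some distance `l > 0`. -/
def IsParallelDomain (K : Set X) : Prop :=
  ∃ (B : Set X) (l : ℝ), IsGeodesicLine B ∧ 0 < l ∧ K = parallelDomain B l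

/-- A convex domain bounded by a (proper) hypercycle. -/
def IsHypercycleDomain (K : Set X) : Prop :=
  ∃ (P : Set X) (l : ℝ), IsHalfspace P ∧ 0 < l ∧ K = {x | infDist x P ≤ l}

/-- `C` is a hypercycle or a straight line (a curve at constant distance `l ≥ 0`
from its base line). -/
def IsHypercycleOrLine (C : Set X) : Prop :=
  ∃ (P : Set X) (l : ℝ), IsHalfspace P ∧ 0 ≤ l ∧ C = frontier {x | infDist x P ≤ l}

/-- `C` is a hypercycle (or straight line) with base line `B`. -/
def HypercycleWithBase (C B : Set X) : Prop :=
  ∃ (P : Set X) (l : ℝ), IsHalfspace P ∧ 0 ≤ l ∧ frontier P = B ∧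
    C = frontier {x | infDist x P ≤ l}


/-! Cases (A)-(E) of Theorem 5 (hyperbolic plane). -/

/-- One of the basic bodies of case (A). -/
def CaseABody (K : Set X) : Prop :=
  IsDisc K ∨ IsParaball K ∨ IsHypercycleDomain K ∨ IsHalfspace K

/-- Case (A) of Theorem 5. -/
def CaseA (K L : Set X) : Prop :=
  CaseABody K ∧ CaseABody L ∧
    ((IsHypercycleDomain K ∨ IsHalfspace K) → IsDisc L ∨ Congruent K L) ∧
    ((IsHypercycleDomain L ∨ IsHalfspace L) → IsDisc K ∨ Congruent L K)

/-- `M` is bounded either by two hypercycles whose base lines coincide, or by a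
hypercycle and its base line. -/
def TwoHypSameBase (M : Set X) : Prop :=
  ∃ (B C₁ C₂ : Set X), IsGeodesicLine B ∧ C₁ ≠ C₂ ∧
    HypercycleWithBase C₁ B ∧ HypercycleWithBase C₂ B ∧ frontier M = C₁ ∪ C₂

/-- Case (B) of Theorem 5. -/
def CaseB (K L : Set X) : Prop :=
  (IsDisc K ∧ TwoHypSameBase L) ∨ (IsDisc L ∧ TwoHypSameBase K)

/-- `M` is bounded by at least two hypercycles or straight lines, with all base lines
different, whose mutual distances are at least `2r`. -/
def MultiHypFarApart (M : Set X) (r : ℝ) : Prop :=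
  (∀ x ∈ frontier M, IsHypercycleOrLine (connectedComponentIn (frontier M) x)) ∧
  (∃ x ∈ frontier M, ∃ y ∈ frontier M,
      connectedComponentIn (frontier M) x ≠ connectedComponentIn (frontier M) y) ∧
  (∀ x ∈ frontier M, ∀ y ∈ frontier M,
      connectedComponentIn (frontier M) x ≠ connectedComponentIn (frontier M) y →
        2 * r ≤ dist x y ∧
        ∀ B₁ B₂ : Set X, HypercycleWithBase (connectedComponentIn (frontier M) x) B₁ →
          HypercycleWithBase (connectedComponentIn (frontier M) y) B₂ → B₁ ≠ B₂)

/-- Case (C) of Theorem 5. -/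
def CaseC (K L : Set X) : Prop :=
  (∃ (p : X) (r : ℝ), 0 < r ∧ K = closedBall p r ∧ MultiHypFarApart L r) ∨
  (∃ (p : X) (r : ℝ), 0 < r ∧ L = closedBall p r ∧ MultiHypFarApart K r)

/-- Case (D) of Theorem 5. -/
def CaseD (K L : Set X) : Prop :=
  (IsParaball K ∧ IsParallelDomain L) ∨ (IsParaball L ∧ IsParallelDomain K)

/-- Case (E) of Theorem 5. -/
def CaseE (K L : Set X) : Prop :=
  Congruent K L ∧ IsParallelDomain K ∧ IsParallelDomain L

/-- All cases of (3) of Theorem 5 together. -/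
def Theorem5Cases (K L : Set X) : Prop :=
  CaseA K L ∨ CaseB K L ∨ CaseC K L ∨ CaseD K L ∨ CaseE K L

/-- Condition (1) of Theorem 5: every intersection of congruent copies admits some
non-trivial congruence. -/
def T5Cond1 (K L : Set X) : Prop :=
  ∀ φ ψ : X ≃ᵢ X, OrientationPreserving φ → OrientationPreserving ψ →
    (interior ((⇑φ '' K) ∩ (⇑ψ '' L))).Nonempty →
    AdmitsNontrivialCongruence ((⇑φ '' K) ∩ (⇑ψ '' L))

/-- Condition (2) of Theorem 5: every intersection of congruent copies is axially
symmetric. -/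
def T5Cond2 (K L : Set X) : Prop :=
  ∀ φ ψ : X ≃ᵢ X, OrientationPreserving φ → OrientationPreserving ψ →
    (interior ((⇑φ '' K) ∩ (⇑ψ '' L))).Nonempty →
    AxiallySymmetric ((⇑φ '' K) ∩ (⇑ψ '' L))

/-- All connected components of the boundary of `K` are hypercycles or straight lines. -/
def BdryHypOrLine (K : Set X) : Prop :=
  ∀ x ∈ frontier K, IsHypercycleOrLine (connectedComponentIn (frontier K) x)

/-- The boundary of `K` has at least two connected components. -/
def AtLeastTwoComponents (K : Set X) : Prop :=
  ∃ x ∈ frontier K, ∃ y ∈ frontier K,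
    connectedComponentIn (frontier K) x ≠ connectedComponentIn (frontier K) y

/-- The boundary of `K` is nonempty and has a single connected component. -/
def SingleComponent (K : Set X) : Prop :=
  (frontier K).Nonempty ∧ ∀ x ∈ frontier K, ∀ y ∈ frontier K,
    connectedComponentIn (frontier K) x = connectedComponentIn (frontier K) y

/-- The associated graph of `K` contains two edges with at least one common endpoint:
`K` has two distinct boundary components which are asymptotic (come arbitrarily close). -/
def TwoAsymptoticComponents (K : Set X) : Prop :=
  ∃ x ∈ frontier K, ∃ y ∈ frontier K,
    connectedComponentIn (frontier K) x ≠ connectedComponentIn (frontier K) y ∧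
    ∀ δ > (0 : ℝ), ∃ p ∈ connectedComponentIn (frontier K) x,
      ∃ q ∈ connectedComponentIn (frontier K) y, dist p q < δ

/-- The associated graph of `K` has only pairwise vertex-disjoint edges: distinct
boundary components of `K` stay at positive distance from each other. -/
def VertexDisjointEdges (K : Set X) : Prop :=
  ∀ x ∈ frontier K, ∀ y ∈ frontier K,
    connectedComponentIn (frontier K) x ≠ connectedComponentIn (frontier K) y →
      ∃ δ > (0 : ℝ), ∀ p ∈ connectedComponentIn (frontier K) x,
        ∀ q ∈ connectedComponentIn (frontier K) y, δ ≤ dist p q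

/-! Conditions of Theorem 6. -/

/-- Condition (1) of Theorem 6. -/
def T6Cond1 (K L : Set X) : Prop :=
  ∃ ε > (0 : ℝ), ∀ φ ψ : X ≃ᵢ X, OrientationPreserving φ → OrientationPreserving ψ →
    (interior ((⇑φ '' K) ∩ (⇑ψ '' L))).Nonempty →
    diam ((⇑φ '' K) ∩ (⇑ψ '' L)) < ε →
    CentrallySymmetric ((⇑φ '' K) ∩ (⇑ψ '' L))

/-- Condition (2) of Theorem 6. -/
def T6Cond2 (K L : Set X) : Prop :=
  ∀ x ∈ frontier K, ∀ y ∈ frontier L, ∃ ε > (0 : ℝ),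
    ∀ φ ψ : X ≃ᵢ X, OrientationPreserving φ → OrientationPreserving ψ →
      (interior ((⇑φ '' K) ∩ (⇑ψ '' L))).Nonempty →
      diam ((⇑φ '' K) ∩ (⇑ψ '' L)) < ε →
      ∀ (p : X) (r : ℝ), HasUniqueInball ((⇑φ '' K) ∩ (⇑ψ '' L)) p r →
        frontier ((⇑φ '' K) ∩ (⇑ψ '' L)) ∩ sphere p r = {φ x, ψ y} →
        φ x ∈ interior (⇑ψ '' L) → ψ y ∈ interior (⇑φ '' K) →
        IsMidpoint p (φ x) (ψ y) →
        CentrallySymmetric ((⇑φ '' K) ∩ (⇑ψ '' L))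

/-- Condition (3) of Theorem 6. -/
def T6Cond3 (K L : Set X) : Prop :=
  ∀ x ∈ frontier K, ∀ y ∈ frontier L, ∃ ε > (0 : ℝ),
    ∀ φ ψ : X ≃ᵢ X, OrientationPreserving φ → OrientationPreserving ψ →
      (interior ((⇑φ '' K) ∩ (⇑ψ '' L))).Nonempty →
      diam ((⇑φ '' K) ∩ (⇑ψ '' L)) < ε →
      ∀ (p : X) (r : ℝ), HasUniqueInball ((⇑φ '' K) ∩ (⇑ψ '' L)) p r →
        frontier ((⇑φ '' K) ∩ (⇑ψ '' L)) ∩ sphere p r = {φ x, ψ y} →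
        φ x ∈ interior (⇑ψ '' L) → ψ y ∈ interior (⇑φ '' K) →
        IsMidpoint p (φ x) (ψ y) →
        SymmetricWrtPerpBisector ((⇑φ '' K) ∩ (⇑ψ '' L)) (φ x) (ψ y)

/-- Condition (4) of Theorem 6. -/
def T6Cond4 (d : ℕ) (K L : Set X) : Prop :=
  (∃ r > (0 : ℝ), (IsSphereSpace X d → r ≤ Real.pi / 2) ∧
      (∀ C ∈ bdryComponents K ∪ bdryComponents L, ∃ p : X, C = sphere p r) ∧
      (∃ p : X, K = closedBall p r) ∧ ∃ q : X, L = closedBall q r) ∨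
  ((∀ C ∈ bdryComponents K ∪ bdryComponents L, IsParasphere C) ∧
      IsParaball K ∧ IsParaball L) ∨
  (∃ lam > (0 : ℝ), ∀ C ∈ bdryComponents K ∪ bdryComponents L, IsHypersphere C lam)

/-! Conditions of Theorems 7 and 8. -/

/-- The pair `φ, ψ` is admissible for hypothesis (****): both are orientation
preserving, and for the sphere `(φ K) ∪ (ψ L)` lies in an open hemisphere. -/
def GoodPair (d : ℕ) (K L : Set X) (φ ψ : X ≃ᵢ X) : Prop :=
  OrientationPreserving φ ∧ OrientationPreserving ψ ∧
    (IsSphereSpace X d → ∃ s : X, (⇑φ '' K) ∪ (⇑ψ '' L) ⊆ ball s (Real.pi / 2))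

/-- The convex hull of the union of the two congruent copies. -/
def hullUnion (K L : Set X) (φ ψ : X ≃ᵢ X) : Set X := gconvexHull ((⇑φ '' K) ∪ (⇑ψ '' L))

/-- Condition (A) of (3) of Theorem 7: the diameter of `M` is sufficiently close to `π`
(sphere), resp. sufficiently large (Euclidean, hyperbolic), as measured by `δ`. -/
def BigDiam (d : ℕ) (X : Type*) [MetricSpace X] (M : Set X) (δ : ℝ) : Prop :=
  (IsSphereSpace X d → Real.pi - δ < diam M) ∧ (¬ IsSphereSpace X d → 1 / δ < diam M)

/-- Condition (1) of Theorem 7. -/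
def T7Cond1 (d : ℕ) (K L : Set X) : Prop :=
  ∀ φ ψ : X ≃ᵢ X, GoodPair d K L φ ψ → CentrallySymmetric (hullUnion K L φ ψ)

/-- Condition (2) of Theorem 7. -/
def T7Cond2 (d : ℕ) (K L : Set X) : Prop :=
  ∀ φ ψ : X ≃ᵢ X, GoodPair d K L φ ψ → ∀ a b : X, UniqueDiametral (hullUnion K L φ ψ) a b →
    SymmetricWrtPerpBisector (hullUnion K L φ ψ) a b

/-- Condition (3) of Theorem 7. -/
def T7Cond3 (d : ℕ) (K L : Set X) : Prop :=
  ∃ δ > (0 : ℝ), ∀ φ ψ : X ≃ᵢ X, GoodPair d K L φ ψ →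
    ∀ x ∈ frontier K, ∀ y ∈ frontier L,
      BigDiam d X (hullUnion K L φ ψ) δ →
      UniqueDiametral (hullUnion K L φ ψ) (φ x) (ψ y) →
      CentrallySymmetric (hullUnion K L φ ψ)

/-- Condition (4) of Theorem 7. -/
def T7Cond4 (d : ℕ) (K L : Set X) : Prop :=
  ∃ δ > (0 : ℝ), ∀ φ ψ : X ≃ᵢ X, GoodPair d K L φ ψ →
    ∀ x ∈ frontier K, ∀ y ∈ frontier L,
      BigDiam d X (hullUnion K L φ ψ) δ →
      UniqueDiametral (hullUnion K L φ ψ) (φ x) (ψ y) →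
      SymmetricWrtPerpBisector (hullUnion K L φ ψ) (φ x) (ψ y)

/-- Condition (5) of Theorem 7. -/
def T7Cond5 (d : ℕ) (K L : Set X) : Prop :=
  ∃ δ > (0 : ℝ), ∀ φ ψ : X ≃ᵢ X, GoodPair d K L φ ψ →
    ∀ x ∈ frontier K, ∀ y ∈ frontier L,
      BigDiam d X (hullUnion K L φ ψ) δ →
      UniqueDiametral (hullUnion K L φ ψ) (φ x) (ψ y) →
      ∃ ε₀ > (0 : ℝ), ∀ ε : ℝ, 0 < ε → ε < ε₀ →
        (IsSphereSpace X d → ∃ s : X, (⇑φ '' K) ∪ (⇑ψ '' L) ⊆ ball s (Real.pi / 2) ∧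
            segCyl (φ x) (ψ y) ε ⊆ ball s (Real.pi / 2)) ∧
        CentrallySymmetric (hullUnion K L φ ψ ∩ segCyl (φ x) (ψ y) ε)

/-- Condition (6) of Theorem 7. -/
def T7Cond6 (d : ℕ) (K L : Set X) : Prop :=
  ∃ δ > (0 : ℝ), ∀ φ ψ : X ≃ᵢ X, GoodPair d K L φ ψ →
    ∀ x ∈ frontier K, ∀ y ∈ frontier L,
      BigDiam d X (hullUnion K L φ ψ) δ →
      UniqueDiametral (hullUnion K L φ ψ) (φ x) (ψ y) →
      ∃ ε₀ > (0 : ℝ), ∀ ε : ℝ, 0 < ε → ε < ε₀ →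
        (IsSphereSpace X d → ∃ s : X, (⇑φ '' K) ∪ (⇑ψ '' L) ⊆ ball s (Real.pi / 2) ∧
            segCyl (φ x) (ψ y) ε ⊆ ball s (Real.pi / 2)) ∧
        SymmetricWrtPerpBisector (hullUnion K L φ ψ ∩ segCyl (φ x) (ψ y) ε) (φ x) (ψ y)

/-- Condition (7) of Theorem 7: `K` and `L` are congruent balls. -/
def T7Cond7 (d : ℕ) (K L : Set X) : Prop :=
  ∃ r > (0 : ℝ), (IsSphereSpace X d → r < Real.pi / 2) ∧
    (∃ p : X, K = closedBall p r) ∧ ∃ q : X, L = closedBall q r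

/-- Condition (1) of Theorem 8. -/
def T8Cond1 (K L : Set X) : Prop :=
  ∀ φ ψ : X ≃ᵢ X, GoodPair 2 K L φ ψ → AxiallySymmetric (hullUnion K L φ ψ)

/-- Condition (2) of Theorem 8. -/
def T8Cond2 (K L : Set X) : Prop :=
  ∀ φ ψ : X ≃ᵢ X, GoodPair 2 K L φ ψ → AdmitsNontrivialCongruence (hullUnion K L φ ψ)

/-- Condition (3) of Theorem 8. -/
def T8Cond3 (K L : Set X) : Prop :=
  ∃ δ > (0 : ℝ), ∀ φ ψ : X ≃ᵢ X, GoodPair 2 K L φ ψ →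
    ∀ x ∈ frontier K, ∀ y ∈ frontier L,
      BigDiam 2 X (hullUnion K L φ ψ) δ →
      UniqueDiametral (hullUnion K L φ ψ) (φ x) (ψ y) →
      AxiallySymmetric (hullUnion K L φ ψ)

/-- Condition (4) of Theorem 8. -/
def T8Cond4 (K L : Set X) : Prop :=
  ∃ δ > (0 : ℝ), ∀ φ ψ : X ≃ᵢ X, GoodPair 2 K L φ ψ →
    ∀ x ∈ frontier K, ∀ y ∈ frontier L,
      BigDiam 2 X (hullUnion K L φ ψ) δ →
      UniqueDiametral (hullUnion K L φ ψ) (φ x) (ψ y) →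
      AdmitsNontrivialCongruence (hullUnion K L φ ψ)

/-- Condition (5) of Theorem 8. -/
def T8Cond5 (K L : Set X) : Prop :=
  ∃ δ > (0 : ℝ), ∀ φ ψ : X ≃ᵢ X, GoodPair 2 K L φ ψ →
    ∀ x ∈ frontier K, ∀ y ∈ frontier L,
      BigDiam 2 X (hullUnion K L φ ψ) δ →
      UniqueDiametral (hullUnion K L φ ψ) (φ x) (ψ y) →
      ∃ ε₀ > (0 : ℝ), ∀ ε : ℝ, 0 < ε → ε < ε₀ →
        (IsSphereSpace X 2 → ∃ s : X, (⇑φ '' K) ∪ (⇑ψ '' L) ⊆ ball s (Real.pi / 2) ∧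
            segCyl (φ x) (ψ y) ε ⊆ ball s (Real.pi / 2)) ∧
        AxiallySymmetric (hullUnion K L φ ψ ∩ segCyl (φ x) (ψ y) ε)

/-- Condition (6) of Theorem 8. -/
def T8Cond6 (K L : Set X) : Prop :=
  ∃ δ > (0 : ℝ), ∀ φ ψ : X ≃ᵢ X, GoodPair 2 K L φ ψ →
    ∀ x ∈ frontier K, ∀ y ∈ frontier L,
      BigDiam 2 X (hullUnion K L φ ψ) δ →
      UniqueDiametral (hullUnion K L φ ψ) (φ x) (ψ y) →
      ∃ ε₀ > (0 : ℝ), ∀ ε : ℝ, 0 < ε → ε < ε₀ →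
        (IsSphereSpace X 2 → ∃ s : X, (⇑φ '' K) ∪ (⇑ψ '' L) ⊆ ball s (Real.pi / 2) ∧
            segCyl (φ x) (ψ y) ε ⊆ ball s (Real.pi / 2)) ∧
        AdmitsNontrivialCongruence (hullUnion K L φ ψ ∩ segCyl (φ x) (ψ y) ε)

/-- Condition (7) of Theorem 8: `K` and `L` are (in general incongruent) circles. -/
def T8Cond7 (K L : Set X) : Prop :=
  ∃ (p q : X) (r s : ℝ), 0 < r ∧ 0 < s ∧
    (IsSphereSpace X 2 → r < Real.pi / 2 ∧ s < Real.pi / 2) ∧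
    K = closedBall p r ∧ L = closedBall q s


/-- A realization of `X` as a component of a quadric `{v | B v v = k}`, `k = ±1`, covering the
unit sphere and the hyperboloid model of hyperbolic space at the same time. -/
structure QuadricModel (X : Type*) [MetricSpace X] (V : Type*) [NormedAddCommGroup V]
    [NormedSpace ℝ V] where
  /-- the curvature -/
  k : ℝ
  /-- the ambient bilinear form -/
  B : V →ₗ[ℝ] V →ₗ[ℝ] ℝ
  /-- the embedding -/
  e : X → V
  hk : k = 1 ∨ k = -1
  symm : ∀ u v, B u v = B v u
  ind : Topology.IsInducing e
  self : ∀ x, B (e x) (e x) = k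
  pos : ∀ x τ, B (e x) τ = 0 → τ ≠ 0 → 0 < B τ τ
  mem : ∀ v x, B v v = k → (k = -1 → B v (e x) < 0) → ∃ z, e z = v
  neg : k = -1 → ∀ x y, B (e x) (e y) < 0
  dist_le : ∀ x y z w, dist x y ≤ dist z w ↔ B (e z) (e w) ≤ B (e x) (e y)
  btw : ∀ x y z (α β : ℝ), 0 ≤ α → 0 ≤ β → e z = α • e x + β • e y → Btw x z y
  dim : 3 ≤ Module.finrank ℝ V
  proper : ProperSpace X
  arccos : k = 1 → ∀ x y, dist x y = Real.arccos (B (e x) (e y))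
  cosh : k = -1 → ∀ x y, Real.cosh (dist x y) = -B (e x) (e y)

namespace QuadricModel

open Topology

variable {V : Type*} [NormedAddCommGroup V] [NormedSpace ℝ V] (M : QuadricModel X V)

theorem k_sq : M.k * M.k = 1 := by rcases M.hk with h | h <;> simp [h]

theorem k_ne : M.k ≠ 0 := by rcases M.hk with h | h <;> simp [h]

theorem B_le (x y : X) : M.B (M.e x) (M.e y) ≤ M.k := by
  rw [← M.self x, ← M.dist_le x x x y]
  simp

theorem eq_of_B (x y : X) (h : M.k ≤ M.B (M.e x) (M.e y)) : x = y := by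
  rw [← M.self x, ← M.dist_le x y x x] at h
  simpa using h

theorem dist_eq (x y z w : X) :
    dist x y = dist z w ↔ M.B (M.e x) (M.e y) = M.B (M.e z) (M.e w) := by
  rw [le_antisymm_iff, M.dist_le, M.dist_le, le_antisymm_iff, and_comm]

theorem B_lt (x y : X) (h : x ≠ y) : M.B (M.e x) (M.e y) < M.k :=
  lt_of_not_ge fun h' => h (M.eq_of_B x y h')

theorem e_injective : Function.Injective M.e := fun x y h =>
  M.eq_of_B x y (by rw [← h, M.self])

theorem B_sub_self (u v : V) :
    M.B (u - v) (u - v) = M.B u u - 2 * M.B u v + M.B v v := by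
  simp only [map_sub, LinearMap.sub_apply, M.symm v u]; ring

theorem B_add_self (u v : V) :
    M.B (u + v) (u + v) = M.B u u + 2 * M.B u v + M.B v v := by
  simp only [map_add, LinearMap.add_apply, M.symm v u]; ring

theorem continuous_B [FiniteDimensional ℝ V] (v : V) : Continuous fun x => M.B (M.e x) v :=
  ((M.B.flip v).continuous_of_finiteDimensional).comp M.ind.continuous

/-- The half-space type region `{u | B u ν ≤ c}`. -/
def region (ν : V) (c : ℝ) : Set X := {u | M.B (M.e u) ν ≤ c}

theorem isClosed_region [FiniteDimensional ℝ V] (ν : V) (c : ℝ) : IsClosed (M.region ν c) :=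
  isClosed_le (M.continuous_B ν) continuous_const

theorem eq_of_mem_frontier_region [FiniteDimensional ℝ V] {ν : V} {c : ℝ} {x : X}
    (hx : x ∈ frontier (M.region ν c)) : M.B (M.e x) ν = c := by
  rw [(M.isClosed_region ν c).frontier_eq] at hx
  refine le_antisymm hx.1 (not_lt.1 fun h => hx.2 ?_)
  have ho : IsOpen {u : X | M.B (M.e u) ν < c} := isOpen_lt (M.continuous_B ν) continuous_const
  exact interior_maximal (fun u hu => le_of_lt (show M.B (M.e u) ν < c from hu)) ho h

theorem exists_orthogonal [FiniteDimensional ℝ V] (u v : V) :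
    ∃ τ, τ ≠ 0 ∧ M.B u τ = 0 ∧ M.B v τ = 0 := by
  have h : LinearMap.ker ((M.B u).prod (M.B v)) ≠ ⊥ := by
    apply LinearMap.ker_ne_bot_of_finrank_lt
    have := M.dim
    simp only [Module.finrank_prod, Module.finrank_self]
    omega
  obtain ⟨τ, hτ, h0⟩ := Submodule.exists_mem_ne_zero_of_ne_bot h
  rw [LinearMap.mem_ker, LinearMap.prod_apply] at hτ
  simp only [Function.prod, Prod.mk_eq_zero] at hτ
  exact ⟨τ, h0, hτ.1, hτ.2⟩

/-- A unit vector orthogonal to a point and to a further vector. -/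
theorem exists_unit_orthogonal [FiniteDimensional ℝ V] (x : X) (v : V) :
    ∃ τ, M.B τ τ = 1 ∧ M.B (M.e x) τ = 0 ∧ M.B v τ = 0 := by
  obtain ⟨τ, h0, h1, h2⟩ := M.exists_orthogonal (M.e x) v
  have hp := M.pos x τ h1 h0
  refine ⟨(√(M.B τ τ))⁻¹ • τ, ?_, by simp [h1], by simp [h2]⟩
  simp only [map_smul, LinearMap.smul_apply, smul_eq_mul]
  have := Real.mul_self_sqrt hp.le
  have h3 : √(M.B τ τ) ≠ 0 := (Real.sqrt_pos.2 hp).ne'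
  field_simp
  linarith

/-- Moving a point in the direction of a tangent vector. -/
theorem exists_move (x : X) (τ : V) (hτ : M.B (M.e x) τ = 0) :
    ∃ u : ℝ → X, Tendsto u (𝓝[>] 0) (𝓝 x) ∧
      ∀ ν, 0 < M.B τ ν → ∀ᶠ t in 𝓝[>] 0, M.B (M.e x) ν < M.B (M.e (u t)) ν := by
  classical
  set q := M.B τ τ with hq
  let v : ℝ → V := fun t =>
    ((1 - M.k * q * t ^ 2) / (1 + M.k * q * t ^ 2)) • M.e x +
      (2 * t / (1 + M.k * q * t ^ 2)) • τ
  have hs : Tendsto (fun t : ℝ => M.k * q * t ^ 2) (𝓝[>] 0) (𝓝 0) := by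
    have : Continuous fun t : ℝ => M.k * q * t ^ 2 := by fun_prop
    simpa using (this.tendsto 0).mono_left nhdsWithin_le_nhds
  have h1 : ∀ᶠ t in 𝓝[>] (0 : ℝ), |M.k * q * t ^ 2| < 1 := by
    have := hs.eventually (Metric.ball_mem_nhds (0 : ℝ) one_pos)
    filter_upwards [this] with t ht
    simpa [Real.dist_eq] using ht
  have hex : ∀ᶠ t in 𝓝[>] (0 : ℝ), ∃ z, M.e z = v t := by
    filter_upwards [h1] with t ht
    obtain ⟨ha, hb⟩ := abs_lt.1 ht
    have hd : 1 + M.k * q * t ^ 2 ≠ 0 := by linarith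
    apply M.mem _ x
    · simp only [v, map_add, map_smul, LinearMap.add_apply, LinearMap.smul_apply, smul_eq_mul,
        hτ, M.symm τ (M.e x), M.self, ← hq]
      have := M.k_sq
      field_simp
      linear_combination (-4 * q * t ^ 2) * this
    · intro hk
      simp only [v, map_add, map_smul, LinearMap.add_apply, LinearMap.smul_apply, smul_eq_mul,
        hτ, M.symm τ (M.e x), M.self]
      rw [hk] at ha hb hd ⊢
      have : 0 < (1 - -1 * q * t ^ 2) / (1 + -1 * q * t ^ 2) := div_pos (by linarith) (by linarith)
      linarith
  refine ⟨fun t => if h : ∃ z, M.e z = v t then h.choose else x, ?_, ?_⟩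
  · rw [M.ind.tendsto_nhds_iff]
    have hc : Tendsto v (𝓝[>] 0) (𝓝 (M.e x)) := by
      have : ContinuousAt v 0 := by
        apply ContinuousAt.add
        · apply ContinuousAt.smul _ continuousAt_const
          exact ContinuousAt.div (by fun_prop) (by fun_prop) (by simp)
        · apply ContinuousAt.smul _ continuousAt_const
          exact ContinuousAt.div (by fun_prop) (by fun_prop) (by simp)
      have h := this.tendsto.mono_left (nhdsWithin_le_nhds (s := Ioi (0 : ℝ)))
      simpa [v] using h
    refine hc.congr' ?_
    filter_upwards [hex] with t ht
    simp only [Function.comp, dif_pos ht]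
    exact ht.choose_spec.symm
  · intro ν hν
    have h2 : ∀ᶠ t in 𝓝[>] (0 : ℝ), M.k * q * t * M.B (M.e x) ν < M.B τ ν := by
      have hc : Continuous fun t : ℝ => M.k * q * t * M.B (M.e x) ν := by fun_prop
      have := (hc.tendsto 0).mono_left (nhdsWithin_le_nhds (s := Ioi (0 : ℝ)))
      simp only [mul_zero, zero_mul] at this
      exact this.eventually_lt_const hν
    filter_upwards [hex, h1, h2, self_mem_nhdsWithin] with t ht h1 h2 h3
    simp only [dif_pos ht]
    rw [ht.choose_spec]
    have h3 : 0 < t := h3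
    have hd : 0 < 1 + M.k * q * t ^ 2 := by linarith [(abs_lt.1 h1).1]
    simp only [v, map_add, map_smul, LinearMap.add_apply, LinearMap.smul_apply, smul_eq_mul]
    have h4 : (1 - M.k * q * t ^ 2) / (1 + M.k * q * t ^ 2) * M.B (M.e x) ν +
        2 * t / (1 + M.k * q * t ^ 2) * M.B τ ν - M.B (M.e x) ν =
        2 * t * (M.B τ ν - M.k * q * t * M.B (M.e x) ν) / (1 + M.k * q * t ^ 2) := by
      field_simp; ring
    have : 0 < 2 * t * (M.B τ ν - M.k * q * t * M.B (M.e x) ν) / (1 + M.k * q * t ^ 2) :=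
      div_pos (mul_pos (by linarith) (by linarith)) hd
    linarith

/-- Points of `X` have no isolated antipode: a neighbourhood contains another point. -/
theorem exists_ne_mem_open [FiniteDimensional ℝ V] {O : Set X} (hO : IsOpen O)
    (hne : O.Nonempty) (a : V) : ∃ o ∈ O, M.e o ≠ a := by
  obtain ⟨o, ho⟩ := hne
  by_cases h : M.e o = a
  · obtain ⟨τ, h1, h2, -⟩ := M.exists_unit_orthogonal o 0
    obtain ⟨u, hu, hu'⟩ := M.exists_move o τ h2
    obtain ⟨t, ht, ht'⟩ := ((hu.eventually (hO.mem_nhds ho)).and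
      (hu' τ (by rw [h1]; exact one_pos))).exists
    exact ⟨u t, ht, fun h' => by rw [h', h] at ht'; exact lt_irrefl _ ht'⟩
  · exact ⟨o, ho, h⟩

/-- The reflection along a vector. -/
noncomputable def reflV (v w : V) : V := w - (2 * M.B w v / M.B v v) • v

theorem B_reflV (v : V) (hv : M.B v v ≠ 0) (w w' : V) :
    M.B (M.reflV v w) (M.reflV v w') = M.B w w' := by
  simp only [reflV, map_sub, map_smul, LinearMap.sub_apply, LinearMap.smul_apply, smul_eq_mul,
    M.symm v w']
  field_simp
  ring

theorem reflV_reflV (v : V) (hv : M.B v v ≠ 0) (w : V) : M.reflV v (M.reflV v w) = w := by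
  have : M.B (M.reflV v w) v = - M.B w v := by
    simp only [reflV, map_sub, map_smul, LinearMap.sub_apply, LinearMap.smul_apply, smul_eq_mul]
    field_simp
    ring
  rw [reflV, this, reflV]
  module

theorem exists_reflV (v : V) (hv : 0 < M.B v v) (x : X) : ∃ z, M.e z = M.reflV v (M.e x) := by
  apply M.mem _ x
  · rw [M.B_reflV v hv.ne', M.self]
  · intro hk
    simp only [reflV, map_sub, map_smul, LinearMap.sub_apply, LinearMap.smul_apply, smul_eq_mul,
      M.self, M.symm v (M.e x)]
    have : 2 * M.B (M.e x) v / M.B v v * M.B (M.e x) v = 2 * (M.B (M.e x) v) ^ 2 / M.B v v := by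
      ring
    rw [this, hk]
    have : 0 ≤ 2 * (M.B (M.e x) v) ^ 2 / M.B v v := by positivity
    linarith

theorem B_sub_pos {x y : X} (h : x ≠ y) : 0 < M.B (M.e x - M.e y) (M.e x - M.e y) := by
  rw [M.B_sub_self, M.self, M.self]
  linarith [M.B_lt x y h]

/-- The reflection in the bisector of two points. -/
theorem exists_reflection [FiniteDimensional ℝ V] {x y : X} (h : x ≠ y) :
    ∃ σ : X ≃ᵢ X, IsReflection σ ∧ σ x = y ∧ σ y = x ∧
      ∀ u, M.e (σ u) = M.reflV (M.e x - M.e y) (M.e u) := by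
  have hn := M.B_sub_pos h
  set n := M.e x - M.e y with hnd
  choose f hf using M.exists_reflV n hn
  have hff : ∀ u, f (f u) = u := fun u => M.e_injective (by rw [hf, hf, M.reflV_reflV _ hn.ne'])
  let σ : X ≃ᵢ X := ⟨⟨f, f, hff, hff⟩, Isometry.of_dist_eq fun u v => by
    change dist (f u) (f v) = _
    rw [M.dist_eq, hf, hf, M.B_reflV _ hn.ne']⟩
  have hσ : ∀ u, σ u = f u := fun u => rfl
  have hx : M.B (M.e x) n = M.k - M.B (M.e x) (M.e y) := by simp [hnd, M.self]
  have hy : M.B (M.e y) n = M.B (M.e x) (M.e y) - M.k := by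
    simp [hnd, M.self, M.symm (M.e y) (M.e x)]
  have hnn : M.B n n = 2 * (M.k - M.B (M.e x) (M.e y)) := by
    rw [hnd, M.B_sub_self, M.self, M.self]; ring
  have hlt := M.B_lt x y h
  have hxy : σ x = y := by
    apply M.e_injective
    rw [hσ, hf, reflV, hx, hnn]
    have : M.k - M.B (M.e x) (M.e y) ≠ 0 := by linarith
    rw [div_self (by simpa using this), one_smul, hnd]
    abel
  have hyx : σ y = x := by rw [← hxy, hσ, hσ, hff]
  have hfix : ∀ u, M.B (M.e u) n = 0 → σ u = u := fun u hu => by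
    apply M.e_injective
    rw [hσ, hf, reflV, hu]; simp
  refine ⟨σ, ⟨?_, ?_, ?_⟩, hxy, hyx, fun u => hf u⟩
  · ext u; exact hff u
  · intro h'
    rw [h'] at hxy
    exact h hxy
  · intro hc
    have := hc.intermediate_value (a := y) (b := x) (by simpa [hyx] using h)
      (by simpa [hxy] using h.symm) (M.continuous_B n).continuousOn
    obtain ⟨u, hu, hu'⟩ := this (show (0 : ℝ) ∈ _ from ⟨by rw [hy]; linarith, by rw [hx]; linarith⟩)
    exact hu (hfix u hu')

end QuadricModel

namespace QuadricModel

open Topology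

variable {V : Type*} [NormedAddCommGroup V] [NormedSpace ℝ V] (M : QuadricModel X V)

theorem nonneg (x : X) (τ : V) (h : M.B (M.e x) τ = 0) : 0 ≤ M.B τ τ := by
  by_cases h0 : τ = 0
  · simp [h0]
  · exact (M.pos x τ h h0).le

theorem neg_one_lt_of_add_ne {x y : X} (h : M.e x + M.e y ≠ 0) :
    -1 < M.k * M.B (M.e x) (M.e y) := by
  rcases M.hk with hk | hk
  · rw [hk, one_mul]
    set b := M.B (M.e x) (M.e y) with hb
    have h1 := M.nonneg x (M.e y - b • M.e x) (by simp [M.self, hk, ← hb])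
    have h2 : M.B (M.e y - b • M.e x) (M.e y - b • M.e x) = 1 - b ^ 2 := by
      simp only [map_sub, map_smul, LinearMap.sub_apply, LinearMap.smul_apply, smul_eq_mul,
        M.self, M.symm (M.e y) (M.e x), ← hb, hk]
      ring
    rcases lt_or_ge (-1) b with h3 | h3
    · exact h3
    · have hb1 : b = -1 := by nlinarith
      have h4 := M.pos x (M.e x + M.e y) (by rw [map_add, M.self, ← hb, hb1, hk]; norm_num) h
      rw [M.B_add_self, M.self, M.self, ← hb, hb1, hk] at h4
      norm_num at h4
  · have := M.B_le x y
    rw [hk] at this ⊢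
    linarith

/-- Two points that are not antipodal are joined by a connected set of points in their
nonnegative span. -/
theorem exists_segment {x y : X} (h : M.e x + M.e y ≠ 0) :
    ∃ S : Set X, IsPreconnected S ∧ x ∈ S ∧ y ∈ S ∧
      ∀ w ∈ S, ∃ α β : ℝ, 0 ≤ α ∧ 0 ≤ β ∧ M.e w = α • M.e x + β • M.e y := by
  set b := M.B (M.e x) (M.e y) with hb
  have hkb := M.neg_one_lt_of_add_ne h
  rw [← hb] at hkb
  let g : ℝ → ℝ := fun t => (1 - t) ^ 2 + t ^ 2 + 2 * t * (1 - t) * (M.k * b)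
  have hg : ∀ t ∈ Icc (0 : ℝ) 1, 0 < g t := by
    rintro t ⟨h0, h1⟩
    have : g t = (1 - 2 * t) ^ 2 + 2 * (t * (1 - t)) * (1 + M.k * b) := by simp only [g]; ring
    rw [this]
    rcases eq_or_lt_of_le h0 with h0 | h0
    · rw [← h0]; norm_num
    rcases eq_or_lt_of_le h1 with h1 | h1
    · rw [h1]; norm_num
    have : 0 < t * (1 - t) := mul_pos h0 (by linarith)
    have : 0 < 2 * (t * (1 - t)) * (1 + M.k * b) := by
      apply mul_pos <;> linarith
    positivity
  let v : ℝ → V := fun t => ((√(g t))⁻¹ * (1 - t)) • M.e x + ((√(g t))⁻¹ * t) • M.e y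
  have hv : ∀ t : Icc (0 : ℝ) 1, ∃ z, M.e z = v t := by
    rintro ⟨t, ht⟩
    have hgt := hg t ht
    have hs := Real.sq_sqrt hgt.le
    have hs0 : 0 < √(g t) := Real.sqrt_pos.2 hgt
    apply M.mem _ x
    · simp only [v, map_add, map_smul, LinearMap.add_apply, LinearMap.smul_apply, smul_eq_mul,
        M.symm (M.e y) (M.e x), M.self, ← hb]
      field_simp
      rw [hs]
      simp only [g]
      linear_combination (-2 * t * (1 - t) * b) * M.k_sq
    · intro hk
      have h1 := M.neg hk x y
      simp only [v, map_add, map_smul, LinearMap.add_apply, LinearMap.smul_apply, smul_eq_mul,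
        M.symm (M.e y) (M.e x), M.self, ← hb]
      have h2 : (1 - t) * M.k + t * b < 0 := by
        rw [← hb] at h1
        rw [hk]
        rcases eq_or_lt_of_le ht.1 with h0 | h0
        · rw [← h0]; norm_num
        · nlinarith [ht.2, mul_pos h0 (neg_pos.2 h1)]
      have h3 : (√(g t))⁻¹ * ((1 - t) * M.k + t * b) < 0 :=
        mul_neg_of_pos_of_neg (inv_pos.2 hs0) h2
      linarith
  choose f hf using hv
  have hfv : ∀ t : Icc (0 : ℝ) 1, M.e (f t) = v t := hf
  refine ⟨range f, ?_, ⟨⟨0, by simp⟩, ?_⟩, ⟨⟨1, by simp⟩, ?_⟩, ?_⟩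
  · rw [← M.ind.isPreconnected_image, ← range_comp]
    have : M.e ∘ f = fun t : Icc (0 : ℝ) 1 => v t := funext hfv
    rw [this]
    apply isPreconnected_range
    have hgc : Continuous fun t : Icc (0 : ℝ) 1 => g t := by fun_prop
    have hgi : Continuous fun t : Icc (0 : ℝ) 1 => (√(g t))⁻¹ :=
      (Real.continuous_sqrt.comp hgc).inv₀ fun t => (Real.sqrt_pos.2 (hg t t.2)).ne'
    exact ((hgi.mul (by fun_prop)).smul continuous_const).add
      ((hgi.mul (by fun_prop)).smul continuous_const)
  · apply M.e_injective
    rw [hfv]; simp [v, g]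
  · apply M.e_injective
    rw [hfv]; simp [v, g]
  · rintro _ ⟨⟨t, ht⟩, rfl⟩
    have hs0 : 0 ≤ (√(g t))⁻¹ := by positivity
    exact ⟨_, _, mul_nonneg hs0 (by linarith [ht.2]), mul_nonneg hs0 ht.1, hfv _⟩

theorem k_mul_add_sub_one_nonneg {x y w : X} {α β : ℝ} (hα : 0 ≤ α) (hβ : 0 ≤ β)
    (h : M.e w = α • M.e x + β • M.e y) : 0 ≤ M.k * (α + β - 1) := by
  have h1 := M.self w
  rw [h] at h1
  simp only [map_add, map_smul, LinearMap.add_apply, LinearMap.smul_apply, smul_eq_mul,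
    M.symm (M.e y) (M.e x), M.self] at h1
  have h2 := M.B_le x y
  have h3 := mul_le_mul_of_nonneg_left h2 (mul_nonneg hα hβ)
  rcases M.hk with hk | hk <;> rw [hk] at h1 h3 ⊢ <;> nlinarith

/-- Geodesic convexity of caps. -/
theorem cap_lt {x y w : X} {α β s : ℝ} (hα : 0 ≤ α) (hβ : 0 ≤ β) (hs : 0 ≤ s) {ν : V}
    (h : M.e w = α • M.e x + β • M.e y) (hx : M.B (M.e x) ν < -M.k * s)
    (hy : M.B (M.e y) ν < -M.k * s) : M.B (M.e w) ν < -M.k * s := by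
  have h1 := M.k_mul_add_sub_one_nonneg hα hβ h
  have h0 : 0 < α + β := by
    rcases eq_or_lt_of_le hα with ha | ha
    · rcases eq_or_lt_of_le hβ with hb | hb
      · have := M.self w
        rw [h, ← ha, ← hb] at this
        simp at this
        exact absurd this.symm M.k_ne
      · linarith
    · linarith
  have h2 : M.B (M.e w) ν = α * M.B (M.e x) ν + β * M.B (M.e y) ν := by
    rw [h]; simp
  have h3 : α * M.B (M.e x) ν + β * M.B (M.e y) ν < (α + β) * (-M.k * s) := by
    rcases eq_or_lt_of_le hα with ha | ha
    · rw [← ha] at h0 ⊢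
      have := mul_lt_mul_of_pos_left hy (show 0 < β by linarith)
      linarith
    · have := mul_lt_mul_of_pos_left hx ha
      have := mul_le_mul_of_nonneg_left hy.le hβ
      linarith
  have h4 := mul_nonneg h1 hs
  rw [h2]
  nlinarith

theorem mem_of_gconvex {K : Set X} (hK : GConvex K) {x y w : X} (hx : x ∈ K) (hy : y ∈ K)
    {α β : ℝ} (hα : 0 ≤ α) (hβ : 0 ≤ β) (h : M.e w = α • M.e x + β • M.e y) : w ∈ K := by
  refine hK x hx y hy w ⟨M.btw x y w α β hα hβ h, fun w' hw' hd => ?_⟩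
  have hb := M.btw x y w α β hα hβ h
  have hd' : dist w' y = dist w y := by
    unfold Btw at hb hw'
    linarith
  rw [M.dist_eq] at hd hd'
  apply M.eq_of_B
  rw [← M.self w]
  have hw : ∀ u, M.B u (M.e w) = α * M.B u (M.e x) + β * M.B u (M.e y) := fun u => by
    rw [h]; simp
  rw [hw, hw, hd', M.symm (M.e w') (M.e x), hd, M.symm (M.e w) (M.e x)]

theorem mem_interior_of_gconvex [FiniteDimensional ℝ V] {K : Set X} (hK : GConvex K)
    {x y w : X} (hx : x ∈ K) (hy : y ∈ interior K) {α β : ℝ} (hα : 0 ≤ α) (hβ : 0 < β)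
    (h : M.e w = α • M.e x + β • M.e y) : w ∈ interior K := by
  let v : X → V := fun w' => M.e w' - α • M.e x
  let g : X → ℝ := fun w' => M.k * (M.k - 2 * α * M.B (M.e w') (M.e x) + α ^ 2 * M.k)
  have hgB : ∀ w', M.B (v w') (v w') = M.k * g w' := fun w' => by
    simp only [v, g, map_sub, map_smul, LinearMap.sub_apply, LinearMap.smul_apply, smul_eq_mul,
      M.self, M.symm (M.e x) (M.e w')]
    linear_combination (-(M.k - 2 * α * M.B (M.e w') (M.e x) + α ^ 2 * M.k)) * M.k_sq
  have hvw : v w = β • M.e y := by simp [v, h]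
  have hgw : g w = β ^ 2 := by
    have := hgB w
    rw [hvw] at this
    simp only [map_smul, LinearMap.smul_apply, smul_eq_mul, M.self] at this
    have h2 : M.k * (β ^ 2 - g w) = 0 := by linarith
    rcases mul_eq_zero.1 h2 with h3 | h3
    · exact absurd h3 M.k_ne
    · linarith
  have hgc : Continuous g := by
    have := M.continuous_B (M.e x)
    fun_prop
  have hvc : Continuous v := M.ind.continuous.sub continuous_const
  let n : X → V := fun w' => (√(g w'))⁻¹ • v w'
  have hgw0 : 0 < g w := by rw [hgw]; positivity
  have hnw : n w = M.e y := by
    simp only [n, hgw, hvw, Real.sqrt_sq hβ.le, smul_smul, inv_mul_cancel₀ hβ.ne', one_smul]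
  have hnc : ContinuousAt n w :=
    ((hgc.continuousAt.sqrt).inv₀ (Real.sqrt_pos.2 hgw0).ne').smul hvc.continuousAt
  have hg1 : ∀ᶠ w' in 𝓝 w, 0 < g w' := hgc.continuousAt.eventually (lt_mem_nhds hgw0)
  have hy1 : ∀ᶠ w' in 𝓝 w, M.k = -1 → M.B (n w') (M.e y) < 0 := by
    by_cases hk : M.k = -1
    · have hc : ContinuousAt (fun w' => M.B (n w') (M.e y)) w :=
        ContinuousAt.comp (f := n) (g := fun u => M.B u (M.e y))
          ((M.B.flip (M.e y)).continuous_of_finiteDimensional).continuousAt hnc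
      have : M.B (n w) (M.e y) < 0 := by rw [hnw, M.self, hk]; norm_num
      filter_upwards [hc.eventually (gt_mem_nhds this)] with w' hw' _ using hw'
    · exact Eventually.of_forall fun _ h => absurd h hk
  have hex : ∀ᶠ w' in 𝓝 w, ∃ z, M.e z = n w' := by
    filter_upwards [hg1, hy1] with w' h1 h2
    apply M.mem _ y _ h2
    simp only [n, map_smul, LinearMap.smul_apply, smul_eq_mul, hgB]
    have h3 := Real.mul_self_sqrt h1.le
    have h4 := (Real.sqrt_pos.2 h1).ne'
    field_simp
    linear_combination (-M.k) * h3
  classical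
  let f : X → X := fun w' => if h : ∃ z, M.e z = n w' then h.choose else y
  have hf : Tendsto f (𝓝 w) (𝓝 y) := by
    rw [M.ind.tendsto_nhds_iff, ← hnw]
    refine hnc.tendsto.congr' ?_
    filter_upwards [hex] with w' h1
    simp only [f, Function.comp, dif_pos h1]
    exact h1.choose_spec.symm
  rw [mem_interior_iff_mem_nhds]
  filter_upwards [hex, hg1, hf.eventually (isOpen_interior.mem_nhds hy)] with w' h1 h2 h3
  refine M.mem_of_gconvex hK hx (interior_subset h3) hα (Real.sqrt_nonneg (g w')) ?_
  simp only [f, dif_pos h1]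
  rw [h1.choose_spec]
  simp only [n, smul_smul, mul_inv_cancel₀ (Real.sqrt_pos.2 h2).ne', one_smul, v]
  abel

end QuadricModel

theorem IsMidpoint.ne {p x y : X} (h : IsMidpoint p x y) (hxp : x ≠ p) : x ≠ y := by
  rintro rfl
  have h1 := h.1
  unfold Btw at h1
  rw [dist_self, dist_comm p x] at h1
  exact hxp (dist_eq_zero.1 (by linarith))

namespace QuadricModel

open Topology

variable {V : Type*} [NormedAddCommGroup V] [NormedSpace ℝ V] (M : QuadricModel X V)

theorem add_ne_zero_of_isMidpoint {p x y : X} (h : IsMidpoint p x y) (hxp : x ≠ p) :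
    M.e x + M.e p ≠ 0 := by
  intro h0
  have hb : M.B (M.e p) (M.e y) = -M.k := by
    rw [← (M.dist_eq x p p y).1 h.2, eq_neg_of_add_eq_zero_left h0]
    simp [M.self]
  refine h.ne hxp (M.e_injective ?_)
  have h1 : ¬ (M.e p + M.e y ≠ 0) := fun h1 => by
    have := M.neg_one_lt_of_add_ne h1
    rw [hb] at this
    linarith [M.k_sq]
  rw [not_not] at h1
  rw [eq_neg_of_add_eq_zero_left h0, eq_neg_of_add_eq_zero_right h1]

theorem k_mul_one_sub_sq_pos {x p : X} (hne : x ≠ p) (h0 : M.e x + M.e p ≠ 0) :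
    0 < M.k * (1 - M.B (M.e x) (M.e p) ^ 2) := by
  have h1 := M.B_lt x p hne
  have h2 := M.neg_one_lt_of_add_ne h0
  rcases M.hk with hk | hk <;> rw [hk] at h1 h2 ⊢ <;> nlinarith

/-- A region containing a ball which touches its boundary is determined by the touching
point, the centre of the ball and the invariants of the region. -/
theorem eq_of_closedBall_subset_region {p x : X} {ν : V} {c : ℝ}
    (hsub : closedBall p (dist x p) ⊆ M.region ν c) (hx : M.B (M.e x) ν = c) (hne : x ≠ p)
    (h0 : M.e x + M.e p ≠ 0) :
    ∃ μ : ℝ, 0 ≤ μ ∧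
      ν = (M.k * c) • M.e x - μ • (M.e p - (M.k * M.B (M.e x) (M.e p)) • M.e x) ∧
      μ ^ 2 * (M.k * (1 - M.B (M.e x) (M.e p) ^ 2)) = M.B ν ν - M.k * c ^ 2 := by
  set b := M.B (M.e x) (M.e p) with hb
  have hq := M.k_mul_one_sub_sq_pos hne h0
  rw [← hb] at hq
  set q := M.k * (1 - b ^ 2) with hqd
  set w := M.e p - (M.k * b) • M.e x with hw
  have hxw : M.B (M.e x) w = 0 := by
    simp only [hw, map_sub, map_smul, smul_eq_mul, M.self, ← hb]
    linear_combination (-b) * M.k_sq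
  have hwp : M.B w (M.e p) = q := by
    simp only [hw, map_sub, map_smul, LinearMap.sub_apply, LinearMap.smul_apply, smul_eq_mul,
      M.self, ← hb, hqd]
    ring
  have hww : M.B w w = q := by
    nth_rewrite 2 [hw]
    rw [map_sub, map_smul, M.symm w (M.e x), hxw, hwp]
    simp
  have hA : ∀ τ, M.B (M.e x) τ = 0 → 0 < M.B τ (M.e p) → M.B τ ν ≤ 0 := by
    intro τ h1 h2
    by_contra! h3
    obtain ⟨u, -, hu⟩ := M.exists_move x τ h1
    obtain ⟨t, ht1, ht2⟩ := ((hu _ h2).and (hu _ h3)).exists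
    have h4 : u t ∈ closedBall p (dist x p) := by
      rw [mem_closedBall, M.dist_le]; exact ht1.le
    have h5 : M.B (M.e (u t)) ν ≤ c := hsub h4
    linarith
  have hA' : ∀ τ, M.B (M.e x) τ = 0 → M.B τ (M.e p) = 0 → M.B τ ν ≤ 0 := by
    intro τ h1 h2
    refine le_of_forall_pos_le_add fun δ hδ => ?_
    have hd : 0 < δ / (|M.B w ν| + 1) := by positivity
    have h3 := hA (τ + (δ / (|M.B w ν| + 1)) • w) (by simp [h1, hxw])
      (by simp only [map_add, map_smul, LinearMap.add_apply, LinearMap.smul_apply, smul_eq_mul,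
            h2, hwp, zero_add]; positivity)
    simp only [map_add, map_smul, LinearMap.add_apply, LinearMap.smul_apply, smul_eq_mul] at h3
    have h4 : -(δ / (|M.B w ν| + 1) * M.B w ν) ≤ δ := by
      rw [div_mul_eq_mul_div, ← neg_div, div_le_iff₀ (by positivity)]
      nlinarith [neg_abs_le (M.B w ν), abs_nonneg (M.B w ν)]
    linarith
  have hA0 : ∀ τ, M.B (M.e x) τ = 0 → M.B τ (M.e p) = 0 → M.B τ ν = 0 := by
    intro τ h1 h2
    refine le_antisymm (hA' τ h1 h2) ?_
    have := hA' (-τ) (by simp [h1]) (by simp [h2])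
    simpa using this
  have hμ : 0 ≤ -M.B w ν / q := div_nonneg (by linarith [hA w hxw (by rw [hwp]; exact hq)]) hq.le
  set μ := -M.B w ν / q with hμd
  have hμq : μ * q = -M.B w ν := by rw [hμd]; field_simp
  have hν : ν = (M.k * c) • M.e x - μ • w := by
    set ρ := ν - ((M.k * c) • M.e x - μ • w) with hρ
    have h1 : M.B (M.e x) ρ = 0 := by
      simp only [hρ, map_sub, map_smul, smul_eq_mul, M.self, hxw, hx]
      linear_combination (-c) * M.k_sq
    have h2 : M.B w ρ = 0 := by
      simp only [hρ, map_sub, map_smul, smul_eq_mul, M.symm w (M.e x), hxw, hww]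
      linarith
    have h3 : M.B ρ (M.e p) = 0 := by
      have : M.e p = w + (M.k * b) • M.e x := by rw [hw]; abel
      rw [this, map_add, map_smul, M.symm ρ w, M.symm ρ (M.e x), h1, h2]; simp
    have h4 : M.B ρ ρ = 0 := by
      nth_rewrite 2 [hρ]
      simp only [map_sub, map_smul, smul_eq_mul, hA0 ρ h1 h3, M.symm ρ w, M.symm ρ (M.e x), h1, h2]
      simp
    by_contra h5
    have h6 := M.pos x ρ h1 (sub_ne_zero.2 h5)
    rw [h4] at h6
    exact lt_irrefl _ h6
  refine ⟨μ, hμ, hν, ?_⟩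
  conv_rhs => rw [hν]
  simp only [map_sub, map_smul, LinearMap.sub_apply, LinearMap.smul_apply, smul_eq_mul, M.self,
    hxw, M.symm w (M.e x), hww]
  linear_combination (-M.k * c ^ 2) * M.k_sq

/-- Two congruent regions touched by a ball at antipodal points are interchanged by the
reflection in the bisector of these points. -/
theorem exists_reflection_region [FiniteDimensional ℝ V] {p x y : X} {ν ν' : V} {c : ℝ}
    (hsub : closedBall p (dist x p) ⊆ M.region ν c)
    (hsub' : closedBall p (dist x p) ⊆ M.region ν' c)
    (hx : M.B (M.e x) ν = c) (hy : M.B (M.e y) ν' = c) (hνν : M.B ν ν = M.B ν' ν')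
    (hne : x ≠ p) (hm : IsMidpoint p x y) :
    ∃ σ : X ≃ᵢ X, IsReflection σ ∧ σ x = y ∧ σ y = x ∧
      ∀ u, M.B (M.e (σ u)) ν = M.B (M.e u) ν' ∧ M.B (M.e (σ u)) ν' = M.B (M.e u) ν := by
  have hm' : IsMidpoint p y x := by
    refine ⟨?_, by rw [dist_comm y p, ← hm.2, dist_comm]⟩
    have := hm.1
    unfold Btw at this ⊢
    rw [dist_comm y p, dist_comm p x, dist_comm y x, add_comm, this]
  have hyx : dist y p = dist x p := by rw [dist_comm y p, ← hm.2]
  have hne' : y ≠ p := by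
    rintro rfl
    rw [dist_self] at hyx
    exact hne (dist_eq_zero.1 hyx.symm)
  have hxy := hm.ne hne
  obtain ⟨μ, hμ, hν, h1⟩ := M.eq_of_closedBall_subset_region hsub hx hne
    (M.add_ne_zero_of_isMidpoint hm hne)
  obtain ⟨μ', hμ', hν', h1'⟩ := M.eq_of_closedBall_subset_region (by rwa [hyx]) hy hne'
    (M.add_ne_zero_of_isMidpoint hm' hne')
  have hb : M.B (M.e y) (M.e p) = M.B (M.e x) (M.e p) := (M.dist_eq _ _ _ _).1 hyx
  rw [hb] at hν' h1'
  have hq := M.k_mul_one_sub_sq_pos hne (M.add_ne_zero_of_isMidpoint hm hne)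
  have hμμ : μ' = μ := by
    have h2 : μ' ^ 2 = μ ^ 2 := by
      apply mul_right_cancel₀ hq.ne'
      rw [h1, h1', hνν]
    exact (pow_left_inj₀ hμ' hμ two_ne_zero).1 h2
  rw [hμμ] at hν'
  obtain ⟨σ, hσ, hσx, hσy, hσe⟩ := M.exists_reflection hxy
  have hvv := (M.B_sub_pos hxy).ne'
  have hrx : M.reflV (M.e x - M.e y) (M.e x) = M.e y := by rw [← hσe, hσx]
  have hrp : M.reflV (M.e x - M.e y) (M.e p) = M.e p := by
    have : M.B (M.e p) (M.e x - M.e y) = 0 := by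
      rw [map_sub, M.symm, ← hb, M.symm, sub_self]
    rw [reflV, this]; simp
  have hlin : ∀ (a : ℝ) (u w : V), M.reflV (M.e x - M.e y) (u - w) =
      M.reflV (M.e x - M.e y) u - M.reflV (M.e x - M.e y) w ∧
      M.reflV (M.e x - M.e y) (a • u) = a • M.reflV (M.e x - M.e y) u := by
    intro a u w
    constructor
    · simp only [reflV, map_sub _ u w, LinearMap.sub_apply (M.B u)]
      module
    · simp only [reflV, map_smul _ a u, LinearMap.smul_apply a (M.B u), smul_eq_mul]
      module
  have hr : M.reflV (M.e x - M.e y) ν = ν' := by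
    rw [hν, hν', (hlin 0 _ _).1, (hlin _ _ 0).2, (hlin _ _ 0).2, (hlin 0 _ _).1, (hlin _ _ 0).2,
      hrx, hrp]
  have hr' : M.reflV (M.e x - M.e y) ν' = ν := by rw [← hr, M.reflV_reflV _ hvv]
  refine ⟨σ, hσ, hσx, hσy, fun u => ⟨?_, ?_⟩⟩
  · rw [hσe, ← hr', M.B_reflV _ hvv]
  · rw [hσe, ← hr, M.B_reflV _ hvv]

end QuadricModel

theorem image_eq_of_involutive {σ : X ≃ᵢ X} (hσ : IsReflection σ) {S : Set X}
    (h : ∀ u ∈ S, σ u ∈ S) : ⇑σ '' S = S := by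
  apply Subset.antisymm
  · rintro _ ⟨u, hu, rfl⟩
    exact h u hu
  · intro u hu
    refine ⟨σ u, h u hu, ?_⟩
    exact congrArg (fun f : X ≃ᵢ X => f u) hσ.1

/-- In a space where two distinct bisectors do not separate, each half-space is one of the sides
of the bisector of two points. -/
theorem IsHalfspace.exists_eq_side
    (hpath : ∀ x y u v : X, x ≠ y → u ≠ v → dist x u = dist x v → dist y u = dist y v →
      ∃ S : Set X, IsPreconnected S ∧ x ∈ S ∧ y ∈ S ∧
        ∀ z ∈ S, ¬ (dist z x = dist z y ∧ dist z u = dist z v))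
    (hside : ∀ x y : X, IsPreconnected {z | dist z x < dist z y})
    {P : Set X} (hP : IsHalfspace P) : ∃ x y, x ≠ y ∧ P = {z | dist z x ≤ dist z y} := by
  obtain ⟨σ, ⟨hinv, hne, -⟩, hcl, hun, hint⟩ := hP
  have hσσ : ∀ u, σ (σ u) = u := fun u => congrArg (fun f : X ≃ᵢ X => f u) hinv
  have hcl' : IsClosed (σ '' P) := σ.toHomeomorph.isClosedMap _ hcl
  have hsep : ∀ S : Set X, IsPreconnected S → (S ∩ P).Nonempty → (S ∩ σ '' P).Nonempty →
      ∃ z ∈ S, σ z = z := by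
    intro S hS h1 h2
    obtain ⟨z, hz, hz'⟩ := isPreconnected_closed_iff.1 hS P (σ '' P) hcl hcl'
      (by rw [hun]; exact subset_univ _) h1 h2
    rw [hint] at hz'
    exact ⟨z, hz, hz'⟩
  obtain ⟨x, hx, hxP⟩ : ∃ x, σ x ≠ x ∧ x ∈ P := by
    obtain ⟨x, hx⟩ : ∃ x, σ x ≠ x := by
      by_contra! h
      exact hne (IsometryEquiv.ext h)
    rcases (show x ∈ P ∪ σ '' P by rw [hun]; trivial) with h | ⟨z, hz, rfl⟩
    · exact ⟨x, hx, h⟩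
    · exact ⟨z, fun h => hx (by rw [h, h]), hz⟩
  have hfix : ∀ z, σ z = z → ∀ u, dist z u = dist z (σ u) := fun z hz u => by
    conv_rhs => rw [← hz]
    rw [σ.dist_eq]
  have hbis : ∀ u, dist u x = dist u (σ x) → σ u = u := by
    intro u hu
    by_contra hne
    have h1 : dist (σ u) x = dist u (σ x) := by
      conv_lhs => rw [← hσσ x, σ.dist_eq]
    obtain ⟨S, hS, hxS, hyS, hS'⟩ := hpath x (σ x) u (σ u) (Ne.symm hx) (Ne.symm hne)
      (by rw [dist_comm x, dist_comm x, h1, hu])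
      (by rw [σ.dist_eq, dist_comm (σ x), ← hu, dist_comm])
    obtain ⟨z, hz, hz'⟩ := hsep S hS ⟨x, hxS, hxP⟩ ⟨σ x, hyS, mem_image_of_mem _ hxP⟩
    exact hS' z hz ⟨hfix z hz' x, hfix z hz' u⟩
  have hPfix : ∀ z, σ z = z → z ∈ P := fun z hz =>
    (show z ∈ P ∩ σ '' P by rw [hint]; exact hz).1
  refine ⟨x, σ x, Ne.symm hx, Subset.antisymm (fun z hz => ?_) (fun z hz => ?_)⟩
  · by_contra h
    have h : dist z (σ x) < dist z x := not_le.1 h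
    obtain ⟨w, hw, hw'⟩ := hsep _ (hside (σ x) x) ⟨z, h, hz⟩
      ⟨σ x, by simpa using hx, mem_image_of_mem _ hxP⟩
    exact hw.ne (hfix w hw' x).symm
  · rcases eq_or_lt_of_le (show dist z x ≤ dist z (σ x) from hz) with h | h
    · exact hPfix z (hbis z h)
    · by_contra hzP
      have hz' : z ∈ σ '' P := by
        have : z ∈ P ∪ σ '' P := by rw [hun]; trivial
        exact this.resolve_left hzP
      obtain ⟨w, hw, hw'⟩ := hsep _ (hside x (σ x)) ⟨x, by simpa using Ne.symm hx, hxP⟩ ⟨z, h, hz'⟩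
      exact hw.ne (hfix w hw' x)

namespace QuadricModel

open Topology

variable {V : Type*} [NormedAddCommGroup V] [NormedSpace ℝ V] (M : QuadricModel X V)

theorem dist_lt (x y z w : X) :
    dist x y < dist z w ↔ M.B (M.e z) (M.e w) < M.B (M.e x) (M.e y) := by
  rw [← not_le, M.dist_le, not_le]

theorem exists_path_avoiding (M : QuadricModel X V) {x y u v : X} (hxy : x ≠ y) (huv : u ≠ v)
    (h1 : dist x u = dist x v) (h2 : dist y u = dist y v) :
    ∃ S : Set X, IsPreconnected S ∧ x ∈ S ∧ y ∈ S ∧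
      ∀ z ∈ S, ¬ (dist z x = dist z y ∧ dist z u = dist z v) := by
  rw [M.dist_eq] at h1 h2
  have hw := M.B_sub_pos hxy
  have hw' := M.B_sub_pos huv
  set b := M.B (M.e x) (M.e y) with hb
  have hbk := M.B_le x y
  set ω := M.e x - M.e y with hω
  set ω' := M.e u - M.e v with hω'
  have hq : M.B ω ω = 2 * (M.k - b) := by
    rw [hω, M.B_sub_self, M.self, M.self]; ring
  have hxω : M.B (M.e x) ω = M.k - b := by rw [hω, map_sub, M.self]
  have hyω : M.B (M.e y) ω = b - M.k := by rw [hω, map_sub, M.self, M.symm]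
  have hxω' : M.B (M.e x) ω' = 0 := by rw [hω', map_sub, h1, sub_self]
  have hyω' : M.B (M.e y) ω' = 0 := by rw [hω', map_sub, h2, sub_self]
  have hωω' : M.B ω ω' = 0 := by rw [hω, map_sub M.B, LinearMap.sub_apply, hxω', hyω', sub_zero]
  set l := √(M.B ω ω / M.B ω' ω') with hl
  have hl0 : 0 < l := Real.sqrt_pos.2 (div_pos hw hw')
  have hll : l ^ 2 * M.B ω' ω' = M.B ω ω := by
    rw [hl, Real.sq_sqrt (div_pos hw hw').le]; field_simp
  let p : ℝ → V := fun θ => (1 / 2 : ℝ) • (M.e x + M.e y) + (Real.cos θ / 2) • ω +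
    (Real.sin θ / 2 * l) • ω'
  have hpB : ∀ θ τ, M.B (p θ) τ = 1 / 2 * (M.B (M.e x) τ + M.B (M.e y) τ) +
      Real.cos θ / 2 * M.B ω τ + Real.sin θ / 2 * l * M.B ω' τ := fun θ τ => by
    simp only [p, map_add, map_smul, LinearMap.add_apply, LinearMap.smul_apply, smul_eq_mul]
  have hex : ∀ θ, ∃ z, M.e z = p θ := by
    intro θ
    apply M.mem _ x
    · rw [hpB]
      simp only [p, map_add, map_smul, smul_eq_mul, M.symm ω (M.e x), M.symm ω (M.e y),
        M.symm ω' (M.e x), M.symm ω' (M.e y), M.symm ω' ω, hxω, hyω, hxω', hyω', hωω', M.self,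
        M.symm (M.e y) (M.e x), ← hb, hq]
      rw [hq] at hll
      linear_combination (Real.sin θ) ^ 2 / 4 * hll + (M.k - b) / 2 * Real.sin_sq_add_cos_sq θ
    · intro hk
      rw [hpB, M.self, M.symm (M.e y), M.symm ω, M.symm ω', hxω, hxω', ← hb, hk]
      rw [hk] at hbk
      nlinarith [Real.cos_le_one θ]
  choose f hf using hex
  refine ⟨range f, ?_, ⟨0, ?_⟩, ⟨Real.pi, ?_⟩, ?_⟩
  · rw [← M.ind.isPreconnected_image, ← range_comp]
    have : M.e ∘ f = p := funext hf
    rw [this]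
    apply isPreconnected_range
    fun_prop
  · apply M.e_injective
    rw [hf]; simp only [p, Real.cos_zero, Real.sin_zero, hω]; module
  · apply M.e_injective
    rw [hf]; simp only [p, Real.cos_pi, Real.sin_pi, hω]; module
  · rintro _ ⟨θ, rfl⟩ ⟨h4, h5⟩
    rw [M.dist_eq, hf] at h4 h5
    have h6 : M.B (p θ) ω = 0 := by rw [hω, map_sub, h4, sub_self]
    have h7 : M.B (p θ) ω' = 0 := by rw [hω', map_sub, h5, sub_self]
    rw [hpB, hxω, hyω, M.symm ω' ω, hωω'] at h6
    rw [hpB, hxω', hyω', hωω'] at h7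
    have hc : Real.cos θ = 0 := by
      have : Real.cos θ * M.B ω ω = 0 := by linarith
      exact (mul_eq_zero.1 this).resolve_right hw.ne'
    have hs : Real.sin θ = 0 := by
      have : Real.sin θ * (l * M.B ω' ω') = 0 := by linarith
      exact (mul_eq_zero.1 this).resolve_right (mul_pos hl0 hw').ne'
    have := Real.sin_sq_add_cos_sq θ
    rw [hc, hs] at this
    norm_num at this

theorem isPreconnected_cap (ν : V) {s : ℝ} (hs : 0 ≤ s)
    (hν : ∀ u v : X, M.B (M.e u) ν < -M.k * s → M.B (M.e v) ν < -M.k * s → M.e u + M.e v ≠ 0) :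
    IsPreconnected {u : X | M.B (M.e u) ν < -M.k * s} := by
  apply isPreconnected_of_forall_pair
  intro u hu v hv
  obtain ⟨S, hS, huS, hvS, h⟩ := M.exists_segment (hν u v hu hv)
  refine ⟨S, fun w hw => ?_, huS, hvS, hS⟩
  obtain ⟨α, β, hα, hβ, hw⟩ := h w hw
  exact M.cap_lt hα hβ hs hw hu hv

theorem isPreconnected_side (M : QuadricModel X V) (x y : X) : IsPreconnected {z | dist z x < dist z y} := by
  have : {z | dist z x < dist z y} = {z : X | M.B (M.e z) (M.e y - M.e x) < -M.k * 0} := by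
    ext z
    simp only [mem_ofPred_eq, M.dist_lt, map_sub, mul_zero]
    constructor <;> intro h <;> linarith
  rw [this]
  refine M.isPreconnected_cap _ le_rfl fun u v hu hv h0 => ?_
  have : M.B (M.e u + M.e v) (M.e y - M.e x) < 0 := by
    rw [map_add, LinearMap.add_apply]; linarith
  rw [h0] at this
  simp at this

/-- Half-spaces are bounded by linear hyperplanes. -/
theorem exists_eq_of_isHalfspace {P : Set X} (hP : IsHalfspace P) :
    ∃ n, M.B n n = 1 ∧ P = M.region n 0 ∧ P.Nonempty := by
  obtain ⟨x, y, hxy, rfl⟩ := hP.exists_eq_side (fun x y u v => M.exists_path_avoiding)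
    M.isPreconnected_side
  have hv := M.B_sub_pos hxy.symm
  have hs := Real.sqrt_pos.2 hv
  refine ⟨(√(M.B (M.e y - M.e x) (M.e y - M.e x)))⁻¹ • (M.e y - M.e x), ?_, ?_, ⟨x, by simp⟩⟩
  · have := Real.mul_self_sqrt hv.le
    rw [map_smul, map_smul, LinearMap.smul_apply, smul_eq_mul, smul_eq_mul]
    field_simp
    linarith
  · ext z
    simp only [mem_ofPred_eq, region, M.dist_le, map_smul, smul_eq_mul]
    rw [inv_mul_le_iff₀ hs, mul_zero, map_sub, sub_nonpos]

theorem one_sub_nonneg {n : V} (hn : M.B n n = 1) (u : X) :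
    0 ≤ 1 - M.k * M.B (M.e u) n ^ 2 := by
  have h := M.nonneg u (n - (M.k * M.B (M.e u) n) • M.e u) (by
    rw [map_sub, map_smul, M.self, smul_eq_mul]
    linear_combination (-M.B (M.e u) n) * M.k_sq)
  have h2 : M.B (n - (M.k * M.B (M.e u) n) • M.e u) (n - (M.k * M.B (M.e u) n) • M.e u) =
      1 - M.k * M.B (M.e u) n ^ 2 := by
    simp only [map_sub, map_smul, LinearMap.sub_apply, LinearMap.smul_apply, smul_eq_mul, M.self,
      hn, M.symm n (M.e u)]
    linear_combination (M.k * M.B (M.e u) n ^ 2) * M.k_sq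
  rwa [h2] at h

/-- The orthogonal projection to a hyperplane. -/
theorem exists_foot {n : V} (hn : M.B n n = 1) (u : X) :
    ∃ f, √(1 - M.k * M.B (M.e u) n ^ 2) • M.e f = M.e u - M.B (M.e u) n • n := by
  set a := M.B (M.e u) n with ha
  have hB : M.B (M.e u - a • n) (M.e u - a • n) = M.k - a ^ 2 := by
    simp only [map_sub, map_smul, LinearMap.sub_apply, LinearMap.smul_apply, smul_eq_mul, M.self,
      hn, M.symm n (M.e u), ← ha]
    ring
  have hk2 := M.k_sq
  rcases eq_or_lt_of_le (M.one_sub_nonneg hn u) with h | h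
  · rw [← ha] at h
    have ha2 : a ^ 2 = M.k := by linear_combination M.k * h - a ^ 2 * hk2
    refine ⟨u, ?_⟩
    rw [← h, Real.sqrt_zero, zero_smul]
    by_contra h0
    have := M.pos u (M.e u - a • n) (by
      rw [map_sub, map_smul, M.self, ← ha, smul_eq_mul]; linarith) (Ne.symm h0)
    rw [hB, ha2] at this
    simp at this
  · rw [← ha] at h
    have hs := Real.sqrt_pos.2 h
    have hss := Real.mul_self_sqrt h.le
    obtain ⟨f, hf⟩ := M.mem ((√(1 - M.k * a ^ 2))⁻¹ • (M.e u - a • n)) u (by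
      rw [map_smul, map_smul, LinearMap.smul_apply, smul_eq_mul, smul_eq_mul, hB]
      field_simp
      linear_combination (-M.k) * hss + a ^ 2 * hk2) (by
      intro hk
      simp only [map_sub, map_smul, LinearMap.sub_apply, LinearMap.smul_apply, smul_eq_mul,
        M.self, M.symm n (M.e u), ← ha]
      apply mul_neg_of_pos_of_neg (inv_pos.2 hs)
      rw [hk]; nlinarith)
    exact ⟨f, by rw [hf, smul_smul, mul_inv_cancel₀ hs.ne', one_smul]⟩

theorem B_le_of_unit {n : V} (hn : M.B n n = 1) (u v : X) :
    M.B (M.e u) (M.e v) ≤ M.B (M.e u) n * M.B (M.e v) n +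
      M.k * (√(1 - M.k * M.B (M.e u) n ^ 2) * √(1 - M.k * M.B (M.e v) n ^ 2)) := by
  obtain ⟨f, hf⟩ := M.exists_foot hn u
  obtain ⟨g, hg⟩ := M.exists_foot hn v
  have h1 : M.B (M.e u - M.B (M.e u) n • n) (M.e v - M.B (M.e v) n • n) =
      M.B (M.e u) (M.e v) - M.B (M.e u) n * M.B (M.e v) n := by
    simp only [map_sub, map_smul, LinearMap.sub_apply, LinearMap.smul_apply, smul_eq_mul,
      hn, M.symm n (M.e v)]
    ring
  rw [← hf, ← hg] at h1
  simp only [map_smul, LinearMap.smul_apply, smul_eq_mul] at h1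
  have h2 := mul_le_mul_of_nonneg_left (M.B_le f g) (mul_nonneg
    (Real.sqrt_nonneg (1 - M.k * M.B (M.e u) n ^ 2)) (Real.sqrt_nonneg (1 - M.k * M.B (M.e v) n ^ 2)))
  linarith

/-- The numbers `C = cos lam`, `s = sin lam` resp. `C = -cosh lam`, `s = sinh lam`. -/
structure IsRadius (lam C s : ℝ) : Prop where
  s_pos : 0 < s
  C_pos : 0 < M.k * C
  sq_add : C ^ 2 + M.k * s ^ 2 = 1
  dist_le : ∀ u v : X, dist u v ≤ lam ↔ C ≤ M.B (M.e u) (M.e v)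
  dist_lt : ∀ u v : X, dist u v < lam ↔ C < M.B (M.e u) (M.e v)

theorem exists_isRadius {lam : ℝ} (h0 : 0 < lam) (h1 : M.k = 1 → lam < Real.pi / 2) :
    ∃ C s, M.IsRadius lam C s := by
  rcases M.hk with hk | hk
  · have hcos : ∀ u v : X, M.B (M.e u) (M.e v) = Real.cos (dist u v) := fun u v => by
      have hle := M.B_le u v
      rw [hk] at hle
      rw [M.arccos hk, Real.cos_arccos _ hle]
      by_cases h : M.e u + M.e v = 0
      · rw [eq_neg_of_add_eq_zero_right h, map_neg, M.self, hk]
      · have := M.neg_one_lt_of_add_ne h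
        rw [hk, one_mul] at this
        exact this.le
    have hlam : lam ∈ Icc 0 Real.pi := ⟨h0.le, by linarith [h1 hk, Real.pi_pos]⟩
    have hd : ∀ u v : X, dist u v ∈ Icc 0 Real.pi := fun u v =>
      ⟨dist_nonneg, by rw [M.arccos hk]; exact Real.arccos_le_pi _⟩
    refine ⟨Real.cos lam, Real.sin lam, Real.sin_pos_of_pos_of_lt_pi h0
      (by linarith [h1 hk, Real.pi_pos]), ?_, ?_, fun u v => ?_, fun u v => ?_⟩
    · rw [hk, one_mul]
      exact Real.cos_pos_of_mem_Ioo ⟨by linarith [Real.pi_pos], h1 hk⟩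
    · rw [hk, one_mul, Real.cos_sq_add_sin_sq]
    · rw [hcos]
      exact (Real.strictAntiOn_cos.le_iff_ge hlam (hd u v)).symm
    · rw [hcos]
      exact (Real.strictAntiOn_cos.lt_iff_gt hlam (hd u v)).symm
  · have hcosh : ∀ u v : X, M.B (M.e u) (M.e v) = -Real.cosh (dist u v) := fun u v => by
      rw [M.cosh hk, neg_neg]
    refine ⟨-Real.cosh lam, Real.sinh lam, Real.sinh_pos_iff.2 h0, ?_, ?_, fun u v => ?_,
      fun u v => ?_⟩
    · rw [hk]; linarith [Real.cosh_pos lam]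
    · rw [hk, neg_sq, Real.cosh_sq]; ring
    · rw [hcosh, neg_le_neg_iff, Real.cosh_le_cosh, abs_of_pos h0, abs_of_nonneg dist_nonneg]
    · rw [hcosh, neg_lt_neg_iff, Real.cosh_lt_cosh, abs_of_pos h0, abs_of_nonneg dist_nonneg]

variable {M}

theorem IsRadius.s_sq_lt {lam C s : ℝ} (h : M.IsRadius lam C s) : 0 < 1 - M.k * s ^ 2 := by
  have h1 := h.sq_add
  have h2 := h.C_pos
  have h3 : C ≠ 0 := by rintro rfl; simp at h2
  have := sq_pos_of_ne_zero h3
  linarith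

theorem IsRadius.C_eq {lam C s : ℝ} (h : M.IsRadius lam C s) : C = M.k * √(1 - M.k * s ^ 2) := by
  have h1 : 1 - M.k * s ^ 2 = (M.k * C) ^ 2 := by
    linear_combination -h.sq_add - C ^ 2 * M.k_sq
  rw [h1, Real.sqrt_sq h.C_pos.le]
  linear_combination (-C) * M.k_sq

variable (M)

theorem setOf_infDist_le {n : V} (hn : M.B n n = 1) (hne : (M.region n 0).Nonempty)
    [FiniteDimensional ℝ V]
    {lam C s : ℝ} (h : M.IsRadius lam C s) : {u | infDist u (M.region n 0) ≤ lam} = M.region n s := by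
  have := M.proper
  have hC := h.C_eq
  have hs := h.s_sq_lt
  have hs0 := h.s_pos
  have hlam : 0 ≤ lam := by
    obtain ⟨u, -⟩ := hne
    have h1 := (h.dist_le u u).2 (by
      rw [M.self]
      have h2 := h.sq_add
      have h3 := h.C_pos
      rcases M.hk with hk | hk <;> rw [hk] at h2 h3 ⊢ <;> nlinarith)
    rwa [dist_self] at h1
  have hmono : ∀ a, 0 ≤ a → a ≤ s → M.k * √(1 - M.k * s ^ 2) ≤ M.k * √(1 - M.k * a ^ 2) := by
    intro a ha has
    have : a ^ 2 ≤ s ^ 2 := by gcongr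
    rcases M.hk with hk | hk <;> rw [hk]
    · rw [one_mul _, one_mul √(1 - 1 * a ^ 2)]; apply Real.sqrt_le_sqrt; linarith
    · have : √(1 - -1 * a ^ 2) ≤ √(1 - -1 * s ^ 2) := by apply Real.sqrt_le_sqrt; linarith
      linarith
  ext u
  change infDist u (M.region n 0) ≤ lam ↔ M.B (M.e u) n ≤ s
  constructor
  · intro hu
    obtain ⟨v, hv, hd⟩ := (M.isClosed_region n 0).exists_infDist_eq_dist hne u
    rw [hd, h.dist_le] at hu
    by_contra! ha
    have h1 := M.B_le_of_unit hn u v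
    have h2 := M.one_sub_nonneg hn u
    have h3 := M.one_sub_nonneg hn v
    have hv : M.B (M.e v) n ≤ 0 := hv
    set a := M.B (M.e u) n
    set b := M.B (M.e v) n
    have hab : a * b ≤ 0 := mul_nonpos_of_nonneg_of_nonpos (by linarith) hv
    have has : s ^ 2 < a ^ 2 := by gcongr
    rw [hC] at hu
    rcases M.hk with hk | hk <;> rw [hk] at h1 h2 h3 hu hs
    · have h4 : √(1 - 1 * a ^ 2) < √(1 - 1 * s ^ 2) := Real.sqrt_lt_sqrt h2 (by linarith)
      have h5 : √(1 - 1 * b ^ 2) ≤ 1 := Real.sqrt_le_one.2 (by nlinarith)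
      have h6 := mul_le_mul_of_nonneg_left h5 (Real.sqrt_nonneg (1 - 1 * a ^ 2))
      linarith
    · have h4 : √(1 - -1 * s ^ 2) < √(1 - -1 * a ^ 2) := Real.sqrt_lt_sqrt hs.le (by linarith)
      have h5 : 1 ≤ √(1 - -1 * b ^ 2) := by
        rw [Real.one_le_sqrt]; nlinarith
      have h6 := mul_le_mul_of_nonneg_left h5 (Real.sqrt_nonneg (1 - -1 * a ^ 2))
      linarith
  · intro hu
    rcases le_or_gt (M.B (M.e u) n) 0 with ha | ha
    · rw [infDist_zero_of_mem (show u ∈ M.region n 0 from ha)]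
      exact hlam
    · obtain ⟨f, hf⟩ := M.exists_foot hn u
      have h4 := hmono _ ha.le hu
      set a := M.B (M.e u) n with had
      have hpos : 0 < √(1 - M.k * a ^ 2) := by
        have h5 := h.C_pos
        rw [hC] at h5
        rcases eq_or_lt_of_le (Real.sqrt_nonneg (1 - M.k * a ^ 2)) with h6 | h6
        · rw [← h6] at h4
          rcases M.hk with hk | hk
          · rw [hk] at h4 h5; linarith
          · rw [hk] at h6
            have : 0 < √(1 - -1 * a ^ 2) := Real.sqrt_pos.2 (by nlinarith)
            linarith
        · exact h6
      have hfn : M.B (M.e f) n = 0 := by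
        have h5 : √(1 - M.k * a ^ 2) * M.B (M.e f) n = 0 := by
          rw [← smul_eq_mul, ← LinearMap.smul_apply, ← map_smul, hf, map_sub, LinearMap.sub_apply,
            map_smul, LinearMap.smul_apply, hn, ← had]
          simp
        exact (mul_eq_zero.1 h5).resolve_left hpos.ne'
      refine (infDist_le_dist_of_mem (show f ∈ M.region n 0 from hfn.le)).trans ?_
      rw [h.dist_le, hC]
      have hu' : M.e u = √(1 - M.k * a ^ 2) • M.e f + a • n := by rw [hf]; abel
      rw [hu', map_add, map_smul, map_smul, LinearMap.add_apply, LinearMap.smul_apply,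
        LinearMap.smul_apply, M.self, M.symm n, hfn, smul_eq_mul, smul_eq_mul]
      linarith

theorem frontier_region [FiniteDimensional ℝ V] {n : V} (hn : M.B n n = 1) {s : ℝ}
    (hs : 0 < 1 - M.k * s ^ 2) : frontier (M.region n s) = {u | M.B (M.e u) n = s} := by
  apply Subset.antisymm
  · intro u hu
    exact M.eq_of_mem_frontier_region hu
  · intro u hu
    have hu : M.B (M.e u) n = s := hu
    rw [(M.isClosed_region n s).frontier_eq]
    refine ⟨hu.le, fun hi => ?_⟩
    obtain ⟨v, hv, hv'⟩ := M.exists_move u (n - (M.k * s) • M.e u) (by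
      rw [map_sub, map_smul, M.self, hu, smul_eq_mul]
      linear_combination (-s) * M.k_sq)
    have h1 := hv' n (by
      rw [map_sub, map_smul, LinearMap.sub_apply, LinearMap.smul_apply, hn, hu, smul_eq_mul]
      linarith)
    obtain ⟨t, ht1, ht2⟩ := (h1.and (hv.eventually (isOpen_interior.mem_nhds hi))).exists
    have h3 : v t ∈ M.region n s := interior_subset ht2
    have h3 : M.B (M.e (v t)) n ≤ s := h3
    linarith

theorem isRadius_of_isHypersphere [FiniteDimensional ℝ V] {Y : Set X} {lam : ℝ}
    (h : IsHypersphere Y lam) (hY : Y.Nonempty) :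
    (∃ C s, M.IsRadius lam C s) ∧ ∀ C s, M.IsRadius lam C s →
      ∃ n, M.B n n = 1 ∧ Y = {u | M.B (M.e u) n = s} ∧ (M.region n 0).Nonempty := by
  obtain ⟨h0, ⟨P, hP, hYP⟩, -⟩ := h
  obtain ⟨n, hn, rfl, hne⟩ := M.exists_eq_of_isHalfspace hP
  refine ⟨M.exists_isRadius h0 fun hk => ?_, fun C s hr => ⟨n, hn, ?_, hne⟩⟩
  · by_contra! hlam
    have : {u | infDist u (M.region n 0) ≤ lam} = univ := by
      refine eq_univ_of_forall fun u => ?_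
      obtain ⟨τ, h1, h2, h3⟩ := M.exists_unit_orthogonal u n
      obtain ⟨z, hz⟩ := M.mem τ u (by rw [h1, hk]) (fun h => by rw [hk] at h; norm_num at h)
      have hzP : z ∈ M.region n 0 := by
        change M.B (M.e z) n ≤ 0
        rw [hz, M.symm, h3]
      refine (infDist_le_dist_of_mem hzP).trans ?_
      rw [M.arccos hk, hz, h2, Real.arccos_zero]
      exact hlam
    rw [hYP, this, frontier_univ] at hY
    exact not_nonempty_empty hY
  · rw [hYP, M.setOf_infDist_le hn hne hr, M.frontier_region hn hr.s_sq_lt]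

end QuadricModel

namespace QuadricModel

open Topology

variable {V : Type*} [NormedAddCommGroup V] [NormedSpace ℝ V] (M : QuadricModel X V)

theorem exists_mid {x u : X} (hne : x ≠ u) (h0 : M.e x + M.e u ≠ 0) :
    ∃ m t, 0 < t ∧ M.e m = t • M.e x + t • M.e u ∧ 0 < M.k * (2 * t - 1) := by
  have h1 := M.neg_one_lt_of_add_ne h0
  have h2 := M.B_lt x u hne
  have h3 : M.k = -1 → M.B (M.e x) (M.e u) < 0 := fun hk => M.neg hk x u
  have hk2 := M.k_sq
  set b := M.B (M.e x) (M.e u) with hb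
  have hpos : 0 < 2 * (1 + M.k * b) := by linarith
  set N := √(2 * (1 + M.k * b)) with hN
  have hN0 : 0 < N := Real.sqrt_pos.2 hpos
  have hNN : N ^ 2 = 2 * (1 + M.k * b) := Real.sq_sqrt hpos.le
  obtain ⟨m, hm⟩ := M.mem (N⁻¹ • M.e x + N⁻¹ • M.e u) x (by
    simp only [map_add, map_smul, LinearMap.add_apply, LinearMap.smul_apply, smul_eq_mul,
      M.symm (M.e u) (M.e x), M.self, ← hb]
    field_simp
    linear_combination (-M.k) * hNN - 2 * b * hk2) (by
    intro hk
    simp only [map_add, map_smul, LinearMap.add_apply, LinearMap.smul_apply, smul_eq_mul,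
      M.symm (M.e u) (M.e x), M.self, ← hb]
    have := mul_pos (inv_pos.2 hN0) (show 0 < 1 - b by linarith [h3 hk])
    rw [hk]; linarith)
  refine ⟨m, N⁻¹, inv_pos.2 hN0, hm, ?_⟩
  have h4 : 2 * N⁻¹ - 1 = (2 - N) / N := by field_simp
  rw [h4, ← mul_div_assoc]
  apply div_pos _ hN0
  rcases M.hk with hk | hk <;> rw [hk] at hNN h2 ⊢ <;> nlinarith

/-- The boundary of a cap contains two non-antipodal points, so that points of their segment lie
strictly inside the cap. -/
theorem exists_mem_lt [FiniteDimensional ℝ V] {K : Set X} (hK : GConvex K) {lam C s : ℝ}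
    (hr : M.IsRadius lam C s) {ν : V} (hν : M.B ν ν = 1) {x : X} (hx : M.B (M.e x) ν = -M.k * s)
    (hsub : {u : X | M.B (M.e u) ν = -M.k * s} ⊆ K) : ∃ m ∈ K, M.B (M.e m) ν < -M.k * s := by
  have hk2 := M.k_sq
  have hC := hr.C_pos
  have hC2 := hr.sq_add
  have hC0 : C ≠ 0 := by rintro rfl; simp at hC
  obtain ⟨τ, h1, h2, h3⟩ := M.exists_unit_orthogonal x ν
  set c := -M.k * s with hc
  set f := M.e x - c • ν with hf
  have hxf : M.B (M.e x) f = M.k * C ^ 2 := by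
    rw [hf, map_sub, M.self, map_smul, hx, smul_eq_mul, hc]
    linear_combination (-M.k) * hC2
  have hfν : M.B f ν = 0 := by
    rw [hf, map_sub, LinearMap.sub_apply, map_smul, LinearMap.smul_apply, hx, hν]; simp
  have hfτ : M.B f τ = 0 := by
    rw [hf, map_sub, LinearMap.sub_apply, map_smul, LinearMap.smul_apply, h2, h3]; simp
  have hff : M.B f f = M.k * C ^ 2 := by
    nth_rewrite 2 [hf]
    rw [map_sub, map_smul, hfν, M.symm, hxf]; simp
  set v := τ + (1 / (2 * C)) • f with hv
  have hvv : M.B v v = 1 + M.k / 4 := by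
    simp only [hv, map_add, map_smul, LinearMap.add_apply, LinearMap.smul_apply, smul_eq_mul,
      h1, hfτ, M.symm τ f, hff]
    field_simp
    ring
  have hxv : M.B (M.e x) v = M.k * C / 2 := by
    rw [hv, map_add, map_smul, h2, hxf, smul_eq_mul]
    field_simp
    ring
  have hvν : M.B v ν = 0 := by
    rw [hv, map_add, LinearMap.add_apply, map_smul, LinearMap.smul_apply, hfν, M.symm, h3]; simp
  have hk4 : 0 < 1 + M.k / 4 := by rcases M.hk with hk | hk <;> rw [hk] <;> norm_num
  obtain ⟨u, hu⟩ := M.exists_reflV v (by rw [hvv]; exact hk4) x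
  have huν : M.B (M.e u) ν = c := by
    rw [hu, reflV, map_sub, LinearMap.sub_apply, map_smul, LinearMap.smul_apply, hvν, hx]; simp
  have hux : M.B (M.e x) (M.e u) = M.k - C ^ 2 / (2 * (1 + M.k / 4)) := by
    rw [hu, reflV, map_sub, map_smul, M.self, hxv, hvv, smul_eq_mul]
    have hC2 : 2 * (M.k * C / 2) / (1 + M.k / 4) * (M.k * C / 2) =
        C ^ 2 / (2 * (1 + M.k / 4)) := by
      rw [div_mul_eq_mul_div, div_eq_div_iff hk4.ne' (by positivity)]
      linear_combination C ^ 2 * (1 + M.k / 4) * M.k_sq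
    rw [hC2]
  have hCsq : 0 < C ^ 2 := by positivity
  have hne : x ≠ u := by
    rintro rfl
    rw [M.self] at hux
    have : 0 < C ^ 2 / (2 * (1 + M.k / 4)) := by positivity
    linarith
  have hs := hr.s_pos
  have h0 : M.e x + M.e u ≠ 0 := by
    intro h0
    have h4 : M.B (M.e x + M.e u) ν = c + c := by rw [map_add, LinearMap.add_apply, hx, huν]
    rw [h0, map_zero, LinearMap.zero_apply] at h4
    have h5 : M.k * s = 0 := by linarith
    exact (mul_ne_zero M.k_ne hs.ne') h5
  obtain ⟨m, t, ht, hm, ht'⟩ := M.exists_mid hne h0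
  refine ⟨m, M.mem_of_gconvex hK (hsub hx) (hsub huν) ht.le ht.le hm, ?_⟩
  rw [hm, map_add, map_smul, map_smul, LinearMap.add_apply, LinearMap.smul_apply,
    LinearMap.smul_apply, hx, huν, smul_eq_mul, hc]
  nlinarith [mul_pos ht' hs]

/-- A convex body whose boundary contains a full hypersphere lies on one side of it. -/
theorem subset_region_of_frontier [FiniteDimensional ℝ V] {K : Set X} (hK : GConvex K)
    (hint : (interior K).Nonempty) {ν : V} {c : ℝ}
    (hfr : {u : X | M.B (M.e u) ν = c} ⊆ frontier K) {m : X} (hm : m ∈ K)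
    (hmc : M.B (M.e m) ν < c) : K ⊆ M.region ν c := by
  have key : ∀ a ∈ K, ∀ O : Set X, IsOpen O → O.Nonempty → O ⊆ interior K →
      (∀ o ∈ O, c ∈ uIcc (M.B (M.e a) ν) (M.B (M.e o) ν)) → M.B (M.e a) ν ≠ c → False := by
    intro a ha O hO hne hOK hside hac
    obtain ⟨o, ho, ho'⟩ := M.exists_ne_mem_open hO hne (-M.e a)
    obtain ⟨S, hS, haS, hoS, hseg⟩ := M.exists_segment (x := a) (y := o)
      (fun h => ho' (eq_neg_of_add_eq_zero_right h))
    obtain ⟨w, hw, hwc⟩ : ∃ w ∈ S, M.B (M.e w) ν = c := by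
      have h := hside o ho
      rcases le_total (M.B (M.e a) ν) (M.B (M.e o) ν) with h' | h'
      · rw [uIcc_of_le h'] at h
        exact hS.intermediate_value haS hoS (M.continuous_B ν).continuousOn h
      · rw [uIcc_of_ge h'] at h
        exact hS.intermediate_value hoS haS (M.continuous_B ν).continuousOn h
    obtain ⟨α, β, hα, hβ, hwe⟩ := hseg w hw
    rcases eq_or_lt_of_le hβ with hβ0 | hβ0
    · rw [← hβ0, zero_smul, add_zero] at hwe
      have h1 := M.self w
      rw [hwe] at h1
      simp only [map_smul, LinearMap.smul_apply, smul_eq_mul, M.self] at h1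
      have h2 : α = 1 := by
        have : M.k * (α ^ 2 - 1) = 0 := by linear_combination h1
        have := (mul_eq_zero.1 this).resolve_left M.k_ne
        nlinarith
      rw [h2, one_smul] at hwe
      rw [hwe] at hwc
      exact hac hwc
    · have h1 := M.mem_interior_of_gconvex hK ha (hOK ho) hα hβ0 hwe
      exact (hfr hwc).2 h1
  intro z hz
  by_contra hzc
  have hzc : c < M.B (M.e z) ν := not_le.1 hzc
  have hopen1 : IsOpen {u : X | M.B (M.e u) ν < c} := isOpen_lt (M.continuous_B ν) continuous_const
  have hopen2 : IsOpen {u : X | c < M.B (M.e u) ν} := isOpen_lt continuous_const (M.continuous_B ν)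
  obtain ⟨o, ho⟩ := hint
  rcases lt_trichotomy (M.B (M.e o) ν) c with h | h | h
  · refine key z hz _ (isOpen_interior.inter hopen1) ⟨o, ho, h⟩ inter_subset_left ?_ hzc.ne'
    intro o' ho'
    rw [uIcc_of_ge (ho'.2.le.trans hzc.le)]
    exact ⟨ho'.2.le, hzc.le⟩
  · exact (hfr h).2 ho
  · refine key m hm _ (isOpen_interior.inter hopen2) ⟨o, ho, h⟩ inter_subset_left ?_ hmc.ne
    intro o' ho'
    rw [uIcc_of_le (hmc.le.trans ho'.2.le)]
    exact ⟨hmc.le, ho'.2.le⟩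

/-- On the sphere, nested boundary hyperspheres of the same radius coincide. -/
theorem eq_of_subset_region_sphere (hk : M.k = 1) {lam C s : ℝ} (hr : M.IsRadius lam C s)
    {ν ν' : V} (hν : M.B ν ν = 1) (hν' : M.B ν' ν' = 1) {x : X} (hx : M.B (M.e x) ν = -M.k * s)
    (hsub : {u : X | M.B (M.e u) ν = -M.k * s} ⊆ M.region ν' (-M.k * s)) : ν = ν' := by
  rw [hk] at hx hsub
  have hs := hr.s_pos
  obtain ⟨a, ha⟩ := M.mem ν x (by rw [hν, hk]) (fun h => by rw [hk] at h; norm_num at h)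
  obtain ⟨b, hb⟩ := M.mem ν' x (by rw [hν', hk]) (fun h => by rw [hk] at h; norm_num at h)
  obtain ⟨u, hu⟩ := M.mem ((2 * (-1 * s)) • ν - M.e x) x (by
    simp only [map_sub, map_smul, LinearMap.sub_apply, LinearMap.smul_apply, smul_eq_mul, M.self,
      hν, hx, M.symm ν (M.e x)]
    ring) (fun h => by rw [hk] at h; norm_num at h)
  have h1 : M.B (M.e x) ν' ≤ -1 * s := hsub hx
  have h2 : M.B (M.e u) ν' ≤ -1 * s := hsub (by
    change M.B (M.e u) ν = -1 * s
    rw [hu, map_sub, LinearMap.sub_apply, map_smul, LinearMap.smul_apply, hν, hx, smul_eq_mul]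
    ring)
  rw [hu, map_sub, LinearMap.sub_apply, map_smul, LinearMap.smul_apply, smul_eq_mul] at h2
  have h3 : 1 ≤ M.B ν ν' := by nlinarith
  rw [← ha, ← hb, ← hk] at h3
  rw [← ha, ← hb, M.eq_of_B a b h3]

theorem B_le_mul_of_subset_region_hyperbolic [FiniteDimensional ℝ V] (hk : M.k = -1)
    {lam C s : ℝ} (hr : M.IsRadius lam C s) {n n' : V} (hn : M.B n n = 1)
    (hsub : {u : X | M.B (M.e u) n = s} ⊆ M.region n' s) (u : X) :
    M.B (M.e u) n' ≤ M.B n n' * M.B (M.e u) n := by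
  obtain ⟨f, hf⟩ := M.exists_foot hn u
  rw [hk] at hf
  set a := M.B (M.e u) n with ha
  have hq : 0 < √(1 - -1 * a ^ 2) := Real.sqrt_pos.2 (by nlinarith)
  have hfn : M.B (M.e f) n = 0 := by
    have h5 : √(1 - -1 * a ^ 2) * M.B (M.e f) n = 0 := by
      rw [← smul_eq_mul, ← LinearMap.smul_apply, ← map_smul, hf, map_sub, LinearMap.sub_apply,
        map_smul, LinearMap.smul_apply, hn, ← ha]
      simp
    exact (mul_eq_zero.1 h5).resolve_left hq.ne'
  obtain ⟨τ, h1, h2, h3⟩ := M.exists_unit_orthogonal f n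
  have hsq := hr.sq_add
  rw [hk] at hsq
  have hpt : ∀ A D : ℝ, 1 ≤ A → A ^ 2 - D ^ 2 = 1 → -C * A * M.B (M.e f) n' +
      -C * D * M.B τ n' + s * M.B n n' ≤ s := by
    intro A D hA hAD
    obtain ⟨z, hz⟩ := M.mem ((-C * A) • M.e f + (-C * D) • τ + s • n) f (by
      simp only [map_add, map_smul, LinearMap.add_apply, LinearMap.smul_apply, smul_eq_mul, M.self,
        hn, hfn, h1, h2, h3, M.symm n (M.e f), M.symm τ (M.e f), M.symm τ n, hk]
      linear_combination (-C ^ 2) * hAD - hsq) (by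
      intro _
      simp only [map_add, map_smul, LinearMap.add_apply, LinearMap.smul_apply, smul_eq_mul, M.self,
        hfn, h2, M.symm n (M.e f), M.symm τ (M.e f), hk]
      have := hr.C_pos
      rw [hk] at this
      nlinarith)
    have h6 : z ∈ M.region n' s := hsub (by
      change M.B (M.e z) n = s
      rw [hz]
      simp only [map_add, map_smul, LinearMap.add_apply, LinearMap.smul_apply, smul_eq_mul,
        hn, hfn, M.symm τ n, h3]
      ring)
    have h7 : M.B (M.e z) n' ≤ s := h6
    rw [hz] at h7
    simpa only [map_add, map_smul, LinearMap.add_apply, LinearMap.smul_apply, smul_eq_mul] using h7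
  have hfn' : M.B (M.e f) n' ≤ 0 := by
    by_contra! hpos
    have hC := hr.C_pos
    rw [hk] at hC
    have hp : 0 < -C * M.B (M.e f) n' := mul_pos (by linarith) hpos
    obtain ⟨A, hA1, hA2⟩ : ∃ A : ℝ, 1 ≤ A ∧
        s - s * M.B n n' < A * (-C * M.B (M.e f) n') := by
      refine ⟨max 1 ((s - s * M.B n n' + 1) / (-C * M.B (M.e f) n')), le_max_left _ _, ?_⟩
      have := (div_le_iff₀ hp).1 (le_max_right 1 ((s - s * M.B n n' + 1) / (-C * M.B (M.e f) n')))
      linarith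
    have hD := Real.sq_sqrt (show 0 ≤ A ^ 2 - 1 by nlinarith)
    have h8 := hpt A √(A ^ 2 - 1) hA1 (by rw [hD]; ring)
    have h9 := hpt A (-√(A ^ 2 - 1)) hA1 (by rw [neg_sq, hD]; ring)
    nlinarith
  have hu : M.e u = √(1 - -1 * a ^ 2) • M.e f + a • n := by rw [hf]; abel
  rw [hu, map_add, map_smul, map_smul, LinearMap.add_apply, LinearMap.smul_apply,
    LinearMap.smul_apply, smul_eq_mul, smul_eq_mul]
  have := mul_nonpos_of_nonneg_of_nonpos hq.le hfn'
  linarith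

/-- Near a boundary point of a cap no further boundary hypersphere of the same radius occurs. -/
theorem le_B_of_subset_region [FiniteDimensional ℝ V] {lam C s : ℝ} (hr : M.IsRadius lam C s)
    {ν ν' : V} (hν : M.B ν ν = 1) (hν' : M.B ν' ν' = 1) {x z : X} (hx : M.B (M.e x) ν = -M.k * s)
    (hz : M.B (M.e z) ν' = -M.k * s) (hxz : C ≤ M.B (M.e x) (M.e z))
    (hsub : {u : X | M.B (M.e u) ν = -M.k * s} ⊆ M.region ν' (-M.k * s))
    (hsub' : {u : X | M.B (M.e u) ν' = -M.k * s} ⊆ M.region ν (-M.k * s)) :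
    -M.k * s ≤ M.B (M.e z) ν := by
  rcases M.hk with hk | hk
  · rw [M.eq_of_subset_region_sphere hk hr hν hν' hx hsub, hz]
  · by_contra! hzν
    have hc : -M.k * s = s := by rw [hk]; ring
    rw [hc] at hx hz hsub hsub' hzν
    have hs := hr.s_pos
    have hC := hr.C_eq
    have h1 := M.B_le_mul_of_subset_region_hyperbolic hk hr hν hsub
    have h2 := M.B_le_mul_of_subset_region_hyperbolic hk hr hν' hsub'
    rw [M.symm ν' ν] at h2
    have h3 := M.B_le_of_unit hν x z
    have h4 := h1 z
    rw [hx, hk] at h3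
    rw [hk] at hC
    rw [hz] at h4
    set h := M.B ν ν' with hh
    set a := M.B (M.e z) ν with ha
    have ha0 : 0 ≤ a := by
      by_contra! ha0
      have h5 : 1 ≤ √(1 - -1 * a ^ 2) := by rw [Real.one_le_sqrt]; nlinarith
      have h6 := mul_le_mul_of_nonneg_left h5 (Real.sqrt_nonneg (1 - -1 * s ^ 2))
      have h7 := mul_pos hs (neg_pos.2 ha0)
      linarith
    have ha1 : 0 < a := by
      rcases eq_or_lt_of_le ha0 with h5 | h5
      · rw [← h5] at h4; linarith
      · exact h5
    have hh1 : 1 < h := by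
      by_contra! h5
      nlinarith
    obtain ⟨u, hu⟩ := M.exists_reflV ν (by rw [hν]; exact one_pos) z
    have huν : M.B (M.e u) ν = -a := by
      rw [hu, reflV, map_sub, LinearMap.sub_apply, map_smul, LinearMap.smul_apply, hν, ← ha,
        smul_eq_mul]
      ring
    have h5 := h1 u
    have h6 := h2 u
    rw [huν] at h5 h6
    nlinarith

/-- Local structure of a convex body bounded by congruent hyperspheres. -/
theorem exists_local_region [FiniteDimensional ℝ V] {K : Set X} (hcl : IsClosed K)
    (hK : GConvex K) (hint : (interior K).Nonempty) {lam C s : ℝ} (hr : M.IsRadius lam C s)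
    (hcomp : ∀ z ∈ frontier K, ∃ ν, M.B ν ν = 1 ∧ M.B (M.e z) ν = -M.k * s ∧
      {u : X | M.B (M.e u) ν = -M.k * s} ⊆ frontier K) {x : X} (hx : x ∈ frontier K) :
    ∃ ν, M.B ν ν = 1 ∧ M.B (M.e x) ν = -M.k * s ∧ K ⊆ M.region ν (-M.k * s) ∧
      ∀ u ∈ M.region ν (-M.k * s), dist x u < lam → u ∈ K := by
  have hfrK : frontier K ⊆ K := hcl.frontier_subset
  have hcomp' : ∀ z ∈ frontier K, ∃ ν, M.B ν ν = 1 ∧ M.B (M.e z) ν = -M.k * s ∧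
      {u : X | M.B (M.e u) ν = -M.k * s} ⊆ frontier K ∧ K ⊆ M.region ν (-M.k * s) := by
    intro z hz
    obtain ⟨ν, h1, h2, h3⟩ := hcomp z hz
    obtain ⟨m, hm, hm'⟩ := M.exists_mem_lt hK hr h1 h2 (h3.trans hfrK)
    exact ⟨ν, h1, h2, h3, M.subset_region_of_frontier hK hint h3 hm hm'⟩
  obtain ⟨ν, hν, hxν, hfr, hKr⟩ := hcomp' x hx
  refine ⟨ν, hν, hxν, hKr, ?_⟩
  set A := {u : X | M.B (M.e u) ν < -M.k * s} ∩ ball x lam with hA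
  have hAB : ∀ u ∈ A, M.B (M.e u) (-M.e x) < -M.k * (M.k * C) := by
    rintro u ⟨-, hu⟩
    have h1 := (hr.dist_lt u x).1 hu
    rw [map_neg]
    have : -M.k * (M.k * C) = -C := by linear_combination (-C) * M.k_sq
    linarith
  have hAfr : ∀ u ∈ A, u ∉ frontier K := by
    intro u hu hufr
    obtain ⟨ν', hν', huν', hfr', hKr'⟩ := hcomp' u hufr
    have h1 := (hr.dist_lt u x).1 hu.2
    exact absurd hu.1 (not_lt.2 (M.le_B_of_subset_region hr hν hν' hxν huν'
      (by rw [M.symm]; exact h1.le) ((hfr.trans hfrK).trans hKr') ((hfr'.trans hfrK).trans hKr)))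
  have hApre : IsPreconnected A := by
    apply isPreconnected_of_forall_pair
    intro u hu v hv
    have h0 : M.e u + M.e v ≠ 0 := by
      intro h0
      have h1 : M.B (M.e u + M.e v) (M.e x) = M.B (M.e u) (M.e x) + M.B (M.e v) (M.e x) := by
        rw [map_add, LinearMap.add_apply]
      rw [h0, map_zero, LinearMap.zero_apply] at h1
      rcases M.hk with hk | hk
      · have h2 := hr.C_pos
        have h3 := (hr.dist_lt u x).1 hu.2
        have h4 := (hr.dist_lt v x).1 hv.2
        rw [hk] at h2
        linarith
      · linarith [M.neg hk u x, M.neg hk v x]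
    obtain ⟨S, hS, huS, hvS, hseg⟩ := M.exists_segment h0
    refine ⟨S, fun w hw => ?_, huS, hvS, hS⟩
    obtain ⟨α, β, hα, hβ, hwe⟩ := hseg w hw
    refine ⟨M.cap_lt hα hβ hr.s_pos.le hwe hu.1 hv.1, ?_⟩
    have h1 := M.cap_lt hα hβ hr.C_pos.le hwe (hAB u hu) (hAB v hv)
    rw [mem_ball, hr.dist_lt]
    rw [map_neg] at h1
    have : -M.k * (M.k * C) = -C := by linear_combination (-C) * M.k_sq
    linarith
  have hlam : 0 < lam := by
    by_contra! h
    have h1 := not_lt.2 (show lam ≤ dist x x by simpa using h)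
    rw [hr.dist_lt, M.self] at h1
    have h2 := hr.C_pos
    have h3 := hr.sq_add
    have h4 := hr.s_pos
    rcases M.hk with hk | hk <;> rw [hk] at h1 h2 h3 <;> nlinarith
  have hAK : (A ∩ interior K).Nonempty := by
    obtain ⟨o, ho, ho'⟩ := M.exists_ne_mem_open isOpen_interior hint (-M.e x)
    obtain ⟨S, hS, hxS, hoS, hseg⟩ := M.exists_segment (x := x) (y := o)
      (fun h => ho' (eq_neg_of_add_eq_zero_right h))
    have hxo : 0 < dist x o := by
      rw [dist_pos]
      rintro rfl
      exact hx.2 ho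
    obtain ⟨w, hw, hwd⟩ : ∃ w ∈ S, dist x w = min (lam / 2) (dist x o) :=
      hS.intermediate_value hxS hoS (f := fun w => dist x w) (by fun_prop)
        ⟨by simp only [dist_self]; positivity, min_le_right _ _⟩
    have hwx : 0 < dist x w := by rw [hwd]; positivity
    obtain ⟨α, β, hα, hβ, hwe⟩ := hseg w hw
    have hwK : w ∈ interior K := by
      rcases eq_or_lt_of_le hβ with hβ0 | hβ0
      · exfalso
        rw [← hβ0, zero_smul, add_zero] at hwe
        have h1 := M.self w
        rw [hwe] at h1
        simp only [map_smul, LinearMap.smul_apply, smul_eq_mul, M.self] at h1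
        have h2 : α = 1 := by
          have : M.k * (α ^ 2 - 1) = 0 := by linear_combination h1
          have := (mul_eq_zero.1 this).resolve_left M.k_ne
          nlinarith
        rw [h2, one_smul] at hwe
        rw [M.e_injective hwe, dist_self] at hwx
        exact lt_irrefl _ hwx
      · exact M.mem_interior_of_gconvex hK (hfrK hx) ho hα hβ0 hwe
    refine ⟨w, ⟨lt_of_le_of_ne (hKr (interior_subset hwK)) fun h => (hfr h).2 hwK, ?_⟩, hwK⟩
    rw [mem_ball, dist_comm, hwd]
    exact (min_le_left _ _).trans_lt (by linarith)
  have hAsub : A ⊆ interior K := by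
    refine hApre.subset_left_of_subset_union isOpen_interior hcl.isOpen_compl
      (disjoint_compl_right.mono_left interior_subset) (fun u hu => ?_) hAK
    by_cases huK : u ∈ K
    · left
      by_contra h
      exact hAfr u hu ⟨subset_closure huK, h⟩
    · exact Or.inr huK
  intro u hu hxu
  rcases eq_or_lt_of_le (show M.B (M.e u) ν ≤ -M.k * s from hu) with h | h
  · exact hfrK (hfr h)
  · exact interior_subset (hAsub ⟨h, by rwa [mem_ball, dist_comm]⟩)

end QuadricModel

theorem IsInball.pos {S : Set X} {p : X} {r : ℝ} (h : IsInball S p r)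
    (hint : (interior S).Nonempty) : 0 < r := by
  obtain ⟨o, ho⟩ := hint
  obtain ⟨ρ, hρ, hsub⟩ := nhds_basis_closedBall.mem_iff.1 (mem_interior_iff_mem_nhds.1 ho)
  exact hρ.trans_le (h.2.2 o ρ hsub)

theorem exists_closedBall_add_subset [ProperSpace X] {p : X} {r : ℝ} {O : Set X} (hO : IsOpen O)
    (hsub : closedBall p r ⊆ O) : ∃ δ > 0, closedBall p (r + δ) ⊆ O := by
  rcases (closedBall p (r + 1) \ O).eq_empty_or_nonempty with h | h
  · exact ⟨1, one_pos, sdiff_eq_empty.1 h⟩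
  · obtain ⟨u, hu, hmin⟩ := ((isCompact_closedBall p (r + 1)).diff hO).exists_isMinOn h
      (f := fun u => dist u p) (by fun_prop)
    have hr : r < dist u p := by
      by_contra! h'
      exact hu.2 (hsub h')
    refine ⟨min 1 ((dist u p - r) / 2), by have := sub_pos.2 hr; positivity, fun v hv => ?_⟩
    by_contra hvO
    rw [mem_closedBall] at hv
    have h1 : dist u p ≤ dist v p := hmin (show v ∈ closedBall p (r + 1) \ O from
      ⟨hv.trans (by gcongr; exact min_le_left _ _), hvO⟩)
    linarith [min_le_right 1 ((dist u p - r) / 2)]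

theorem mul_add_sqrt_mul_sqrt_gt {s μ b D a A : ℝ} (hs : 0 ≤ s) (hμ : 0 < μ)
    (hb : 0 < b ^ 2 - 1) (h2 : μ ^ 2 * (b ^ 2 - 1) = 1 + s ^ 2)
    (h3 : D = s * b + μ * (b ^ 2 - 1)) (hD : 0 ≤ D) (ha : s < a) (hA : D ≤ A) :
    -b < a * A + √(1 + a ^ 2) * √(1 + A ^ 2) := by
  set S := √(b ^ 2 - 1) with hS
  have hSS : S ^ 2 = b ^ 2 - 1 := Real.sq_sqrt hb.le
  have hS0 : 0 < S := Real.sqrt_pos.2 hb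
  rw [← hSS] at h2 h3
  have h4 : μ * S < √(1 + a ^ 2) := by
    apply Real.lt_sqrt_of_sq_lt
    nlinarith
  have h5 : -(μ * S * b) - s * S ≤ √(1 + D ^ 2) := by
    apply Real.le_sqrt_of_sq_le
    apply le_of_eq
    rw [h3]
    linear_combination h2 + (s ^ 2 - μ ^ 2 * S ^ 2) * hSS
  have h6 : √(1 + D ^ 2) ≤ √(1 + A ^ 2) := by gcongr
  have h7 : 0 < √(1 + D ^ 2) := by positivity
  have h8 : μ * S * √(1 + D ^ 2) < √(1 + a ^ 2) * √(1 + A ^ 2) :=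
    mul_lt_mul h4 h6 h7 (Real.sqrt_nonneg _)
  have h9 : μ * S * (-(μ * S * b) - s * S) ≤ μ * S * √(1 + D ^ 2) := by gcongr
  have h10 : s * D ≤ a * A := mul_le_mul ha.le hA hD (hs.trans ha.le)
  have h11 : μ * S * (-(μ * S * b) - s * S) + s * D = -b := by
    rw [h3]; linear_combination (-b) * h2
  linarith

namespace QuadricModel

variable {V : Type*} [NormedAddCommGroup V] [NormedSpace ℝ V] (M : QuadricModel X V)

theorem add_eq_smul_of_isMidpoint (hk : M.k = -1) {p x y : X} (hm : IsMidpoint p x y) :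
    M.e x + M.e y = (-2 * M.B (M.e x) (M.e p)) • M.e p := by
  have h1 := M.cosh hk x p
  have h2 := M.cosh hk p y
  have h3 := M.cosh hk x y
  rw [← hm.1, ← hm.2, ← two_mul, Real.cosh_two_mul, Real.sinh_sq, h1] at h3
  rw [← hm.2, h1, M.symm] at h2
  rw [M.symm (M.e p) (M.e y), M.symm (M.e p) (M.e x)] at h2
  set b := M.B (M.e x) (M.e p) with hb
  have h4 : M.e x + M.e y - (-2 * b) • M.e p = 0 := by
    by_contra h0
    refine (M.pos p _ ?_ h0).ne' ?_
    · simp only [map_sub, map_add, map_smul, smul_eq_mul, M.self, hk, M.symm (M.e p) (M.e x),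
        M.symm (M.e p) (M.e y), ← hb]
      linear_combination h2
    · simp only [map_sub, map_add, map_smul, smul_eq_mul, M.self, hk, M.symm (M.e p) (M.e x),
        M.symm (M.e p) (M.e y), ← hb, LinearMap.sub_apply, LinearMap.add_apply,
        LinearMap.smul_apply, M.symm (M.e y) (M.e x)]
      linear_combination 2 * h3 + 4 * b * h2
  exact sub_eq_zero.1 h4

theorem dist_eq_of_B (hk : M.k = -1) {p q : X} {t : ℝ} (ht : 0 ≤ t)
    (h : M.B (M.e p) (M.e q) = -Real.cosh t) : dist p q = t := by
  have h1 := M.cosh hk p q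
  rw [h, neg_neg] at h1
  exact Real.cosh_injOn dist_nonneg ht h1

/-- The hyperspheres through two antipodal points of a sphere inside both of the caps they bound
satisfy `ν + ν' = 2 D p`. -/
theorem exists_add_eq_smul (hk : M.k = -1) {ν ν' : V} {s : ℝ} {p x y : X}
    (hsub : closedBall p (dist x p) ⊆ M.region ν s)
    (hsub' : closedBall p (dist x p) ⊆ M.region ν' s)
    (hν : M.B ν ν = 1) (hν' : M.B ν' ν' = 1) (hx : M.B (M.e x) ν = s) (hy : M.B (M.e y) ν' = s)
    (hxp : x ≠ p) (hm : IsMidpoint p x y) :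
    ∃ D μ : ℝ, 0 < μ ∧ ν = (-s - μ * M.B (M.e x) (M.e p)) • M.e x - μ • M.e p ∧
      μ ^ 2 * (M.B (M.e x) (M.e p) ^ 2 - 1) = 1 + s ^ 2 ∧
      D = s * M.B (M.e x) (M.e p) + μ * (M.B (M.e x) (M.e p) ^ 2 - 1) ∧
      ν + ν' = (2 * D) • M.e p := by
  have hyx : dist y p = dist x p := by rw [dist_comm y, hm.2]
  have hyp : y ≠ p := by
    rintro rfl
    rw [dist_self] at hyx
    exact hxp (dist_eq_zero.1 hyx.symm)
  have h0 : ∀ a b : X, M.e a + M.e b ≠ 0 := by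
    intro a b h
    have h1 : M.B (M.e a + M.e b) (M.e a) = 0 := by rw [h]; simp
    rw [map_add, LinearMap.add_apply] at h1
    linarith [M.neg hk a a, M.neg hk b a]
  obtain ⟨μ, hμ, h1, h2⟩ := M.eq_of_closedBall_subset_region hsub hx hxp (h0 x p)
  obtain ⟨μ', hμ', h1', h2'⟩ := M.eq_of_closedBall_subset_region (by rwa [hyx]) hy hyp (h0 y p)
  have hadd := M.add_eq_smul_of_isMidpoint hk hm
  have hb : M.B (M.e y) (M.e p) = M.B (M.e x) (M.e p) := by
    have h := congrArg (fun w => M.B w (M.e p)) hadd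
    simp only [map_add, map_smul, LinearMap.add_apply, LinearMap.smul_apply, smul_eq_mul, M.self,
      hk] at h
    linarith
  rw [hb] at h1' h2'
  set b := M.B (M.e x) (M.e p) with hbdef
  rw [hk, hν] at h2
  rw [hk, hν'] at h2'
  have hb1 : 0 < b ^ 2 - 1 := by
    have h3 := M.B_lt x p hxp
    rw [hk, ← hbdef] at h3
    nlinarith [M.neg hk x p]
  have hμμ : μ' = μ := by
    have h3 : (μ' - μ) * (μ' + μ) * (b ^ 2 - 1) = 0 := by linear_combination h2' - h2
    have h4 := (mul_eq_zero.1 h3).resolve_right hb1.ne'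
    nlinarith
  have hμ0 : 0 < μ := by
    refine lt_of_le_of_ne hμ ?_
    rintro rfl
    nlinarith
  refine ⟨_, μ, hμ0, ?_, by linear_combination h2, rfl, ?_⟩
  · rw [h1, hk]
    module
  · have h3 : ν + ν' = (-s - μ * b) • (M.e x + M.e y) - (2 * μ) • M.e p := by
      rw [h1, h1', hk, hμμ]
      module
    rw [h3, hadd]
    module

theorem exists_inball_of_nonneg [FiniteDimensional ℝ V] (hk : M.k = -1) {ν ν' : V} {s : ℝ}
    (hs : 0 < s) {p x y : X}
    (hsub : closedBall p (dist x p) ⊆ M.region ν s)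
    (hsub' : closedBall p (dist x p) ⊆ M.region ν' s)
    (hν : M.B ν ν = 1) (hν' : M.B ν' ν' = 1) (hx : M.B (M.e x) ν = s) (hy : M.B (M.e y) ν' = s)
    (hxp : x ≠ p) (hm : IsMidpoint p x y) {D : ℝ} (hD : 0 ≤ D)
    (hadd : ν + ν' = (2 * D) • M.e p) {δ : ℝ} (hδ : 0 ≤ δ) :
    ∃ q, dist p q = δ ∧ closedBall q (dist x p) ⊆ M.region ν s ∩ M.region ν' s := by
  obtain ⟨D', μ, hμ, h1, h2, h3, h4⟩ := M.exists_add_eq_smul hk hsub hsub' hν hν' hx hy hxp hm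
  have hpp : M.B (M.e p) (M.e p) = -1 := by rw [M.self, hk]
  have hDD : D' = D := by
    have h5 := congrArg (fun w => M.B w (M.e p)) (h4.symm.trans hadd)
    simp only [map_smul, LinearMap.smul_apply, smul_eq_mul, hpp] at h5
    linarith
  subst hDD
  obtain ⟨τ, hτ, hpτ, hxτ⟩ := M.exists_unit_orthogonal p (M.e x)
  set b := M.B (M.e x) (M.e p) with hb
  have hτν : M.B τ ν = 0 := by
    rw [h1, map_sub, map_smul, map_smul, M.symm τ, M.symm τ, hxτ, hpτ]; simp
  have hτν' : M.B τ ν' = 0 := by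
    have h5 := congrArg (M.B τ) hadd
    rw [map_add, hτν, map_smul, M.symm τ (M.e p), hpτ] at h5
    simpa using h5
  have hpν : M.B (M.e p) ν = -D' := by
    rw [h1, map_sub, map_smul, map_smul, M.symm _ (M.e x), ← hb, hpp, h3, smul_eq_mul, smul_eq_mul]
    ring
  have hpν' : M.B (M.e p) ν' = -D' := by
    have h5 := congrArg (M.B (M.e p)) hadd
    rw [map_add, hpν, map_smul, hpp, smul_eq_mul] at h5
    linarith
  have hcs := Real.cosh_sq δ
  obtain ⟨q, hq⟩ := M.mem (Real.cosh δ • M.e p + Real.sinh δ • τ) p (by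
    simp only [map_add, map_smul, LinearMap.add_apply, LinearMap.smul_apply, smul_eq_mul, hpp, hτ,
      hpτ, M.symm τ (M.e p), hk]
    linear_combination -hcs) (by
    intro _
    simp only [map_add, map_smul, LinearMap.add_apply, LinearMap.smul_apply, smul_eq_mul, hpp,
      M.symm τ (M.e p), hpτ]
    linarith [Real.cosh_pos δ])
  have hpq : dist p q = δ := M.dist_eq_of_B hk hδ (by
    rw [hq, map_add, map_smul, map_smul, hpp, hpτ]; simp)
  have key : ∀ n : V, M.B n n = 1 → M.B (M.e p) n = -D' → M.B τ n = 0 →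
      closedBall q (dist x p) ⊆ M.region n s := by
    intro n hn hpn hτn u hu
    by_contra hus
    have hus : s < M.B (M.e u) n := not_le.1 hus
    have h5 : b ≤ M.B (M.e u) (M.e q) := (M.dist_le u q x p).1 hu
    have h6 := M.B_le_of_unit hn u q
    have hqn : M.B (M.e q) n = -(Real.cosh δ * D') := by
      rw [hq, map_add, LinearMap.add_apply, map_smul, map_smul, LinearMap.smul_apply,
        LinearMap.smul_apply, hpn, hτn]
      simp
    rw [hqn, hk] at h6
    set a := M.B (M.e u) n with ha
    have hb1 : 0 < b ^ 2 - 1 := by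
      have h7 := M.B_lt x p hxp
      rw [hk, ← hb] at h7
      nlinarith [M.neg hk x p]
    have h7 := mul_add_sqrt_mul_sqrt_gt hs.le hμ hb1 h2 h3 hD hus
      (le_mul_of_one_le_left hD (Real.one_le_cosh δ))
    have e1 : 1 - -1 * a ^ 2 = 1 + a ^ 2 := by ring
    have e2 : 1 - -1 * (-(Real.cosh δ * D')) ^ 2 = 1 + (Real.cosh δ * D') ^ 2 := by ring
    rw [e1, e2] at h6
    linarith
  exact ⟨q, hpq, fun u hu => ⟨key ν hν hpν hτν hu, key ν' hν' hpν' hτν' hu⟩⟩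

theorem symmetricWrtPerpBisector_region [FiniteDimensional ℝ V] {ν ν' : V} {c c' : ℝ} {p x y : X} (hc : c = c')
    (hsub : closedBall p (dist x p) ⊆ M.region ν c ∩ M.region ν' c')
    (hx : M.B (M.e x) ν = c) (hy : M.B (M.e y) ν' = c') (hνν : M.B ν ν = M.B ν' ν') (hne : x ≠ p)
    (hm : IsMidpoint p x y) :
    SymmetricWrtPerpBisector (M.region ν c ∩ M.region ν' c') x y := by
  subst hc
  obtain ⟨σ, hσ, hxy, -, hB⟩ := M.exists_reflection_region (hsub.trans inter_subset_left)
    (hsub.trans inter_subset_right) hx hy hνν hne hm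
  refine ⟨σ, hσ, hxy, image_eq_of_involutive hσ fun u hu => ⟨?_, ?_⟩⟩
  · exact (hB u).1.trans_le hu.2
  · exact (hB u).2.trans_le hu.1

theorem isBounded_of_B_le (hk : M.k = -1) {S : Set X} {p : X} {C : ℝ}
    (h : ∀ u ∈ S, -M.B (M.e u) (M.e p) ≤ C) : Bornology.IsBounded S := by
  refine (isBounded_closedBall (x := p) (r := C)).subset fun u hu => ?_
  have h1 := M.cosh hk u p
  have h2 := Real.self_le_sinh_iff.2 (dist_nonneg (x := u) (y := p))
  have h3 := Real.sinh_lt_cosh (dist u p)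
  rw [mem_closedBall]
  linarith [h u hu]

/-- Small intersections of two convex bodies that near `x` and `y` are caps bounded by congruent
hyperspheres. -/
theorem symmetricWrtPerpBisector_of_local_region [FiniteDimensional ℝ V] {K L : Set X} {ν ν' : V}
    {s lam : ℝ} {p x y : X} {r : ℝ} (hs : 0 < s) (hν : M.B ν ν = 1) (hν' : M.B ν' ν' = 1)
    (hx : M.B (M.e x) ν = -M.k * s) (hy : M.B (M.e y) ν' = -M.k * s)
    (hKcl : IsClosed K) (hLcl : IsClosed L)
    (hK : K ⊆ M.region ν (-M.k * s)) (hL : L ⊆ M.region ν' (-M.k * s))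
    (hK' : ∀ u ∈ M.region ν (-M.k * s), dist x u < lam → u ∈ K)
    (hL' : ∀ u ∈ M.region ν' (-M.k * s), dist y u < lam → u ∈ L)
    (hlam : 0 < lam) (hr : 0 < r) (hball : HasUniqueInball (K ∩ L) p r)
    (hfr : frontier (K ∩ L) ∩ sphere p r = {x, y}) (hxL : x ∈ interior L) (hyK : y ∈ interior K)
    (hm : IsMidpoint p x y) (hdiam : diam (K ∩ L) < lam) :
    SymmetricWrtPerpBisector (K ∩ L) x y := by
  have hxf : x ∈ frontier (K ∩ L) ∩ sphere p r := by rw [hfr]; simp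
  have hyf : y ∈ frontier (K ∩ L) ∩ sphere p r := by rw [hfr]; simp
  have hcl : IsClosed (K ∩ L) := hKcl.inter hLcl
  have hxM := hcl.frontier_subset hxf.1
  have hyM := hcl.frontier_subset hyf.1
  have hxp : dist x p = r := hxf.2
  have hne : x ≠ p := by
    rintro rfl
    rw [dist_self] at hxp
    exact hr.ne hxp
  have hsub := hball.1.2.1
  have hsubK : closedBall p (dist x p) ⊆ M.region ν (-M.k * s) := by
    rw [hxp]; exact (hsub.trans inter_subset_left).trans hK
  have hsubL : closedBall p (dist x p) ⊆ M.region ν' (-M.k * s) := by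
    rw [hxp]; exact (hsub.trans inter_subset_right).trans hL
  have hbdd : Bornology.IsBounded (K ∩ L) := by
    rcases M.hk with hk | hk
    · refine (isBounded_closedBall (x := p) (r := Real.pi)).subset fun u _ => ?_
      rw [mem_closedBall, M.arccos hk]
      exact Real.arccos_le_pi _
    · have hc : -M.k * s = s := by rw [hk]; ring
      rw [hc] at hx hy hK hL hK' hL' hsubK hsubL
      obtain ⟨D, -, -, -, -, -, hadd⟩ :=
        M.exists_add_eq_smul hk hsubK hsubL hν hν' hx hy hne hm
      rcases lt_or_ge D 0 with hD | hD
      · refine M.isBounded_of_B_le hk (p := p) (C := s / -D) fun u hu => ?_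
        rw [le_div_iff₀ (neg_pos.2 hD)]
        have h1 := congrArg (M.B (M.e u)) hadd
        rw [map_add, map_smul, smul_eq_mul] at h1
        have h2 : M.B (M.e u) ν ≤ s := hK hu.1
        have h3 : M.B (M.e u) ν' ≤ s := hL hu.2
        linarith
      · exfalso
        have := M.proper
        have hO : IsOpen (interior (K ∩ L) ∪ (ball x lam ∩ interior L ∪ ball y lam ∩ interior K)) :=
          isOpen_interior.union ((isOpen_ball.inter isOpen_interior).union
            (isOpen_ball.inter isOpen_interior))
        obtain ⟨δ, hδ, hδO⟩ := exists_closedBall_add_subset hO (p := p) (r := r) (by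
          intro u hu
          by_cases hui : u ∈ interior (K ∩ L)
          · exact Or.inl hui
          · right
            have huf : u ∈ frontier (K ∩ L) := ⟨subset_closure (hsub hu), hui⟩
            have hus : u ∈ frontier (K ∩ L) ∩ sphere p r := by
              refine ⟨huf, le_antisymm hu ?_⟩
              by_contra! h
              exact hui (interior_mono hsub (ball_subset_interior_closedBall h))
            rw [hfr] at hus
            rcases hus with rfl | rfl
            · exact Or.inl ⟨mem_ball_self hlam, hxL⟩
            · exact Or.inr ⟨mem_ball_self hlam, hyK⟩)
        obtain ⟨q, hpq, hq⟩ := M.exists_inball_of_nonneg hk hs hsubK hsubL hν hν' hx hy hne hm hD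
          hadd hδ.le
        rw [hxp] at hq
        have hqM : closedBall q r ⊆ K ∩ L := by
          intro u hu
          have hup : u ∈ closedBall p (r + δ) := by
            rw [mem_closedBall] at hu ⊢
            linarith [dist_triangle u q p, dist_comm p q]
          rcases hδO hup with h | h | h
          · exact interior_subset h
          · exact ⟨hK' u (hq hu).1 (mem_ball'.1 h.1), interior_subset h.2⟩
          · exact ⟨interior_subset h.2, hL' u (hq hu).2 (mem_ball'.1 h.1)⟩
        have := hball.2 q r ⟨hr.le, hqM, hball.1.2.2⟩
        rw [this, dist_self] at hpq
        exact hδ.ne hpq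
  obtain ⟨σ, hσ, hxy, hyx, hB⟩ := M.exists_reflection_region hsubK hsubL hx hy
    (hν.trans hν'.symm) hne hm
  refine ⟨σ, hσ, hxy, image_eq_of_involutive hσ fun u hu => ⟨hK' _ ?_ ?_, hL' _ ?_ ?_⟩⟩
  · exact (hB u).1.trans_le (hL hu.2)
  · rw [← hyx, σ.dist_eq]
    exact (dist_le_diam_of_mem hbdd hyM hu).trans_lt hdiam
  · exact (hB u).2.trans_le (hK hu.1)
  · rw [← hxy, σ.dist_eq]
    exact (dist_le_diam_of_mem hbdd hxM hu).trans_lt hdiam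

end QuadricModel

/-- The conclusion of the lemma for a single pair of bodies. -/
def SymmetricIfSmall (ε : ℝ) (K L : Set X) : Prop :=
  ∀ x ∈ frontier K, ∀ y ∈ frontier L, (interior (K ∩ L)).Nonempty → diam (K ∩ L) < ε →
    ∀ (p : X) (r : ℝ), HasUniqueInball (K ∩ L) p r → frontier (K ∩ L) ∩ sphere p r = {x, y} →
      x ∈ interior L → y ∈ interior K → IsMidpoint p x y → SymmetricWrtPerpBisector (K ∩ L) x y

section Transport

variable {Y : Type*} [MetricSpace Y]

theorem frontier_image (f : X ≃ᵢ Y) (K : Set X) : frontier (f '' K) = f '' frontier K :=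
  (f.toHomeomorph.image_frontier K).symm

theorem interior_image (f : X ≃ᵢ Y) (K : Set X) : interior (f '' K) = f '' interior K :=
  (f.toHomeomorph.image_interior K).symm

theorem t6Cond3_of_symmetricIfSmall {K L : Set X} {ε : ℝ} (hε : 0 < ε)
    (h : ∀ φ ψ : X ≃ᵢ X, SymmetricIfSmall ε (φ '' K) (ψ '' L)) : T6Cond3 K L := by
  intro x hx y hy
  refine ⟨ε, hε, fun φ ψ _ _ hint hdiam p r hp hfr hxL hyK hm => ?_⟩
  refine h φ ψ (φ x) ?_ (ψ y) ?_ hint hdiam p r hp hfr hxL hyK hm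
  · rw [frontier_image]; exact mem_image_of_mem _ hx
  · rw [frontier_image]; exact mem_image_of_mem _ hy

theorem GConvex.image {K : Set X} (hK : GConvex K) (f : X ≃ᵢ Y) : GConvex (f '' K) := by
  rintro _ ⟨x, hx, rfl⟩ _ ⟨y, hy, rfl⟩ z ⟨hz, hz'⟩
  refine ⟨f.symm z, hK x hx y hy _ ⟨?_, fun w hw hd => ?_⟩, f.apply_symm_apply z⟩
  · have h1 := f.dist_eq x (f.symm z)
    have h2 := f.dist_eq (f.symm z) y
    have h3 := f.dist_eq x y
    rw [f.apply_symm_apply] at h1 h2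
    rw [Btw, ← h1, ← h2, ← h3]
    exact hz
  · have h := hz' (f w) (by rw [Btw, f.dist_eq, f.dist_eq, f.dist_eq]; exact hw) (by
      have h1 := f.dist_eq x (f.symm z)
      rw [f.apply_symm_apply] at h1
      rw [f.dist_eq, hd, h1])
    rw [← h, f.symm_apply_apply]

theorem IsReflection.conj {σ : X ≃ᵢ X} (hσ : IsReflection σ) (f : X ≃ᵢ Y) :
    IsReflection ((f.symm.trans σ).trans f) := by
  obtain ⟨h1, h2, h3⟩ := hσ
  refine ⟨?_, fun h => h2 ?_, fun h => h3 ?_⟩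
  · ext y
    have h4 := DFunLike.congr_fun h1 (f.symm y)
    change σ (σ (f.symm y)) = f.symm y at h4
    change f (σ (f.symm (f (σ (f.symm y))))) = y
    rw [f.symm_apply_apply, h4, f.apply_symm_apply]
  · ext x
    have h4 := DFunLike.congr_fun h (f x)
    change f (σ (f.symm (f x))) = f x at h4
    rw [f.symm_apply_apply] at h4
    exact f.injective h4
  · have h4 := h.image f.symm f.symm.continuous.continuousOn
    convert h4 using 1
    ext x
    simp only [IsometryEquiv.trans_apply, mem_image, mem_ofPred_eq]
    constructor
    · intro hx
      exact ⟨f x, by simpa using hx, by simp⟩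
    · rintro ⟨y, hy, rfl⟩
      intro h5
      rw [h5, f.apply_symm_apply] at hy
      exact hy rfl

theorem image_setOf_fixed (σ : X ≃ᵢ X) (f : X ≃ᵢ Y) :
    f '' {x | σ x = x} = {y | ((f.symm.trans σ).trans f) y = y} := by
  ext y
  simp only [IsometryEquiv.trans_apply, mem_image, mem_ofPred_eq]
  constructor
  · rintro ⟨x, hx, rfl⟩
    rw [f.symm_apply_apply, hx]
  · intro h
    refine ⟨f.symm y, ?_, f.apply_symm_apply y⟩
    rw [← f.symm_apply_apply (σ (f.symm y)), h]

theorem IsHyperplane.image {B : Set X} (hB : IsHyperplane B) (f : X ≃ᵢ Y) :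
    IsHyperplane (f '' B) := by
  obtain ⟨σ, hσ, rfl⟩ := hB
  exact ⟨_, hσ.conj f, image_setOf_fixed σ f⟩

theorem IsHalfspace.image {P : Set X} (hP : IsHalfspace P) (f : X ≃ᵢ Y) :
    IsHalfspace (f '' P) := by
  obtain ⟨σ, hσ, hcl, h1, h2⟩ := hP
  have h3 : ((f.symm.trans σ).trans f) '' (f '' P) = f '' (σ '' P) := by
    simp only [← image_comp]
    congr 1
    ext x
    simp
  refine ⟨_, hσ.conj f, f.toHomeomorph.isClosedMap P hcl, ?_, ?_⟩
  · rw [h3, ← image_union, h1, image_univ, f.surjective.range_eq]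
  · rw [h3, ← image_inter f.injective, h2, image_setOf_fixed]

theorem IsHypersphere.image {C : Set X} {lam : ℝ} (hC : IsHypersphere C lam) (f : X ≃ᵢ Y) :
    IsHypersphere (f '' C) lam := by
  obtain ⟨h1, ⟨P, hP, rfl⟩, h2⟩ := hC
  refine ⟨h1, ⟨f '' P, hP.image f, ?_⟩, fun h => h2 ?_⟩
  · rw [← frontier_image]
    congr 1
    ext y
    simp only [mem_image, mem_ofPred_eq]
    constructor
    · rintro ⟨x, hx, rfl⟩
      rwa [infDist_image f.isometry]
    · intro hy
      refine ⟨f.symm y, ?_, f.apply_symm_apply y⟩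
      rwa [← infDist_image f.isometry, f.apply_symm_apply]
  · have h3 := h.image f.symm
    rwa [← image_comp, f.symm_comp_self, image_id] at h3

theorem IsParaball.image {K : Set X} (hK : IsParaball K) (f : X ≃ᵢ Y) : IsParaball (f '' K) := by
  obtain ⟨γ, hγ, rfl⟩ := hK
  refine ⟨f ∘ γ, f.isometry.comp hγ, ?_⟩
  ext y
  simp only [mem_image, mem_ofPred_eq, Function.comp_apply]
  constructor
  · rintro ⟨x, hx, rfl⟩
    simpa only [f.dist_eq] using hx
  · intro h
    refine ⟨f.symm y, ?_, f.apply_symm_apply y⟩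
    have h1 : ∀ t, dist (f.symm y) (γ t) = dist y (f (γ t)) := fun t => by
      rw [← f.dist_eq, f.apply_symm_apply]
    simpa only [h1] using h

theorem isHypersphere_bdryComponents_image {K : Set X} {lam : ℝ}
    (h : ∀ C ∈ bdryComponents K, IsHypersphere C lam) (f : X ≃ᵢ Y) :
    ∀ C ∈ bdryComponents (f '' K), IsHypersphere C lam := by
  rintro _ ⟨y, hy, rfl⟩
  rw [frontier_image] at hy ⊢
  obtain ⟨x, hx, rfl⟩ := hy
  have h1 := f.toHomeomorph.image_connectedComponentIn hx
  change f '' _ = _ at h1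
  exact h1 ▸ (h _ ⟨x, hx, rfl⟩).image f

theorem SymmetricIfSmall.of_image {K L : Set X} {ε : ℝ} (f : X ≃ᵢ Y)
    (h : SymmetricIfSmall ε (f '' K) (f '' L)) : SymmetricIfSmall ε K L := by
  intro x hx y hy hint hdiam p r hp hfr hxL hyK hm
  have hKL : f '' K ∩ f '' L = f '' (K ∩ L) := (image_inter f.injective).symm
  rw [SymmetricIfSmall, hKL] at h
  have hball : ∀ q s, closedBall (f q) s ⊆ f '' (K ∩ L) ↔ closedBall q s ⊆ K ∩ L := fun q s => by
    rw [← f.image_closedBall, image_subset_image_iff f.injective]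
  have hin : ∀ q s, IsInball (f '' (K ∩ L)) (f q) s ↔ IsInball (K ∩ L) q s := fun q s => by
    refine and_congr_right fun _ => and_congr (hball q s) ⟨fun h q s hs => ?_, fun h q s hs => ?_⟩
    · exact h (f q) s ((hball q s).2 hs)
    · obtain ⟨q, rfl⟩ := f.surjective q
      exact h q s ((hball q s).1 hs)
  obtain ⟨σ, hσ, hxy, hS⟩ := h (f x) (by rw [frontier_image]; exact mem_image_of_mem _ hx) (f y)
    (by rw [frontier_image]; exact mem_image_of_mem _ hy) (by
      rw [interior_image]; exact hint.image _) (by rwa [f.isometry.diam_image]) (f p) r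
    ⟨(hin p r).2 hp.1, fun q s hq => by
      obtain ⟨q, rfl⟩ := f.surjective q
      rw [hp.2 q s ((hin q s).1 hq)]⟩
    (by rw [frontier_image, ← f.image_sphere, ← image_inter f.injective, hfr, image_pair])
    (by rw [interior_image]; exact mem_image_of_mem _ hxL)
    (by rw [interior_image]; exact mem_image_of_mem _ hyK)
    (by simpa only [IsMidpoint, Btw, f.dist_eq] using hm)
  refine ⟨_, hσ.conj f.symm, ?_, ?_⟩
  · simp [hxy]
  · have h1 : ((f.symm.symm.trans σ).trans f.symm) '' (K ∩ L) =
        f.symm '' (σ '' (f '' (K ∩ L))) := by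
      simp only [← image_comp]
      congr 1
    rw [h1, hS, ← image_comp, f.symm_comp_self, image_id]

end Transport

namespace QuadricModel

open Topology

variable {V : Type*} [NormedAddCommGroup V] [NormedSpace ℝ V] (M : QuadricModel X V)

theorem symmetricIfSmall_region [FiniteDimensional ℝ V] (ε : ℝ) {ν ν' : V} {c c' : ℝ}
    (h : ∀ x ∈ frontier (M.region ν c), ∀ y ∈ frontier (M.region ν' c'), c = c')
    (hνν : M.B ν ν = M.B ν' ν') :
    SymmetricIfSmall ε (M.region ν c) (M.region ν' c') := by
  intro x hx y hy hint _ p r hp hfr _ _ hm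
  have hxp : dist x p = r := (show x ∈ frontier _ ∩ sphere p r by rw [hfr]; simp).2
  refine M.symmetricWrtPerpBisector_region (h x hx y hy) (hxp ▸ hp.1.2.1)
    (M.eq_of_mem_frontier_region hx) (M.eq_of_mem_frontier_region hy) hνν ?_ hm
  rintro rfl
  exact (hp.1.pos hint).ne' (by rw [← hxp, dist_self])

theorem closedBall_eq_region {q z : X} {R : ℝ} (hz : dist z q = R) :
    closedBall q R = M.region (-M.e q) (-M.B (M.e z) (M.e q)) := by
  ext u
  rw [mem_closedBall, ← hz, M.dist_le]
  change _ ↔ M.B (M.e u) (-M.e q) ≤ _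
  rw [map_neg, neg_le_neg_iff]

theorem symmetricIfSmall_closedBall (M : QuadricModel X V) [FiniteDimensional ℝ V] (ε : ℝ) (q q' : X) (R : ℝ) :
    SymmetricIfSmall ε (closedBall q R) (closedBall q' R) := by
  intro x hx y hy
  have h1 := frontier_closedBall_subset_sphere hx
  have h2 := frontier_closedBall_subset_sphere hy
  rw [M.closedBall_eq_region h1] at hx ⊢
  rw [M.closedBall_eq_region h2] at hy ⊢
  refine M.symmetricIfSmall_region ε (fun _ _ _ _ => ?_) ?_ x hx y hy
  · rw [(M.dist_eq x q y q').1 (h1.trans h2.symm)]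
  · simp [M.self]

theorem exists_geodesic_eq (hk : M.k = -1) {γ : ℝ → X} (hγ : Isometry γ) :
    ∃ b, M.B b b = 1 ∧ M.B (M.e (γ 0)) b = 0 ∧
      ∀ t, M.e (γ t) = Real.cosh t • M.e (γ 0) + Real.sinh t • b := by
  have hB : ∀ t u, M.B (M.e (γ t)) (M.e (γ u)) = -Real.cosh (t - u) := fun t u => by
    rw [← neg_neg (M.B _ _), ← M.cosh hk, hγ.dist_eq, Real.dist_eq, Real.cosh_abs]
  have hs : Real.sinh 1 ≠ 0 := (Real.sinh_pos_iff.2 one_pos).ne'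
  have hcs := Real.cosh_sq 1
  set b := (Real.sinh 1)⁻¹ • (M.e (γ 1) - Real.cosh 1 • M.e (γ 0)) with hb
  have hγb : ∀ t, M.B (M.e (γ t)) b = Real.sinh t := fun t => by
    rw [hb, map_smul, map_sub, map_smul, hB, hB, sub_zero, Real.cosh_sub, smul_eq_mul, smul_eq_mul]
    field_simp
    ring
  have hbb : M.B b b = 1 := by
    nth_rewrite 1 [hb]
    rw [map_smul M.B, map_sub M.B, map_smul M.B, LinearMap.smul_apply, LinearMap.sub_apply,
      LinearMap.smul_apply, hγb, hγb, Real.sinh_zero, smul_zero, sub_zero, smul_eq_mul,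
      inv_mul_cancel₀ hs]
  have h0b : M.B (M.e (γ 0)) b = 0 := by rw [hγb, Real.sinh_zero]
  have h00 : M.B (M.e (γ 0)) (M.e (γ 0)) = -1 := by rw [M.self, hk]
  refine ⟨b, hbb, h0b, fun t => ?_⟩
  have htt : M.B (M.e (γ t)) (M.e (γ t)) = -1 := by rw [M.self, hk]
  have h0t : M.B (M.e (γ 0)) (M.e (γ t)) = -Real.cosh t := by rw [M.symm, hB, sub_zero]
  have hct := Real.cosh_sq t
  refine sub_eq_zero.1 ?_
  by_contra hw
  refine (M.pos (γ 0) _ ?_ hw).ne' ?_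
  · rw [map_sub, map_add, map_smul, map_smul, h0t, h00, h0b]
    simp
  · simp only [map_sub, map_add, map_smul, LinearMap.sub_apply, LinearMap.add_apply,
      LinearMap.smul_apply, smul_eq_mul, htt, h0t, h00, h0b, hbb, hγb, M.symm (M.e (γ t)) (M.e (γ 0)),
      M.symm b]
    linear_combination hct

theorem tendsto_dist_sub (hk : M.k = -1) {γ : ℝ → X} (hγ : Isometry γ) {b : V}
    (hb : ∀ t, M.e (γ t) = Real.cosh t • M.e (γ 0) + Real.sinh t • b) (u : X) :
    0 < -M.B (M.e u) (M.e (γ 0) + b) ∧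
    Tendsto (fun t => dist u (γ t) - t) atTop (𝓝 (Real.log (-M.B (M.e u) (M.e (γ 0) + b)))) := by
  set α := -M.B (M.e u) (M.e (γ 0)) with hα
  set β := -M.B (M.e u) b with hβ
  have hαβ : -M.B (M.e u) (M.e (γ 0) + b) = α + β := by rw [map_add, hα, hβ]; ring
  rw [hαβ]
  have hcosh : ∀ t, Real.cosh (dist u (γ t)) = α * Real.cosh t + β * Real.sinh t := fun t => by
    rw [M.cosh hk, hb t, map_add, map_smul, map_smul, smul_eq_mul, smul_eq_mul, hα, hβ]
    ring
  have hexp : ∀ t, Real.exp (dist u (γ t) - t) =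
      (α + β) + (α - β) * Real.exp (-t) ^ 2 - Real.exp (-dist u (γ t)) * Real.exp (-t) := fun t => by
    have h := hcosh t
    rw [Real.cosh_eq, Real.cosh_eq, Real.sinh_eq] at h
    have h1 : Real.exp t * Real.exp (-t) = 1 := by rw [← Real.exp_add]; simp
    rw [sub_eq_add_neg, Real.exp_add]
    linear_combination 2 * Real.exp (-t) * h + (α + β) * h1
  have h0 : Tendsto (fun t : ℝ => Real.exp (-t)) atTop (𝓝 0) :=
    Real.tendsto_exp_neg_atTop_nhds_zero
  have h1 : Tendsto (fun t => Real.exp (-dist u (γ t)) * Real.exp (-t)) atTop (𝓝 0) := by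
    refine squeeze_zero (fun t => by positivity) (fun t => ?_) h0
    refine mul_le_of_le_one_left (Real.exp_pos _).le ?_
    rw [Real.exp_le_one_iff]
    linarith [dist_nonneg (x := u) (y := γ t)]
  have h2 : Tendsto (fun t => Real.exp (dist u (γ t) - t)) atTop (𝓝 (α + β)) := by
    have h3 := ((tendsto_const_nhds (x := α + β)).add ((h0.pow 2).const_mul (α - β))).sub h1
    simp only [ne_eq, OfNat.ofNat_ne_zero, not_false_eq_true, zero_pow, mul_zero, add_zero,
      sub_zero] at h3
    exact h3.congr fun t => (hexp t).symm
  have h4 : Real.exp (-dist u (γ 0)) ≤ α + β := by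
    refine ge_of_tendsto h2 ?_
    filter_upwards [eventually_ge_atTop 0] with t ht
    rw [Real.exp_le_exp]
    have h5 := dist_triangle (γ 0) u (γ t)
    rw [hγ.dist_eq, Real.dist_eq, zero_sub, abs_neg, abs_of_nonneg ht, dist_comm (γ 0) u] at h5
    linarith
  have h5 : 0 < α + β := (Real.exp_pos _).trans_le h4
  refine ⟨h5, ?_⟩
  have h6 := h2.log h5.ne'
  simpa only [Real.log_exp] using h6

theorem exists_eq_region_of_isParaball {K : Set X} (hK : IsParaball K) :
    ∃ ν, M.B ν ν = 0 ∧ K = M.region ν 1 := by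
  obtain ⟨γ, hγ, rfl⟩ := hK
  rcases M.hk with hk | hk
  · exfalso
    have h1 := hγ.dist_eq 0 4
    rw [M.arccos hk] at h1
    have h2 := Real.arccos_le_pi (M.B (M.e (γ 0)) (M.e (γ 4)))
    rw [h1, Real.dist_eq] at h2
    norm_num at h2
    linarith [Real.pi_lt_four]
  · obtain ⟨b, hbb, h0b, hb⟩ := M.exists_geodesic_eq hk hγ
    refine ⟨-(M.e (γ 0) + b), ?_, ?_⟩
    · simp only [map_neg, LinearMap.neg_apply, map_add, LinearMap.add_apply, M.self, hk, hbb, h0b,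
        M.symm b]
      norm_num
    · ext u
      obtain ⟨h1, h2⟩ := M.tendsto_dist_sub hk hγ hb u
      change (∃ c ≤ 0, _) ↔ M.B (M.e u) (-(M.e (γ 0) + b)) ≤ 1
      rw [map_neg (M.B (M.e u)), ← Real.log_nonpos_iff h1.le]
      constructor
      · rintro ⟨c, hc, hc'⟩
        rwa [tendsto_nhds_unique h2 hc']
      · exact fun h => ⟨_, h, h2⟩

theorem symmetricIfSmall_paraball (M : QuadricModel X V) [FiniteDimensional ℝ V] (ε : ℝ) {K L : Set X}
    (hK : IsParaball K) (hL : IsParaball L) : SymmetricIfSmall ε K L := by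
  obtain ⟨ν, hν, rfl⟩ := M.exists_eq_region_of_isParaball hK
  obtain ⟨ν', hν', rfl⟩ := M.exists_eq_region_of_isParaball hL
  exact M.symmetricIfSmall_region ε (fun _ _ _ _ => rfl) (hν.trans hν'.symm)

theorem exists_hypersphere_bdryComponents [FiniteDimensional ℝ V] {K : Set X} {lam C s : ℝ}
    (hr : M.IsRadius lam C s) (h : ∀ C ∈ bdryComponents K, IsHypersphere C lam) {z : X}
    (hz : z ∈ frontier K) :
    ∃ ν, M.B ν ν = 1 ∧ M.B (M.e z) ν = -M.k * s ∧
      {u : X | M.B (M.e u) ν = -M.k * s} ⊆ frontier K := by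
  have hzC := mem_connectedComponentIn hz
  obtain ⟨n, hn, hC, -⟩ := (M.isRadius_of_isHypersphere (h _ ⟨z, hz, rfl⟩) ⟨z, hzC⟩).2 C s hr
  have hB : ∀ u, M.B (M.e u) ((-M.k) • n) = -M.k * s ↔ M.B (M.e u) n = s := fun u => by
    rw [map_smul, smul_eq_mul]
    exact mul_right_inj' (neg_ne_zero.2 M.k_ne)
  refine ⟨(-M.k) • n, ?_, ?_, fun u hu => ?_⟩
  · rw [map_smul M.B, LinearMap.smul_apply, map_smul, hn, smul_eq_mul, smul_eq_mul]
    linear_combination M.k_sq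
  · rw [hC] at hzC
    exact (hB z).2 hzC
  · apply connectedComponentIn_subset (frontier K) z
    rw [hC]
    exact (hB u).1 hu

theorem symmetricIfSmall_hypersphere (M : QuadricModel X V) [FiniteDimensional ℝ V] {K L : Set X} {lam : ℝ}
    (hlam : 0 < lam) (hKcl : IsClosed K) (hLcl : IsClosed L) (hK : GConvex K) (hL : GConvex L)
    (hKC : ∀ C ∈ bdryComponents K, IsHypersphere C lam)
    (hLC : ∀ C ∈ bdryComponents L, IsHypersphere C lam) : SymmetricIfSmall lam K L := by
  intro x hx y hy hint hdiam p r hp hfr hxL hyK hm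
  obtain ⟨C, s, hr⟩ := (M.isRadius_of_isHypersphere (hKC _ ⟨x, hx, rfl⟩)
    ⟨x, mem_connectedComponentIn hx⟩).1
  obtain ⟨ν, hν, hxν, hKν, hKν'⟩ := M.exists_local_region hKcl hK
    (hint.mono (interior_mono inter_subset_left)) hr
    (fun z hz => M.exists_hypersphere_bdryComponents hr hKC hz) hx
  obtain ⟨ν', hν', hyν', hLν, hLν'⟩ := M.exists_local_region hLcl hL
    (hint.mono (interior_mono inter_subset_right)) hr
    (fun z hz => M.exists_hypersphere_bdryComponents hr hLC hz) hy
  exact M.symmetricWrtPerpBisector_of_local_region hr.s_pos hν hν' hxν hyν' hKcl hLcl hKν hLν hKν'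
    hLν' hlam (hp.1.pos hint) hp hfr hxL hyK hm hdiam

end QuadricModel

namespace Euclid

open Topology InnerProductSpace

variable {E : Type*} [NormedAddCommGroup E] [InnerProductSpace ℝ E]

theorem wbtw_of_btw {x z y : E} (h : Btw x z y) : Wbtw ℝ x z y :=
  dist_add_dist_eq_iff.1 h

theorem exists_reflection (p : E) {u : E} (hu : u ≠ 0) :
    ∃ σ : E ≃ᵢ E, IsReflection σ ∧ (∀ t : ℝ, σ (p + t • u) = p - t • u) ∧
      ∀ z, σ z = z ↔ ⟪u, z - p⟫_ℝ = 0 := by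
  set ρ := (ℝ ∙ u)ᗮ.reflection
  set σ : E ≃ᵢ E := (IsometryEquiv.subRight p).trans
    (ρ.toIsometryEquiv.trans (IsometryEquiv.addRight p)) with hσ
  have hσz : ∀ z, σ z = ρ (z - p) + p := fun z => rfl
  have hρu : ρ u = -u := Submodule.reflection_orthogonalComplement_singleton_eq_neg u
  have hfix : ∀ z, σ z = z ↔ ⟪u, z - p⟫_ℝ = 0 := fun z => by
    rw [hσz, ← eq_sub_iff_add_eq, Submodule.reflection_eq_self_iff,
      Submodule.mem_orthogonal_singleton_iff_inner_right]
  have hσu : ∀ t : ℝ, σ (p + t • u) = p - t • u := fun t => by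
    rw [hσz, add_sub_cancel_left, map_smul, hρu, smul_neg]
    abel
  have huu : 0 < ⟪u, u⟫_ℝ := real_inner_self_pos.2 hu
  have hup : ∀ t : ℝ, σ (p + t • u) = p + t • u ↔ t * ⟪u, u⟫_ℝ = 0 := fun t => by
    rw [hfix, add_sub_cancel_left, inner_smul_right]
  refine ⟨σ, ⟨?_, ?_, ?_⟩, hσu, hfix⟩
  · ext z
    change σ (σ z) = z
    rw [hσz, hσz, add_sub_cancel_right, Submodule.reflection_reflection, sub_add_cancel]
  · intro h
    have h1 := (hup 1).1 (by rw [h]; rfl)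
    rw [one_mul] at h1
    exact huu.ne' h1
  · intro h
    have hc : Continuous fun z : E => ⟪u, z - p⟫_ℝ := by fun_prop
    have h1 := h.intermediate_value (a := p + (-1 : ℝ) • u) (b := p + (1 : ℝ) • u)
      (by change σ _ ≠ _; rw [Ne, hup]; linarith) (by change σ _ ≠ _; rw [Ne, hup]; linarith)
      hc.continuousOn
    obtain ⟨z, hz, hz0⟩ := h1 (show (0 : ℝ) ∈ Icc _ _ by
      simp only [add_sub_cancel_left, inner_smul_right, mem_Icc]
      constructor <;> linarith)
    exact hz ((hfix z).2 hz0)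

theorem exists_center_eq {p q x : E} {r R : ℝ} (hr : 0 < r) (hx : dist x p = r)
    (hxq : dist x q = R) (h : closedBall p r ⊆ closedBall q R) :
    q = p + (1 - R / r) • (x - p) := by
  have hpq : dist p q + r ≤ R := by
    rcases eq_or_ne p q with rfl | hne
    · rw [dist_self, zero_add, ← hx, hxq]
    · have hd : 0 < ‖p - q‖ := norm_pos_iff.2 (sub_ne_zero.2 hne)
      have h1 : p + (r / ‖p - q‖) • (p - q) ∈ closedBall p r := by
        rw [mem_closedBall, dist_eq_norm, add_sub_cancel_left, norm_smul, Real.norm_of_nonneg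
          (by positivity), div_mul_cancel₀ _ hd.ne']
      have h2 := h h1
      rw [mem_closedBall, dist_eq_norm, show p + (r / ‖p - q‖) • (p - q) - q =
        (1 + r / ‖p - q‖) • (p - q) by module, norm_smul, Real.norm_of_nonneg (by positivity),
        add_mul, one_mul, div_mul_cancel₀ _ hd.ne'] at h2
      rwa [dist_eq_norm]
  have hb : Btw x p q := by
    refine le_antisymm ?_ (dist_triangle x p q)
    rw [hx, hxq]; linarith
  obtain ⟨s, hs01, hs⟩ := wbtw_of_btw hb
  have hs' : p - x = s • (q - x) := by
    rw [← hs, AffineMap.lineMap_apply_module']; abel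
  have hR : 0 < R := by linarith [dist_nonneg (x := p) (y := q)]
  have hsR : r / R = s := by
    rw [← hx, ← hxq, dist_comm, dist_comm x, dist_eq_norm, dist_eq_norm, hs', norm_smul,
      Real.norm_of_nonneg hs01.1, mul_div_cancel_right₀]
    rw [← dist_eq_norm, dist_comm, hxq]
    exact hR.ne'
  have : q - x = (R / r) • (p - x) := by
    rw [hs', smul_smul, ← hsR, div_mul_div_cancel₀ hr.ne', div_self hR.ne', one_smul]
  rw [← sub_eq_zero]
  rw [← sub_eq_zero] at this
  rw [← this]
  module

theorem symmetricIfSmall_closedBall (ε : ℝ) (q q' : E) (R : ℝ) :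
    SymmetricIfSmall ε (closedBall q R) (closedBall q' R) := by
  intro x hx y hy hint _ p r hp hfr _ _ hm
  have hr := hp.1.pos hint
  have hxp : dist x p = r := (show x ∈ frontier _ ∩ sphere p r by rw [hfr]; simp).2
  have hyp : dist y p = r := (show y ∈ frontier _ ∩ sphere p r by rw [hfr]; simp).2
  have hq := exists_center_eq hr hxp (frontier_closedBall_subset_sphere hx)
    (hp.1.2.1.trans inter_subset_left)
  have hq' := exists_center_eq hr hyp (frontier_closedBall_subset_sphere hy)
    (hp.1.2.1.trans inter_subset_right)
  have hu : x - p ≠ 0 := by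
    rw [sub_ne_zero]
    rintro rfl
    exact hr.ne (dist_self x ▸ hxp)
  have hpm : p = midpoint ℝ x y := by
    refine eq_midpoint_of_dist_eq_half ?_ ?_
    · linarith [hm.1.symm, hm.2]
    · linarith [hm.1.symm, hm.2]
  have hyu : y - p = -(x - p) := by
    rw [hpm, midpoint_eq_smul_add, invOf_eq_inv]
    module
  obtain ⟨σ, hσ, hσu, -⟩ := exists_reflection p hu
  have hσσ : ∀ u, σ (σ u) = u := fun u => congrArg (fun f : E ≃ᵢ E => f u) hσ.1
  have hσq : σ q = q' := by
    rw [hq, hσu, hq', hyu]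
    module
  refine ⟨σ, hσ, ?_, image_eq_of_involutive hσ fun u hu => ⟨?_, ?_⟩⟩
  · have := hσu 1
    rw [one_smul, add_sub_cancel, sub_eq_add_neg, ← hyu, add_sub_cancel] at this
    exact this
  · have h1 := hu.2
    rw [mem_closedBall, ← hσq, ← σ.dist_eq, hσσ] at h1
    exact h1
  · rw [mem_closedBall, ← hσq, σ.dist_eq]
    exact hu.1

theorem tendsto_norm_sub_smul (u : E) {v : E} (hv : ‖v‖ = 1) :
    Tendsto (fun t : ℝ => ‖u - t • v‖ - t) atTop (𝓝 (-⟪u, v⟫_ℝ)) := by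
  have h1 : Tendsto (fun t : ℝ => t⁻¹) atTop (𝓝 0) := tendsto_inv_atTop_zero
  have h2 : Tendsto (fun t : ℝ => (t⁻¹ * ‖u‖ ^ 2 - 2 * ⟪u, v⟫_ℝ) / (‖t⁻¹ • u - v‖ + 1)) atTop
      (𝓝 ((0 * ‖u‖ ^ 2 - 2 * ⟪u, v⟫_ℝ) / (‖(0 : ℝ) • u - v‖ + 1))) :=
    ((h1.mul_const _).sub_const _).div (((h1.smul_const u).sub_const v).norm.add_const 1)
      (by positivity)
  have h3 : (0 * ‖u‖ ^ 2 - 2 * ⟪u, v⟫_ℝ) / (‖(0 : ℝ) • u - v‖ + 1) = -⟪u, v⟫_ℝ := by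
    rw [zero_smul, zero_sub, norm_neg, hv]; ring
  rw [h3] at h2
  refine h2.congr' ?_
  filter_upwards [eventually_gt_atTop 0] with t ht
  rw [div_eq_iff (by positivity)]
  have h4 : ‖u - t • v‖ ^ 2 = ‖u‖ ^ 2 - 2 * t * ⟪u, v⟫_ℝ + t ^ 2 := by
    rw [norm_sub_sq_real, inner_smul_right, norm_smul, hv, Real.norm_eq_abs, mul_one, sq_abs]
    ring
  have h5 : ‖t⁻¹ • u - v‖ = t⁻¹ * ‖u - t • v‖ := by
    rw [show t⁻¹ • u - v = t⁻¹ • (u - t • v) by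
      rw [smul_sub, smul_smul, inv_mul_cancel₀ ht.ne', one_smul], norm_smul,
      Real.norm_of_nonneg (by positivity)]
  rw [h5]
  field_simp
  linear_combination -h4

theorem exists_eq_of_isParaball {K : Set E} (hK : IsParaball K) :
    ∃ a v : E, K = {z | 0 ≤ ⟪z - a, v⟫_ℝ} := by
  obtain ⟨γ, hγ, rfl⟩ := hK
  set f := hγ.affineIsometryOfStrictConvexSpace
  have hf : ∀ t : ℝ, γ t = γ 0 + t • f.linear 1 := fun t => by
    change f t = f 0 + _
    rw [← map_smul, smul_eq_mul, mul_one]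
    have := f.map_vadd 0 t
    simp only [vadd_eq_add, add_zero] at this
    rw [this, add_comm]
    rfl
  have hv : ‖f.linear 1‖ = 1 := by
    have := hγ.dist_eq 1 0
    rw [hf 1, dist_eq_norm, add_sub_cancel_left, one_smul] at this
    rw [this]; simp
  refine ⟨γ 0, f.linear 1, ?_⟩
  ext z
  have h := tendsto_norm_sub_smul (z - γ 0) hv
  have h' : Tendsto (fun t => dist z (γ t) - t) atTop (𝓝 (-⟪z - γ 0, f.linear 1⟫_ℝ)) :=
    h.congr fun t => by rw [hf t, dist_eq_norm, sub_add_eq_sub_sub]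
  change (∃ b ≤ 0, _) ↔ (0 : ℝ) ≤ _
  rw [← neg_nonpos]
  constructor
  · rintro ⟨b, hb, hb'⟩
    rwa [tendsto_nhds_unique h' hb']
  · exact fun h0 => ⟨_, h0, h'⟩

theorem exists_inner_nonneg (hE : 2 ≤ Module.finrank ℝ E) (v v' : E) :
    ∃ w : E, w ≠ 0 ∧ 0 ≤ ⟪w, v⟫_ℝ ∧ 0 ≤ ⟪w, v'⟫_ℝ := by
  have : FiniteDimensional ℝ E := Module.finite_of_finrank_pos (by omega)
  have h1 : (ℝ ∙ v)ᗮ ≠ ⊥ := fun h => by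
    have h2 := (ℝ ∙ v).finrank_add_finrank_orthogonal
    rw [h, finrank_bot] at h2
    have h3 := finrank_span_le_card (R := ℝ) ({v} : Set E)
    simp at h3
    omega
  obtain ⟨w, hw, hw0⟩ := Submodule.exists_mem_ne_zero_of_ne_bot h1
  rw [Submodule.mem_orthogonal_singleton_iff_inner_left] at hw
  rcases le_total 0 ⟪w, v'⟫_ℝ with h | h
  · exact ⟨w, hw0, hw.ge, h⟩
  · refine ⟨-w, neg_ne_zero.2 hw0, ?_, ?_⟩ <;> rw [inner_neg_left] <;> linarith

theorem symmetricIfSmall_paraball (hE : 2 ≤ Module.finrank ℝ E) (ε : ℝ) {K L : Set E}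
    (hK : IsParaball K) (hL : IsParaball L) : SymmetricIfSmall ε K L := by
  obtain ⟨a, v, rfl⟩ := exists_eq_of_isParaball hK
  obtain ⟨a', v', rfl⟩ := exists_eq_of_isParaball hL
  obtain ⟨w, hw0, hw, hw'⟩ := exists_inner_nonneg hE v v'
  intro x _ y _ _ _ p r hp
  refine absurd (hp.2 (p + w) r ⟨hp.1.1, fun z hz => ?_, hp.1.2.2⟩) (by simpa using hw0)
  have h1 : z - w ∈ closedBall p r := by
    rw [mem_closedBall, dist_eq_norm] at hz ⊢
    rwa [sub_right_comm, sub_sub]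
  obtain ⟨h2, h3⟩ := hp.1.2.1 h1
  have h4 : ∀ b c : E, ⟪z - b, c⟫_ℝ = ⟪z - w - b, c⟫_ℝ + ⟪w, c⟫_ℝ := fun b c => by
    rw [← inner_add_left]; congr 1; abel
  refine ⟨?_, ?_⟩
  · change 0 ≤ ⟪z - a, v⟫_ℝ
    rw [h4]; exact add_nonneg h2 hw
  · change 0 ≤ ⟪z - a', v'⟫_ℝ
    rw [h4]; exact add_nonneg h3 hw'

theorem dist_le_dist_iff (x y z : E) :
    dist z x ≤ dist z y ↔ ⟪y - x, z - midpoint ℝ x y⟫_ℝ ≤ 0 := by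
  rw [dist_eq_norm, dist_eq_norm, ← sq_le_sq₀ (norm_nonneg _) (norm_nonneg _), ← sub_nonpos]
  have h : ‖z - x‖ ^ 2 - ‖z - y‖ ^ 2 = 2 * ⟪y - x, z - midpoint ℝ x y⟫_ℝ := by
    rw [midpoint_eq_smul_add]
    simp only [norm_sub_sq_real, inner_sub_left, inner_sub_right, inner_smul_right, inner_add_right,
      real_inner_self_eq_norm_sq, real_inner_comm x y, real_inner_comm x z, real_inner_comm y z]
    norm_num
    ring
  rw [h]
  constructor <;> intro <;> linarith

theorem exists_eq_of_isHalfspace {P : Set E} (hP : IsHalfspace P) :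
    ∃ n p : E, ‖n‖ = 1 ∧ P = {z | ⟪n, z - p⟫_ℝ ≤ 0} := by
  have hdist : ∀ x y z : E,
      dist z x = dist z y ↔ ⟪y - x, z - midpoint ℝ x y⟫_ℝ = 0 := fun x y z => by
    rw [le_antisymm_iff, dist_le_dist_iff, dist_le_dist_iff, le_antisymm_iff, midpoint_comm,
      ← neg_sub y x, inner_neg_left, neg_nonpos]
  obtain ⟨x, y, hxy, rfl⟩ := hP.exists_eq_side (fun x y u v hxy huv hx hy => by
      set m := midpoint ℝ x y
      have hxm : x - m = (1 / 2 : ℝ) • (x - y) := by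
        simp only [m, midpoint_eq_smul_add, invOf_eq_inv]
        module
      have hn : ⟪v - u, x - y⟫_ℝ = 0 := by
        rw [hdist] at hx hy
        rw [show x - y = (x - midpoint ℝ u v) - (y - midpoint ℝ u v) by abel, inner_sub_right, hx,
          hy, sub_zero]
      have hmn : ⟪v - u, m - midpoint ℝ u v⟫_ℝ = 0 := by
        rw [hdist] at hx
        rw [show m - midpoint ℝ u v = (x - midpoint ℝ u v) - (x - m) by abel, inner_sub_right, hx,
          hxm, inner_smul_right, hn]
        simp
      refine ⟨range fun θ : ℝ => m + (Real.cos θ • (x - m) + Real.sin θ • (v - u)),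
        isPreconnected_range (by fun_prop), ⟨0, by simp⟩, ⟨Real.pi, ?_⟩, ?_⟩
      · simp only [Real.cos_pi, Real.sin_pi, m, midpoint_eq_smul_add]
        norm_num
        module
      · rintro _ ⟨θ, rfl⟩ ⟨h1, h2⟩
        rw [hdist] at h1 h2
        rw [add_sub_cancel_left, inner_add_right, inner_smul_right, inner_smul_right, hxm,
          inner_smul_right, ← neg_sub x y, inner_neg_left, inner_neg_left,
          real_inner_comm (v - u), hn] at h1
        rw [add_sub_right_comm, inner_add_right, hmn, inner_add_right, inner_smul_right, hxm,
          inner_smul_right, hn, inner_smul_right] at h2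
        have h3 : 0 < ⟪x - y, x - y⟫_ℝ := real_inner_self_pos.2 (sub_ne_zero.2 hxy)
        have h4 : 0 < ⟪v - u, v - u⟫_ℝ := real_inner_self_pos.2 (sub_ne_zero.2 huv.symm)
        have h5 : Real.cos θ = 0 := by
          refine (mul_eq_zero.1 (?_ : Real.cos θ * ⟪x - y, x - y⟫_ℝ = 0)).resolve_right h3.ne'
          linarith
        have h6 : Real.sin θ = 0 := by
          refine (mul_eq_zero.1 (?_ : Real.sin θ * ⟪v - u, v - u⟫_ℝ = 0)).resolve_right h4.ne'
          linarith
        have := Real.sin_sq_add_cos_sq θ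
        rw [h5, h6] at this
        norm_num at this) (fun x y => by
      refine Convex.isPreconnected ?_
      have h : {z | dist z x < dist z y} = {z : E | ⟪x - y, midpoint ℝ x y⟫_ℝ < ⟪x - y, z⟫_ℝ} := by
        ext z
        rw [mem_ofPred_eq, mem_ofPred_eq, ← not_le, dist_le_dist_iff, not_le, midpoint_comm,
          inner_sub_right, sub_pos]
      rw [h]
      exact convex_halfSpace_gt (innerSL ℝ (x - y)).isLinear _)
  have hn : 0 < ‖y - x‖ := norm_pos_iff.2 (sub_ne_zero.2 hxy.symm)
  refine ⟨‖y - x‖⁻¹ • (y - x), midpoint ℝ x y, ?_, ?_⟩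
  · rw [norm_smul, norm_inv, norm_norm, inv_mul_cancel₀ hn.ne']
  · ext z
    rw [mem_ofPred_eq, mem_ofPred_eq, dist_le_dist_iff, real_inner_smul_left, inv_mul_le_iff₀ hn,
      mul_zero]

theorem not_isHypersphere (C : Set E) (lam : ℝ) : ¬ IsHypersphere C lam := by
  rintro ⟨hlam, ⟨P, hP, rfl⟩, hne⟩
  obtain ⟨n, p, hn, rfl⟩ := exists_eq_of_isHalfspace hP
  have hn0 : n ≠ 0 := norm_ne_zero_iff.1 (by rw [hn]; exact one_ne_zero)
  have hnn : ⟪n, n⟫_ℝ = 1 := by rw [real_inner_self_eq_norm_sq, hn, one_pow]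
  have hset : {x | infDist x {z | ⟪n, z - p⟫_ℝ ≤ 0} ≤ lam} =
      innerSL ℝ n ⁻¹' Iic (⟪n, p⟫_ℝ + lam) := by
    ext z
    simp only [mem_ofPred_eq, mem_preimage, mem_Iic, innerSL_apply_apply]
    constructor
    · intro h
      refine le_of_forall_pos_le_add fun δ hδ => ?_
      obtain ⟨q, hq, hzq⟩ := (infDist_lt_iff ⟨p, by simp⟩).1 (lt_of_le_of_lt h
        (lt_add_of_pos_right lam hδ))
      have h1 := real_inner_le_norm n (z - q)
      rw [hn, one_mul, ← dist_eq_norm, inner_sub_right] at h1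
      rw [mem_ofPred_eq, inner_sub_right] at hq
      linarith
    · intro h
      have h1 : z - lam • n ∈ {z | ⟪n, z - p⟫_ℝ ≤ 0} := by
        rw [mem_ofPred_eq, inner_sub_right, inner_sub_right, inner_smul_right, hnn]
        linarith
      refine (infDist_le_dist_of_mem h1).trans_eq ?_
      rw [dist_eq_norm, sub_sub_cancel, norm_smul, hn, mul_one, Real.norm_of_nonneg hlam.le]
  apply hne
  obtain ⟨σ, hσ, -, hfix⟩ := exists_reflection (p + lam • n) hn0
  refine ⟨σ, hσ, ?_⟩
  have hsurj : Function.Surjective (innerSL ℝ n) := fun c => ⟨c • n, by simp [hn]⟩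
  have hopen : IsOpenMap (innerSL ℝ n) :=
    LinearMap.isOpenMap_of_finiteDimensional (innerSL ℝ n).toLinearMap hsurj
  rw [hset, ← hopen.preimage_frontier_eq_frontier_preimage (innerSL ℝ n).continuous, frontier_Iic]
  ext z
  simp only [mem_ofPred_eq, mem_preimage, mem_singleton_iff, innerSL_apply_apply]
  rw [hfix, inner_sub_right, inner_add_right, inner_smul_right, hnn, mul_one, sub_eq_zero]

theorem symmetricIfSmall_hypersphere (ε : ℝ) {K L : Set E} {lam : ℝ}
    (h : ∀ C ∈ bdryComponents K, IsHypersphere C lam) : SymmetricIfSmall ε K L :=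
  fun x hx => absurd (h _ ⟨x, hx, rfl⟩) (not_isHypersphere _ _)

end Euclid

open Topology in
theorem isInducing_of_tendsto {V : Type*} [TopologicalSpace V] {e : X → V} (he : Continuous e)
    (h : ∀ x, Tendsto (fun y => dist y x) (comap e (𝓝 (e x))) (𝓝 0)) : Topology.IsInducing e := by
  refine Topology.isInducing_iff_nhds.2 fun x => le_antisymm he.continuousAt.le_comap ?_
  exact (tendsto_iff_dist_tendsto_zero (f := fun y : X => y)).2 (h x)

open InnerProductSpace in
theorem btw_of_arccos {E : Type*} [NormedAddCommGroup E] [InnerProductSpace ℝ E] {e : X → E}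
    (he : ∀ x, ⟪e x, e x⟫_ℝ = 1) (hd : ∀ x y, dist x y = Real.arccos ⟪e x, e y⟫_ℝ)
    {x y z : X} {α β : ℝ} (hα : 0 ≤ α) (hβ : 0 ≤ β) (hz : e z = α • e x + β • e y) :
    Btw x z y := by
  have hcos : ∀ u v, Real.cos (dist u v) = ⟪e u, e v⟫_ℝ := fun u v => by
    have h := real_inner_mul_inner_self_le (e u) (e v)
    rw [he, he, mul_one] at h
    rw [hd, Real.cos_arccos (by nlinarith) (by nlinarith)]
  have hpi : ∀ u v, dist u v ≤ Real.pi := fun u v => hd u v ▸ Real.arccos_le_pi _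
  have hsin0 : ∀ u v, 0 ≤ Real.sin (dist u v) := fun u v =>
    Real.sin_nonneg_of_nonneg_of_le_pi dist_nonneg (hpi u v)
  set D := dist x y
  have ha : Real.cos (dist x z) = α + β * Real.cos D := by
    rw [hcos, hcos, hz, inner_add_right, inner_smul_right, inner_smul_right, he, mul_one]
  have hb : Real.cos (dist z y) = α * Real.cos D + β := by
    rw [hcos, hcos, hz, inner_add_left, real_inner_smul_left, real_inner_smul_left, he, mul_one]
  have h1 : α ^ 2 + β ^ 2 + 2 * α * β * Real.cos D = 1 := by
    have h := he z
    have h' := hcos x y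
    rw [hz, inner_add_left, inner_add_right, inner_add_right] at h
    simp only [inner_smul_right, real_inner_smul_left, he, real_inner_comm (e x) (e y)] at h
    rw [h']
    linarith
  have hD := Real.sin_sq_add_cos_sq D
  have hsa : Real.sin (dist x z) = β * Real.sin D := by
    rw [← sq_eq_sq₀ (hsin0 _ _) (mul_nonneg hβ (hsin0 _ _)), Real.sin_sq, ha]
    linear_combination -h1 - β ^ 2 * hD
  have hsb : Real.sin (dist z y) = α * Real.sin D := by
    rw [← sq_eq_sq₀ (hsin0 _ _) (mul_nonneg hα (hsin0 _ _)), Real.sin_sq, hb]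
    linear_combination -h1 - α ^ 2 * hD
  have hle : dist x z + dist z y ≤ Real.pi := by
    by_contra! h
    have h2 := Real.cos_lt_cos_of_nonneg_of_le_pi (x := Real.pi - dist z y) (y := dist x z)
      (by linarith [hpi z y]) (hpi x z) (by linarith)
    rw [Real.cos_pi_sub, ha, hb] at h2
    have h3 := mul_nonneg (add_nonneg hα hβ)
      (by linarith [Real.neg_one_le_cos D] : 0 ≤ 1 + Real.cos D)
    linarith
  refine Real.injOn_cos ⟨by positivity, hle⟩ ⟨dist_nonneg, hpi x y⟩ ?_
  rw [Real.cos_add, ha, hb, hsa, hsb]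
  linear_combination Real.cos D * h1 - α * β * hD

open InnerProductSpace Topology in
theorem IsSphereSpace.nonempty_quadricModel {d : ℕ} (hd : 2 ≤ d) (hX : IsSphereSpace X d) :
    Nonempty (QuadricModel X (EuclideanSpace ℝ (Fin (d + 1)))) := by
  obtain ⟨e, -, hr, hdist⟩ := hX
  have hself : ∀ x, ⟪e x, e x⟫_ℝ = 1 := fun x => by
    have h : e x ∈ sphere (0 : EuclideanSpace ℝ (Fin (d + 1))) 1 := hr ▸ mem_range_self x
    rw [real_inner_self_eq_norm_sq, mem_sphere_zero_iff_norm.1 h, one_pow]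
  have hI : ∀ x y, ⟪e x, e y⟫_ℝ ∈ Icc (-1 : ℝ) 1 := fun x y => by
    have h := real_inner_mul_inner_self_le (e x) (e y)
    rw [hself, hself, mul_one] at h
    constructor <;> nlinarith
  have hcos : ∀ x y, Real.cos (dist x y) = ⟪e x, e y⟫_ℝ := fun x y => by
    rw [hdist, Real.cos_arccos (hI x y).1 (hI x y).2]
  have hind : IsInducing e := by
    refine isInducing_of_tendsto (continuous_iff_continuousAt.2 fun x => ?_) fun x => ?_
    · refine tendsto_iff_norm_sub_tendsto_zero.2 ?_
      have h : ∀ y, ‖e y - e x‖ = √(2 - 2 * Real.cos (dist y x)) := fun y => by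
        rw [hcos, ← Real.sqrt_sq (norm_nonneg (e y - e x)), ← real_inner_self_eq_norm_sq,
          real_inner_sub_sub_self, hself, hself]
        congr 1; ring
      simp only [h]
      have hc : Continuous fun y => √(2 - 2 * Real.cos (dist y x)) := by fun_prop
      simpa using hc.tendsto x
    · simp only [hdist]
      have hc : Continuous fun v : EuclideanSpace ℝ (Fin (d + 1)) => Real.arccos ⟪v, e x⟫_ℝ := by
        fun_prop
      have h := hc.tendsto (e x)
      rw [hself, Real.arccos_one] at h
      exact h.comp tendsto_comap
  refine ⟨{
    k := 1
    B := innerₗ _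
    e := e
    hk := Or.inl rfl
    symm := fun u v => real_inner_comm v u
    ind := hind
    self := hself
    pos := fun _ τ _ hτ => real_inner_self_pos.2 hτ
    mem := fun v _ hv _ => ?_
    neg := fun h => absurd h (by norm_num)
    dist_le := fun x y z w => ?_
    btw := fun x y z α β hα hβ hz => btw_of_arccos hself hdist hα hβ hz
    dim := by rw [finrank_euclideanSpace_fin]; omega
    proper := ?_
    arccos := fun _ x y => hdist x y
    cosh := fun h => absurd h (by norm_num) }⟩
  · change v ∈ range e
    rw [hr, mem_sphere_zero_iff_norm, ← sq_eq_sq₀ (norm_nonneg _) zero_le_one,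
      ← real_inner_self_eq_norm_sq, one_pow]
    exact hv
  · rw [hdist, hdist, innerₗ_apply_apply, innerₗ_apply_apply]
    exact Real.strictAntiOn_arccos.le_iff_ge (hI x y) (hI z w)
  · have : CompactSpace X := ⟨by
      rw [hind.isCompact_iff, image_univ, hr]
      exact isCompact_sphere _ _⟩
    infer_instance

/-- The Minkowski form as a bilinear map. -/
noncomputable def minkBilin (d : ℕ) :
    EuclideanSpace ℝ (Fin d) × ℝ →ₗ[ℝ] EuclideanSpace ℝ (Fin d) × ℝ →ₗ[ℝ] ℝ :=
  LinearMap.mk₂ ℝ (mink d)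
    (fun u v w => by simp only [mink, Prod.fst_add, Prod.snd_add, inner_add_left]; ring)
    (fun c u v => by
      simp only [mink, Prod.smul_fst, Prod.smul_snd, real_inner_smul_left, smul_eq_mul]; ring)
    (fun u v w => by simp only [mink, Prod.fst_add, Prod.snd_add, inner_add_right]; ring)
    (fun c u v => by
      simp only [mink, Prod.smul_fst, Prod.smul_snd, real_inner_smul_right, smul_eq_mul]; ring)

theorem btw_of_cosh {d : ℕ} {e : X → EuclideanSpace ℝ (Fin d) × ℝ}
    (hd : ∀ x y, Real.cosh (dist x y) = -mink d (e x) (e y))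
    {x y z : X} {α β : ℝ} (hα : 0 ≤ α) (hβ : 0 ≤ β) (hz : e z = α • e x + β • e y) :
    Btw x z y := by
  have hB : ∀ u v, minkBilin d (e u) (e v) = -Real.cosh (dist u v) := fun u v => by
    rw [hd, neg_neg]; rfl
  have hself : ∀ u, minkBilin d (e u) (e u) = -1 := fun u => by rw [hB]; simp
  have hsinh0 : ∀ u v : X, 0 ≤ Real.sinh (dist u v) := fun u v => Real.sinh_nonneg_iff.2 dist_nonneg
  have hyx := hB y x
  have hxy := hB x y
  rw [dist_comm] at hyx
  set D := dist x y
  have ha : Real.cosh (dist x z) = α + β * Real.cosh D := by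
    rw [← neg_neg (Real.cosh _), ← hB, hz, map_add, map_smul, map_smul, hself, hxy, smul_eq_mul,
      smul_eq_mul]
    ring
  have hb : Real.cosh (dist z y) = α * Real.cosh D + β := by
    rw [← neg_neg (Real.cosh _), ← hB, hz, map_add, map_smul, map_smul, LinearMap.add_apply,
      LinearMap.smul_apply, LinearMap.smul_apply, hself, hxy, smul_eq_mul, smul_eq_mul]
    ring
  have h1 : α ^ 2 + β ^ 2 + 2 * α * β * Real.cosh D = 1 := by
    have h := hself z
    simp only [hz, map_add, map_smul, LinearMap.add_apply, LinearMap.smul_apply, hself, hxy, hyx,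
      smul_eq_mul] at h
    linarith
  have hD := Real.cosh_sq D
  have hsa : Real.sinh (dist x z) = β * Real.sinh D := by
    rw [← sq_eq_sq₀ (hsinh0 _ _) (mul_nonneg hβ (hsinh0 _ _)), Real.sinh_sq, ha]
    linear_combination h1 + β ^ 2 * hD
  have hsb : Real.sinh (dist z y) = α * Real.sinh D := by
    rw [← sq_eq_sq₀ (hsinh0 _ _) (mul_nonneg hα (hsinh0 _ _)), Real.sinh_sq, hb]
    linear_combination h1 + α ^ 2 * hD
  refine Real.cosh_strictMonoOn.injOn (mem_Ici.2 (by positivity)) (mem_Ici.2 dist_nonneg) ?_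
  rw [Real.cosh_add, ha, hb, hsa, hsb]
  linear_combination Real.cosh D * h1 - α * β * hD

open InnerProductSpace in
theorem mink_self_pos {d : ℕ} {u τ : EuclideanSpace ℝ (Fin d) × ℝ} (hu : mink d u u = -1)
    (h : mink d u τ = 0) (hτ : τ ≠ 0) : 0 < mink d τ τ := by
  have hcs := real_inner_mul_inner_self_le u.1 τ.1
  simp only [mink] at hu h ⊢
  rw [real_inner_self_eq_norm_sq] at *
  rw [real_inner_self_eq_norm_sq] at *
  have hu1 : 1 ≤ u.2 ^ 2 := by nlinarith [sq_nonneg ‖u.1‖]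
  have hin : ⟪u.1, τ.1⟫_ℝ = u.2 * τ.2 := by linarith
  rw [hin] at hcs
  have h1 : ‖τ.1‖ ^ 2 ≤ u.2 ^ 2 * (‖τ.1‖ ^ 2 - τ.2 * τ.2) := by nlinarith
  rcases (sq_nonneg ‖τ.1‖).eq_or_lt with h0 | h0
  · exfalso
    have h2 : τ.1 = 0 := norm_eq_zero.1 (pow_eq_zero_iff two_ne_zero |>.1 h0.symm)
    rw [h2, inner_zero_right] at hin
    rcases mul_eq_zero.1 hin.symm with h3 | h3
    · rw [h3] at hu1; norm_num at hu1
    · exact hτ (Prod.ext h2 h3)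
  · by_contra! h3
    nlinarith

open InnerProductSpace in
theorem snd_pos_of_mink_neg {d : ℕ} {u v : EuclideanSpace ℝ (Fin d) × ℝ} (hu : mink d u u = -1)
    (hu0 : 0 < u.2) (hv : mink d v v = -1) (h : mink d v u < 0) : 0 < v.2 := by
  by_contra! hv0
  have hcs := real_inner_mul_inner_self_le v.1 u.1
  simp only [mink] at hu hv h
  have h1 : 0 ≤ -v.2 * u.2 := mul_nonneg (by linarith) hu0.le
  have h2 : (v.2 * u.2) * (v.2 * u.2) ≤ ⟪v.1, u.1⟫_ℝ * ⟪v.1, u.1⟫_ℝ := by nlinarith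
  have h3 : 0 ≤ ⟪v.1, v.1⟫_ℝ := real_inner_self_nonneg
  rw [show ⟪v.1, v.1⟫_ℝ = v.2 * v.2 - 1 by linarith,
    show ⟪u.1, u.1⟫_ℝ = u.2 * u.2 - 1 by linarith] at hcs
  nlinarith [mul_pos hu0 hu0]

open InnerProductSpace Topology in
theorem IsHyperbolicSpace.nonempty_quadricModel {d : ℕ} (hd : 2 ≤ d) (hX : IsHyperbolicSpace X d) :
    Nonempty (QuadricModel X (EuclideanSpace ℝ (Fin d) × ℝ)) := by
  obtain ⟨e, -, hr, hcosh⟩ := hX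
  have hmem : ∀ x, mink d (e x) (e x) = -1 ∧ 0 < (e x).2 := fun x => by
    have h : e x ∈ {u | mink d u u = -1 ∧ 0 < u.2} := hr ▸ mem_range_self x
    exact h
  obtain ⟨o, ho⟩ : ((0, 1) : EuclideanSpace ℝ (Fin d) × ℝ) ∈ range e := by
    rw [hr]; simp [mink]
  have hsnd : ∀ x, (e x).2 = Real.cosh (dist x o) := fun x => by
    rw [hcosh, ho]; simp [mink]
  have hind : IsInducing e := by
    refine isInducing_of_tendsto (Continuous.prodMk (f := fun x => (e x).1) (g := fun x => (e x).2)
      (continuous_iff_continuousAt.2 fun x => ?_) ?_) fun x => ?_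
    · refine tendsto_iff_norm_sub_tendsto_zero.2 ?_
      have h : ∀ y, ‖(e y).1 - (e x).1‖ =
          √(2 * Real.cosh (dist y x) - 2 + (Real.cosh (dist y o) - Real.cosh (dist x o)) ^ 2) :=
          fun y => by
        rw [hcosh, ← hsnd, ← hsnd, ← Real.sqrt_sq (norm_nonneg ((e y).1 - (e x).1)),
          ← real_inner_self_eq_norm_sq, real_inner_sub_sub_self]
        congr 1
        have h1 := (hmem x).1
        have h2 := (hmem y).1
        simp only [mink] at h1 h2 ⊢
        linear_combination h1 + h2
      simp only [h]
      have hc : Continuous fun y => √(2 * Real.cosh (dist y x) - 2 +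
          (Real.cosh (dist y o) - Real.cosh (dist x o)) ^ 2) := by fun_prop
      simpa using hc.tendsto x
    · simp only [hsnd]
      fun_prop
    · have h : ∀ y, dist y x = Real.arcosh (-mink d (e y) (e x)) := fun y => by
        rw [← hcosh, Real.arcosh_cosh dist_nonneg]
      simp only [h]
      have h1 : Tendsto (fun y => -mink d (e y) (e x)) (comap e (𝓝 (e x))) (𝓝[Ici 1] 1) := by
        refine tendsto_nhdsWithin_iff.2 ⟨?_, Eventually.of_forall fun y => ?_⟩
        · have hc : Continuous fun v => -mink d v (e x) := by unfold mink; fun_prop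
          have h2 := hc.tendsto (e x)
          rw [(hmem x).1, neg_neg] at h2
          exact h2.comp tendsto_comap
        · rw [← hcosh]; exact Real.one_le_cosh _
      have h2 := (Real.continuousOn_arcosh 1 (by simp)).tendsto
      rw [Real.arcosh_zero] at h2
      exact h2.comp h1
  refine ⟨{
    k := -1
    B := minkBilin d
    e := e
    hk := Or.inr rfl
    symm := fun u v => by
      change mink d u v = mink d v u
      simp only [mink, real_inner_comm, mul_comm]
    ind := hind
    self := fun x => (hmem x).1
    pos := fun x τ h hτ => mink_self_pos (hmem x).1 h hτ
    mem := fun v x hv h => by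
      change v ∈ range e
      rw [hr]
      exact ⟨hv, snd_pos_of_mink_neg (hmem x).1 (hmem x).2 hv (h rfl)⟩
    neg := fun _ x y => by
      change mink d _ _ < 0
      linarith [hcosh x y, Real.cosh_pos (dist x y)]
    dist_le := fun x y z w => by
      change _ ↔ mink d _ _ ≤ mink d _ _
      rw [← neg_le_neg_iff (b := mink d (e z) (e w)), ← hcosh, ← hcosh, Real.cosh_le_cosh,
        abs_dist, abs_dist]
    btw := fun x y z α β hα hβ hz => btw_of_cosh hcosh hα hβ hz
    dim := by
      rw [Module.finrank_prod, finrank_euclideanSpace_fin, Module.finrank_self]; omega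
    proper := ?_
    arccos := fun h => absurd h (by norm_num)
    cosh := fun _ x y => hcosh x y }⟩
  refine ProperSpace.of_seq_closedBall (x := o) tendsto_id (Eventually.of_forall fun R => ?_)
  refine IsCompact.of_isClosed_subset (s := e ⁻¹' {u | u.2 ≤ Real.cosh R}) ?_ isClosed_closedBall
    fun x hx => ?_
  · rw [hind.isCompact_iff, image_preimage_eq_range_inter, hr]
    have hset : {u | mink d u u = -1 ∧ 0 < u.2} ∩ {u | u.2 ≤ Real.cosh R} =
        {u | mink d u u = -1} ∩ {u | 0 ≤ u.2} ∩ {u | u.2 ≤ Real.cosh R} := by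
      ext u
      refine ⟨fun h => ⟨⟨h.1.1, h.1.2.le⟩, h.2⟩, fun h => ⟨⟨h.1.1, ?_⟩, h.2⟩⟩
      refine lt_of_le_of_ne h.1.2 fun h0 => ?_
      have h1 : mink d u u = -1 := h.1.1
      rw [mink, ← h0] at h1
      have h2 : 0 ≤ ⟪u.1, u.1⟫_ℝ := real_inner_self_nonneg
      linarith
    rw [hset]
    refine isCompact_of_isClosed_isBounded (((isClosed_eq ?_ continuous_const).inter
      (isClosed_le continuous_const continuous_snd)).inter
      (isClosed_le continuous_snd continuous_const)) (isBounded_closedBall.subset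
      (t := closedBall 0 (Real.cosh R)) fun u hu => ?_)
    · unfold mink; fun_prop
    · obtain ⟨⟨h1, h2⟩, h3⟩ := hu
      simp only [mem_ofPred_eq, mink, real_inner_self_eq_norm_sq] at h1 h2 h3
      rw [mem_closedBall_zero_iff, Prod.norm_def]
      refine max_le ?_ (by rwa [Real.norm_of_nonneg h2])
      refine abs_le_of_sq_le_sq' ?_ (Real.cosh_pos R).le |>.2
      nlinarith
  · rw [mem_preimage, mem_ofPred_eq, hsnd, Real.cosh_le_cosh, abs_dist]
    exact (mem_closedBall.1 hx).trans (le_abs_self R)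

theorem QuadricModel.t6Cond3 {V : Type*} [NormedAddCommGroup V] [NormedSpace ℝ V]
    [FiniteDimensional ℝ V] (M : QuadricModel X V) {d : ℕ} {K L : Set X} (hKcl : IsClosed K)
    (hLcl : IsClosed L) (hKcv : GConvex K) (hLcv : GConvex L) (h4 : T6Cond4 d K L) :
    T6Cond3 K L := by
  rcases h4 with ⟨r, -, -, -, ⟨p, rfl⟩, q, rfl⟩ | ⟨-, hK, hL⟩ | ⟨lam, hlam, h⟩
  · refine t6Cond3_of_symmetricIfSmall one_pos fun φ ψ => ?_
    rw [φ.image_closedBall, ψ.image_closedBall]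
    exact M.symmetricIfSmall_closedBall 1 _ _ r
  · exact t6Cond3_of_symmetricIfSmall one_pos fun φ ψ =>
      M.symmetricIfSmall_paraball 1 (hK.image φ) (hL.image ψ)
  · exact t6Cond3_of_symmetricIfSmall hlam fun φ ψ =>
      M.symmetricIfSmall_hypersphere hlam (φ.toHomeomorph.isClosed_image.2 hKcl)
        (ψ.toHomeomorph.isClosed_image.2 hLcl) (hKcv.image φ) (hLcv.image ψ)
        (isHypersphere_bdryComponents_image (fun C hC => h C (Or.inl hC)) φ)
        (isHypersphere_bdryComponents_image (fun C hC => h C (Or.inr hC)) ψ)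

theorem Euclid.t6Cond3 {E : Type*} [NormedAddCommGroup E] [InnerProductSpace ℝ E]
    (hE : 2 ≤ Module.finrank ℝ E) (f : X ≃ᵢ E) {d : ℕ} {K L : Set X} (h4 : T6Cond4 d K L) :
    T6Cond3 K L := by
  rcases h4 with ⟨r, -, -, -, ⟨p, rfl⟩, q, rfl⟩ | ⟨-, hK, hL⟩ | ⟨lam, hlam, h⟩
  · refine t6Cond3_of_symmetricIfSmall one_pos fun φ ψ => .of_image f ?_
    rw [φ.image_closedBall, ψ.image_closedBall, f.image_closedBall, f.image_closedBall]
    exact symmetricIfSmall_closedBall 1 _ _ r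
  · exact t6Cond3_of_symmetricIfSmall one_pos fun φ ψ => .of_image f <|
      symmetricIfSmall_paraball hE 1 ((hK.image φ).image f) ((hL.image ψ).image f)
  · exact t6Cond3_of_symmetricIfSmall one_pos fun φ ψ => .of_image f <|
      symmetricIfSmall_hypersphere 1 (isHypersphere_bdryComponents_image
        (isHypersphere_bdryComponents_image (fun C hC => h C (Or.inl hC)) φ) f)

/-- **Lemma 6.1** ((4) ⟹ (3) in Theorem 6). If the connected components of the
boundaries of `K` and `L` are congruent spheres (for `S^d` of radius at most `π/2`),
paraspheres, or congruent hyperspheres (hyperplanes excluded) — with `K`, `L`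
congruent balls, resp. paraballs, in the first two cases — then condition (3) of
Theorem 6 holds: all sufficiently small intersections of congruent copies satisfying
(A), (B), (C) are symmetric with respect to the orthogonal bisector hyperplane of
`[φx, ψy]`. -/
theorem lemma6_1
    (d : ℕ) (hd : 2 ≤ d)
    (X : Type*) [MetricSpace X] (hX : IsSpaceForm X d)
    (K L : Set X)
    (hKcl : IsClosed K) (hLcl : IsClosed L)
    (hKcv : GConvex K) (hLcv : GConvex L)
    (hKint : (interior K).Nonempty) (hLint : (interior L).Nonempty)
    (hKpr : K ≠ univ) (hLpr : L ≠ univ)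
    (h4 : T6Cond4 d K L) :
    T6Cond3 K L := by
  rcases hX with hX | ⟨⟨f⟩⟩ | hX
  · obtain ⟨M⟩ := hX.nonempty_quadricModel hd
    exact M.t6Cond3 hKcl hLcl hKcv hLcv h4
  · exact Euclid.t6Cond3 (by rwa [finrank_euclideanSpace_fin]) f h4
  · obtain ⟨M⟩ := hX.nonempty_quadricModel hd
    exact M.t6Cond3 hKcl hLcl hKcv hLcv h4

end BallChar
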